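/- Assume that for every degree m ≤ n, every GC_m set possesses a maximal line (the GM conjecture up to degree n). Let X be a GC_n set and let ℓ be a k-node line of X with 2 ≤ k ≤ n+1 such that X_ℓ ≠ ∅. Then there exists an integer s with 2k − n − 1 ≤ s ≤ k and s ≥ 2 such that |X_ℓ| = binomial(s,2) and the set X_ℓ is itself a GC_{s−2} set. -/

import Mathlib

open MvPolynomial

/-- Bivariate real polynomials. -/
abbrev Poly2 : Type := MvPolynomial (Fin 2) ℝ

/-- Evaluation of a bivariate polynomial at a point of `ℝ²`. -/
noncomputable def evalPt (p : Poly2) (A : ℝ × ℝ) : ℝ :=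
  MvPolynomial.eval (fun i => if i = 0 then A.1 else A.2) p

/-- `X` is an `n`-poised set: it has `(n+2 choose 2)` nodes and the only polynomial of
total degree at most `n` vanishing on all of `X` is the zero polynomial. -/
def IsPoised (n : ℕ) (X : Finset (ℝ × ℝ)) : Prop :=
  X.card = (n + 2).choose 2 ∧
    ∀ p : Poly2, p.totalDegree ≤ n → (∀ A ∈ X, evalPt p A = 0) → p = 0

/-- `p` is an `n`-fundamental polynomial of the node `A` with respect to `X`. -/
def IsFund (n : ℕ) (X : Finset (ℝ × ℝ)) (A : ℝ × ℝ) (p : Poly2) : Prop :=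
  p.totalDegree ≤ n ∧ evalPt p A = 1 ∧ ∀ B ∈ X, B ≠ A → evalPt p B = 0

/-- `X` is a `GC_n` set: `n`-poised and each node has a fundamental polynomial which is
a product of `n` polynomials of degree 1. -/
def IsGC (n : ℕ) (X : Finset (ℝ × ℝ)) : Prop :=
  IsPoised n X ∧
    ∀ A ∈ X, ∃ p : Poly2, IsFund n X A p ∧
      ∃ f : Fin n → Poly2, (∀ i, (f i).totalDegree = 1) ∧ p = ∏ i, f i

/-- The nodes of `X` lying on the zero set of `ℓ`. -/
noncomputable def nodesOn (X : Finset (ℝ × ℝ)) (ℓ : Poly2) : Finset (ℝ × ℝ) :=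
  @Finset.filter _ (fun A => evalPt ℓ A = 0) (Classical.decPred _) X

/-- `ℓ` is a `k`-node line of `X`: it has degree exactly 1 and passes through exactly
`k` nodes of `X`. -/
def IsKNodeLine (X : Finset (ℝ × ℝ)) (ℓ : Poly2) (k : ℕ) : Prop :=
  ℓ.totalDegree = 1 ∧ (nodesOn X ℓ).card = k

/-- A maximal line of an `n`-poised set: an `(n+1)`-node line. -/
def IsMaximalLine (n : ℕ) (X : Finset (ℝ × ℝ)) (ℓ : Poly2) : Prop :=
  IsKNodeLine X ℓ (n + 1)

/-- The zero set of a polynomial, i.e. the line it determines when it has degree 1. -/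
def zeroSet (ℓ : Poly2) : Set (ℝ × ℝ) := {A | evalPt ℓ A = 0}

/-- `μ(X)`: the number of maximal lines (as subsets of the plane) of `X`. -/
noncomputable def mu (n : ℕ) (X : Finset (ℝ × ℝ)) : ℕ :=
  {L : Set (ℝ × ℝ) | ∃ ℓ : Poly2, IsMaximalLine n X ℓ ∧ L = zeroSet ℓ}.ncard

/-- The node `A` of `X` uses the line `ℓ`: `ℓ` divides a fundamental polynomial of `A`. -/
def Uses (n : ℕ) (X : Finset (ℝ × ℝ)) (ℓ : Poly2) (A : ℝ × ℝ) : Prop :=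
  ∃ p : Poly2, IsFund n X A p ∧ ℓ ∣ p

/-- `X_ℓ`: the set of nodes of `X` using the line `ℓ`. -/
noncomputable def usesSet (n : ℕ) (X : Finset (ℝ × ℝ)) (ℓ : Poly2) : Finset (ℝ × ℝ) :=
  @Finset.filter _ (Uses n X ℓ) (Classical.decPred _) X

/-- The Gasca–Maeztu conjecture for degree `m`: every `GC_m` set has a maximal line. -/
def GM (m : ℕ) : Prop :=
  ∀ Y : Finset (ℝ × ℝ), IsGC m Y → ∃ lam : Poly2, IsMaximalLine m Y lam


namespace GCW
open Classical

abbrev Pt := ℝ × ℝ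

def IsLine (L : Set Pt) : Prop :=
  ∃ a b c : ℝ, (a ≠ 0 ∨ b ≠ 0) ∧ L = {P | a * P.1 + b * P.2 + c = 0}

theorem line_unique {L M : Set Pt} (hL : IsLine L) (hM : IsLine M) {P Q : Pt} (hPQ : P ≠ Q)
    (h1 : P ∈ L) (h2 : Q ∈ L) (h3 : P ∈ M) (h4 : Q ∈ M) : L = M := by
  obtain ⟨a, b, c, hab, rfl⟩ := hL
  obtain ⟨a', b', c', hab', rfl⟩ := hM
  simp only [Set.mem_ofPred_eq] at h1 h2 h3 h4
  have hd : P.1 - Q.1 ≠ 0 ∨ P.2 - Q.2 ≠ 0 := by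
    by_contra! h
    exact hPQ (Prod.ext (by linarith [h.1]) (by linarith [h.2]))
  have e1 : a * (P.1 - Q.1) + b * (P.2 - Q.2) = 0 := by linarith
  have e2 : a' * (P.1 - Q.1) + b' * (P.2 - Q.2) = 0 := by linarith
  have hdet : a * b' - a' * b = 0 := by
    rcases hd with hd | hd
    · apply (mul_eq_zero.1 (?_ : (a * b' - a' * b) * (P.1 - Q.1) = 0)).resolve_right hd
      linear_combination b' * e1 - b * e2
    · apply (mul_eq_zero.1 (?_ : (a * b' - a' * b) * (P.2 - Q.2) = 0)).resolve_right hd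
      linear_combination a * e2 - a' * e1
  have key : ∀ a b a' b' c c' : ℝ, (a ≠ 0 ∨ b ≠ 0) → a * b' - a' * b = 0 →
      a * P.1 + b * P.2 + c = 0 → a' * P.1 + b' * P.2 + c' = 0 → ∀ R : Pt,
      a * R.1 + b * R.2 + c = 0 → a' * R.1 + b' * R.2 + c' = 0 := by
    intro a b a' b' c c' hab hdet h1 h3 R hR
    rcases hab with h | h
    · apply (mul_eq_zero.1 (?_ : a * (a' * R.1 + b' * R.2 + c') = 0)).resolve_left h
      linear_combination a' * hR - a' * h1 + a * h3 + hdet * (R.2 - P.2)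
    · apply (mul_eq_zero.1 (?_ : b * (a' * R.1 + b' * R.2 + c') = 0)).resolve_left h
      linear_combination b' * hR - b' * h1 + b * h3 - hdet * (R.1 - P.1)
  ext R
  exact ⟨key a b a' b' c c' hab hdet h1 h3 R,
    key a' b' a b c' c hab' (by linarith) h3 h1 R⟩

theorem line_pts {L : Set Pt} (hL : IsLine L) (m : ℕ) :
    ∃ F : Finset Pt, (∀ P ∈ F, P ∈ L) ∧ F.card = m := by
  obtain ⟨a, b, c, hab, rfl⟩ := hL
  have hD : a ^ 2 + b ^ 2 ≠ 0 := by
    rcases hab with h | h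
    · have := pow_pos (abs_pos.2 h) 2
      rw [sq_abs] at this; nlinarith [sq_nonneg b]
    · have := pow_pos (abs_pos.2 h) 2
      rw [sq_abs] at this; nlinarith [sq_nonneg a]
  let g : ℕ → Pt := fun t => (-a * c / (a^2+b^2) - b * t, -b * c / (a^2+b^2) + a * t)
  have hg : Function.Injective g := by
    intro s t h
    simp only [g, Prod.mk.injEq] at h
    rcases hab with h' | h'
    · have := h.2
      have : a * (s:ℝ) = a * t := by linarith
      exact_mod_cast mul_left_cancel₀ h' this
    · have := h.1
      have : b * (s:ℝ) = b * t := by linarith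
      exact_mod_cast mul_left_cancel₀ h' this
  refine ⟨(Finset.range m).image g, ?_, ?_⟩
  · intro P hP
    obtain ⟨t, -, rfl⟩ := Finset.mem_image.1 hP
    simp only [Set.mem_ofPred_eq, g]
    field_simp
    ring
  · rw [Finset.card_image_of_injective _ hg, Finset.card_range]

/-! Polynomials -/

noncomputable def lineP (a b c : ℝ) : Poly2 :=
  MvPolynomial.C a * MvPolynomial.X 0 + MvPolynomial.C b * MvPolynomial.X 1 + MvPolynomial.C c

@[simp] theorem evalPt_lineP (a b c : ℝ) (P : Pt) :
    evalPt (lineP a b c) P = a * P.1 + b * P.2 + c := by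
  simp [evalPt, lineP]

@[simp] theorem evalPt_mul (p q : Poly2) (P : Pt) : evalPt (p * q) P = evalPt p P * evalPt q P := by
  simp [evalPt]
@[simp] theorem evalPt_add (p q : Poly2) (P : Pt) : evalPt (p + q) P = evalPt p P + evalPt q P := by
  simp [evalPt]
@[simp] theorem evalPt_sub (p q : Poly2) (P : Pt) : evalPt (p - q) P = evalPt p P - evalPt q P := by
  simp [evalPt]
@[simp] theorem evalPt_C (c : ℝ) (P : Pt) : evalPt (MvPolynomial.C c) P = c := by
  simp [evalPt]
@[simp] theorem evalPt_zero (P : Pt) : evalPt 0 P = 0 := by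
  simp [evalPt]
@[simp] theorem evalPt_one (P : Pt) : evalPt 1 P = 1 := by
  simp [evalPt]

theorem exists_lineP_of_deg_le {p : Poly2} (h : p.totalDegree ≤ 1) :
    ∃ a b c, p = lineP a b c := by
  refine ⟨p.coeff (Finsupp.single 0 1), p.coeff (Finsupp.single 1 1), p.coeff 0, ?_⟩
  have hm : ∀ m : Fin 2 →₀ ℕ, m = 0 ∨ m = Finsupp.single 0 1 ∨ m = Finsupp.single 1 1 ∨
      1 < m.degree := by
    intro m
    have hd : m.degree = m 0 + m 1 := by
      simp [Finsupp.degree_eq_sum]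
    by_cases h0 : 1 < m 0 + m 1
    · right; right; right; omega
    · have : (m 0 = 0 ∧ m 1 = 0) ∨ (m 0 = 1 ∧ m 1 = 0) ∨ (m 0 = 0 ∧ m 1 = 1) := by omega
      rcases this with ⟨h1, h2⟩ | ⟨h1, h2⟩ | ⟨h1, h2⟩
      · left; ext i; fin_cases i <;> simp [h1, h2]
      · right; left; ext i; fin_cases i <;> simp [h1, h2]
      · right; right; left; ext i; fin_cases i <;> simp [h1, h2]
  have e01 : (Finsupp.single (0 : Fin 2) 1 : Fin 2 →₀ ℕ) ≠ Finsupp.single 1 1 := by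
    intro h; have := DFunLike.congr_fun h 0; simp at this
  have e0 : ∀ i : Fin 2, (0 : Fin 2 →₀ ℕ) ≠ Finsupp.single i 1 := by
    intro i h; have := DFunLike.congr_fun h i; simp at this
  ext m
  rcases hm m with rfl | rfl | rfl | hm
  · simp [lineP, MvPolynomial.coeff_C_mul, MvPolynomial.coeff_C]
  · simp [lineP, MvPolynomial.coeff_C_mul, MvPolynomial.coeff_C, MvPolynomial.coeff_X, e0, e01.symm]
  · simp [lineP, MvPolynomial.coeff_C_mul, MvPolynomial.coeff_C, MvPolynomial.coeff_X, e0, e01]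
  · rw [MvPolynomial.coeff_eq_zero_of_totalDegree_lt]
    · have h0 : (0 : Fin 2 →₀ ℕ) ≠ m := by rintro rfl; simp at hm
      have h1 : (Finsupp.single 0 1 : Fin 2 →₀ ℕ) ≠ m := by rintro rfl; simp at hm
      have h2 : (Finsupp.single 1 1 : Fin 2 →₀ ℕ) ≠ m := by rintro rfl; simp at hm
      simp [lineP, MvPolynomial.coeff_C_mul, MvPolynomial.coeff_C, MvPolynomial.coeff_X, h0, h1, h2]
    · rw [Finsupp.degree_apply] at hm
      omega

theorem lineP_deg_le (a b c : ℝ) : (lineP a b c).totalDegree ≤ 1 := by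
  unfold lineP
  refine (MvPolynomial.totalDegree_add _ _).trans (max_le ((MvPolynomial.totalDegree_add _ _).trans (max_le ?_ ?_)) ?_)
  · refine (MvPolynomial.totalDegree_mul _ _).trans ?_
    simp
  · refine (MvPolynomial.totalDegree_mul _ _).trans ?_
    simp
  · simp

theorem lineP_deg {a b c : ℝ} (h : a ≠ 0 ∨ b ≠ 0) : (lineP a b c).totalDegree = 1 := by
  refine le_antisymm (lineP_deg_le a b c) ?_
  by_contra hlt
  have h0 : (lineP a b c).totalDegree = 0 := by omega
  rw [MvPolynomial.totalDegree_eq_zero_iff_eq_C] at h0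
  have e : ∀ P : Pt, a * P.1 + b * P.2 + c = MvPolynomial.coeff 0 (lineP a b c) := by
    intro P
    rw [← evalPt_lineP, h0]; simp
  have e1 := e (0,0)
  have e2 := e (1,0)
  have e3 := e (0,1)
  simp at e1 e2 e3
  rcases h with h | h
  · exact h (by linarith)
  · exact h (by linarith)

theorem exists_lineP {p : Poly2} (h : p.totalDegree = 1) :
    ∃ a b c, (a ≠ 0 ∨ b ≠ 0) ∧ p = lineP a b c := by
  obtain ⟨a, b, c, rfl⟩ := exists_lineP_of_deg_le h.le
  refine ⟨a, b, c, ?_, rfl⟩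
  by_contra! hh
  obtain ⟨rfl, rfl⟩ := hh
  simp [lineP] at h

theorem isLine_zeroSet {p : Poly2} (h : p.totalDegree = 1) : IsLine (zeroSet p) := by
  obtain ⟨a, b, c, hab, rfl⟩ := exists_lineP h
  exact ⟨a, b, c, hab, by ext P; simp [zeroSet]⟩

theorem dvd_of_vanish {l p : Poly2} (hl : l.totalDegree = 1) {d : ℕ} (hp : p.totalDegree ≤ d)
    (F : Finset Pt) (hF : ∀ P ∈ F, evalPt l P = 0) (hc : d + 1 ≤ F.card)
    (hv : ∀ P ∈ F, evalPt p P = 0) : ∃ q, p = l * q ∧ (p = 0 ∨ q.totalDegree + 1 ≤ d) := by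
  have hdvd : l ∣ p := by
    obtain ⟨a, b, c, hab, rfl⟩ := exists_lineP hl
    have hD : a ^ 2 + b ^ 2 ≠ 0 := by
      rcases hab with h | h
      · have := pow_pos (abs_pos.2 h) 2
        rw [sq_abs] at this; nlinarith [sq_nonneg b]
      · have := pow_pos (abs_pos.2 h) 2
        rw [sq_abs] at this; nlinarith [sq_nonneg a]
    set D := a ^ 2 + b ^ 2 with hDdef
    let g : Fin 2 → Polynomial ℝ := fun i => if i = 0 then
      Polynomial.C (-a*c/D) - Polynomial.C b * Polynomial.X else
      Polynomial.C (-b*c/D) + Polynomial.C a * Polynomial.X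
    have hg : ∀ i, (g i).natDegree ≤ 1 := by
      intro i
      by_cases h : i = 0
      · simp only [g, h, if_true]
        compute_degree
      · simp only [g, h, if_false]
        compute_degree
    have hdeg := MvPolynomial.aeval_natDegree_le p hp g hg
    let t : Pt → ℝ := fun P => (a * P.2 - b * P.1) / D
    have ht : ∀ P ∈ F, P.1 = -a*c/D - b * t P ∧ P.2 = -b*c/D + a * t P := by
      intro P hP
      have := hF P hP
      simp at this
      simp only [t]
      constructor
      · field_simp
        rw [hDdef]; linear_combination a * this
      · field_simp
        rw [hDdef]; linear_combination b * this
    have hinj : Set.InjOn t F := by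
      intro P hP Q hQ h
      have h1 := ht P hP
      have h2 := ht Q hQ
      rw [h] at h1
      exact Prod.ext (h1.1.trans h2.1.symm) (h1.2.trans h2.2.symm)
    have hzero : MvPolynomial.aeval g p = 0 := by
      apply Polynomial.eq_zero_of_natDegree_lt_card_of_eval_eq_zero' _ (F.image t)
      · intro x hx
        obtain ⟨P, hP, rfl⟩ := Finset.mem_image.1 hx
        have := hv P hP
        rw [← this, evalPt]
        have hh := ht P hP
        have hcmp : (Polynomial.aeval (t P)).comp (MvPolynomial.aeval g) =
            (MvPolynomial.aeval (fun i : Fin 2 => if i = 0 then P.1 else P.2) : Poly2 →ₐ[ℝ] ℝ) := by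
          apply MvPolynomial.algHom_ext
          intro i
          fin_cases i
          · simp [g]; linear_combination -1 * hh.1
          · simp [g]; linear_combination -1 * hh.2
        have := DFunLike.congr_fun hcmp p
        simp only [AlgHom.comp_apply, Polynomial.coe_aeval_eq_eval, MvPolynomial.coe_aeval_eq_eval] at this
        simpa using this
      · rw [Finset.card_image_of_injOn hinj]
        omega
    let ψ : Polynomial ℝ →ₐ[ℝ] Poly2 := Polynomial.aeval
      ((MvPolynomial.C a * MvPolynomial.X 1 - MvPolynomial.C b * MvPolynomial.X 0) * MvPolynomial.C D⁻¹)
    let I : Ideal Poly2 := Ideal.span {lineP a b c}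
    have hcomp : ((Ideal.Quotient.mkₐ ℝ I).comp (ψ.comp (MvPolynomial.aeval g))) =
        Ideal.Quotient.mkₐ ℝ I := by
      apply MvPolynomial.algHom_ext
      intro i
      simp only [AlgHom.comp_apply, MvPolynomial.aeval_X, Ideal.Quotient.mkₐ_eq_mk]
      rw [Ideal.Quotient.eq, Ideal.mem_span_singleton]
      fin_cases i
      · refine ⟨MvPolynomial.C (-a/D), ?_⟩
        have hC : (MvPolynomial.C D⁻¹ : Poly2) * (MvPolynomial.C a ^ 2 + MvPolynomial.C b ^ 2) = 1 := by
          rw [← MvPolynomial.C_pow, ← MvPolynomial.C_pow, ← MvPolynomial.C_add, ← MvPolynomial.C_mul,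
            ← hDdef, inv_mul_cancel₀ hD, MvPolynomial.C_1]
        simp [g, ψ, lineP, div_eq_mul_inv, MvPolynomial.algebraMap_eq]
        linear_combination (MvPolynomial.X 0) * hC
      · refine ⟨MvPolynomial.C (-b/D), ?_⟩
        have hC : (MvPolynomial.C D⁻¹ : Poly2) * (MvPolynomial.C a ^ 2 + MvPolynomial.C b ^ 2) = 1 := by
          rw [← MvPolynomial.C_pow, ← MvPolynomial.C_pow, ← MvPolynomial.C_add, ← MvPolynomial.C_mul,
            ← hDdef, inv_mul_cancel₀ hD, MvPolynomial.C_1]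
        simp [g, ψ, lineP, div_eq_mul_inv, MvPolynomial.algebraMap_eq]
        linear_combination (MvPolynomial.X 1) * hC
    have := DFunLike.congr_fun hcomp p
    simp only [AlgHom.comp_apply, hzero, map_zero, Ideal.Quotient.mkₐ_eq_mk] at this
    rw [eq_comm, Ideal.Quotient.eq_zero_iff_mem, Ideal.mem_span_singleton] at this
    exact this
  obtain ⟨q, rfl⟩ := hdvd
  refine ⟨q, rfl, ?_⟩
  by_cases h : l * q = 0
  · exact Or.inl h
  · right
    have h1 : l ≠ 0 := left_ne_zero_of_mul h
    have h2 : q ≠ 0 := right_ne_zero_of_mul h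
    rw [MvPolynomial.totalDegree_mul_of_isDomain h1 h2, hl] at hp
    omega
end GCW

namespace GCW
open Classical

noncomputable def pol (L : Set Pt) : Poly2 :=
  if h : ∃ a b c : ℝ, (a ≠ 0 ∨ b ≠ 0) ∧ L = {P | a * P.1 + b * P.2 + c = 0} then
    lineP h.choose h.choose_spec.choose h.choose_spec.choose_spec.choose else 1

theorem pol_spec {L : Set Pt} (h : IsLine L) : ∃ a b c : ℝ, (a ≠ 0 ∨ b ≠ 0) ∧
    L = {P | a * P.1 + b * P.2 + c = 0} ∧ pol L = lineP a b c := by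
  unfold IsLine at h
  refine ⟨h.choose, h.choose_spec.choose, h.choose_spec.choose_spec.choose,
    h.choose_spec.choose_spec.choose_spec.1, h.choose_spec.choose_spec.choose_spec.2, ?_⟩
  rw [pol, dif_pos h]

theorem pol_deg {L : Set Pt} (h : IsLine L) : (pol L).totalDegree = 1 := by
  obtain ⟨a, b, c, hab, -, e⟩ := pol_spec h
  rw [e]; exact lineP_deg hab

theorem pol_eval {L : Set Pt} (h : IsLine L) (P : Pt) : evalPt (pol L) P = 0 ↔ P ∈ L := by
  obtain ⟨a, b, c, hab, h2, e⟩ := pol_spec h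
  rw [e, h2]; simp

noncomputable def pols (T : List (Set Pt)) : Poly2 := (T.map pol).prod

@[simp] theorem pols_nil : pols [] = 1 := rfl
@[simp] theorem pols_cons (L T) : pols (L :: T) = pol L * pols T := by simp [pols]

theorem pols_eval {T : List (Set Pt)} (hT : ∀ L ∈ T, IsLine L) (P : Pt) :
    evalPt (pols T) P = 0 ↔ ∃ L ∈ T, P ∈ L := by
  induction T with
  | nil => simp
  | cons L T ih =>
    rw [pols_cons, evalPt_mul, mul_eq_zero, ih (fun M hM => hT M (List.mem_cons_of_mem _ hM)),
      pol_eval (hT L List.mem_cons_self)]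
    simp

theorem pols_deg {T : List (Set Pt)} (hT : ∀ L ∈ T, IsLine L) : (pols T).totalDegree ≤ T.length := by
  induction T with
  | nil => simp
  | cons L T ih =>
    rw [pols_cons, List.length_cons]
    refine (MvPolynomial.totalDegree_mul _ _).trans ?_
    have := ih (fun M hM => hT M (List.mem_cons_of_mem _ hM))
    have h2 := pol_deg (hT L List.mem_cons_self)
    omega

/-! pigeonhole -/
theorem PH {L : Set Pt} (hL : IsLine L) (T : List (Set Pt)) : ∀ (F : Finset Pt)
    (_ : ∀ P ∈ F, P ∈ L) (_ : ∀ M ∈ T, IsLine M ∧ M ≠ L)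
    (_ : ∀ P ∈ F, ∃ M ∈ T, P ∈ M), F.card ≤ T.length := by
  induction T with
  | nil =>
    intro F _ _ hc
    have : F = ∅ := by
      apply Finset.eq_empty_of_forall_notMem
      intro P hP
      obtain ⟨M, hM, _⟩ := hc P hP
      simp at hM
    simp [this]
  | cons M T ih =>
    intro F hF hT hc
    have h1 := ih (F.filter (· ∉ M)) (fun P hP => hF P (Finset.mem_filter.1 hP).1)
      (fun N hN => hT N (List.mem_cons_of_mem _ hN)) (by
        intro P hP
        obtain ⟨hP, hPM⟩ := Finset.mem_filter.1 hP
        obtain ⟨N, hN, hPN⟩ := hc P hP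
        rcases List.mem_cons.1 hN with rfl | hN
        · exact absurd hPN hPM
        · exact ⟨N, hN, hPN⟩)
    have h2 : (F.filter (· ∈ M)).card ≤ 1 := by
      rw [Finset.card_le_one]
      intro P hP Q hQ
      by_contra hne
      obtain ⟨hP, hPM⟩ := Finset.mem_filter.1 hP
      obtain ⟨hQ, hQM⟩ := Finset.mem_filter.1 hQ
      have := hT M List.mem_cons_self
      exact this.2 (line_unique this.1 hL hne hPM hQM (hF P hP) (hF Q hQ))
    have h3 := Finset.card_filter_add_card_filter_not (s := F) (· ∈ M)
    rw [List.length_cons]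
    omega

theorem PHe {L : Set Pt} (hL : IsLine L) {T : List (Set Pt)} {F : Finset Pt}
    (hF : ∀ P ∈ F, P ∈ L) (hT : ∀ M ∈ T, IsLine M ∧ M ≠ L) {M : Set Pt} (hM : M ∈ T)
    (hc : ∀ P ∈ F, ∃ M' ∈ T.erase M, P ∈ M') : F.card + 1 ≤ T.length := by
  have := PH hL (T.erase M) F hF (fun N hN => hT N (List.mem_of_mem_erase hN)) hc
  rw [List.length_erase_of_mem hM] at this
  have := List.length_pos_of_mem hM
  omega

/-- every line of T hits F -/
theorem PH_hit {L : Set Pt} (hL : IsLine L) {T : List (Set Pt)} {F : Finset Pt}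
    (hF : ∀ P ∈ F, P ∈ L) (hT : ∀ M ∈ T, IsLine M ∧ M ≠ L)
    (hc : ∀ P ∈ F, ∃ M' ∈ T, P ∈ M') (hcard : T.length ≤ F.card) {M : Set Pt} (hM : M ∈ T) :
    ∃ P ∈ F, P ∈ M := by
  by_contra! h
  have := PHe hL hF hT hM (by
    intro P hP
    obtain ⟨N, hN, hPN⟩ := hc P hP
    refine ⟨N, (List.mem_erase_of_ne ?_).2 hN, hPN⟩
    rintro rfl
    exact h P hP hPN)
  omega

theorem PH_uniq {L : Set Pt} (hL : IsLine L) {T : List (Set Pt)} {F : Finset Pt}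
    (hF : ∀ P ∈ F, P ∈ L) (hT : ∀ M ∈ T, IsLine M ∧ M ≠ L)
    (hc : ∀ P ∈ F, ∃ M' ∈ T, P ∈ M') (hcard : T.length ≤ F.card) {M N : Set Pt} (hM : M ∈ T)
    (hN : N ∈ T) {P : Pt} (hP : P ∈ F) (hPM : P ∈ M) (hPN : P ∈ N) : M = N := by
  by_contra hne
  have := PHe hL hF hT hM (by
    intro Q hQ
    by_cases h : Q = P
    · subst h
      exact ⟨N, (List.mem_erase_of_ne (Ne.symm hne)).2 hN, hPN⟩
    obtain ⟨N', hN', hQN⟩ := hc Q hQ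
    refine ⟨N', (List.mem_erase_of_ne ?_).2 hN', hQN⟩
    rintro rfl
    have := hT N' hM
    exact this.2 (line_unique this.1 hL h hQN hPM (hF Q hQ) (hF P hP)))
  omega

/-! GC sets -/
def Valid (n : ℕ) (X : Finset Pt) (A : Pt) (T : List (Set Pt)) : Prop :=
  T.length = n ∧ (∀ L ∈ T, IsLine L ∧ A ∉ L) ∧ ∀ B ∈ X, B ≠ A → ∃ L ∈ T, B ∈ L

def GC (n : ℕ) (X : Finset Pt) : Prop := IsPoised n X ∧ ∀ A ∈ X, ∃ T, Valid n X A T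

theorem gc_of {n X} (h : IsGC n X) : GC n X := by
  refine ⟨h.1, fun A hA => ?_⟩
  obtain ⟨p, hp, f, hf, rfl⟩ := h.2 A hA
  have he : ∀ P, evalPt (∏ i, f i) P = ∏ i, evalPt (f i) P := by
    intro P; simp [evalPt]
  refine ⟨List.ofFn (fun i => zeroSet (f i)), by simp, ?_, ?_⟩
  · intro L hL
    obtain ⟨i, rfl⟩ := (List.mem_ofFn' _ _).1 hL
    refine ⟨isLine_zeroSet (hf i), fun hh => ?_⟩
    have := hp.2.1
    rw [he, Finset.prod_eq_zero (Finset.mem_univ i) (show evalPt (f i) A = 0 from hh)] at this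
    simp at this
  · intro B hB hne
    have := hp.2.2 B hB hne
    rw [he, Finset.prod_eq_zero_iff] at this
    obtain ⟨i, -, hi⟩ := this
    exact ⟨zeroSet (f i), (List.mem_ofFn' _ _).2 ⟨i, rfl⟩, hi⟩

theorem valid_prod {n : ℕ} {X : Finset Pt} {A : Pt} {T : List (Set Pt)} (h : Valid n X A T) :
    ∃ f : Fin n → Poly2, (∀ i, (f i).totalDegree = 1) ∧ IsFund n X A (∏ i, f i) ∧
      ∀ L ∈ T, ∃ i, ∀ P ∈ L, evalPt (f i) P = 0 := by
  obtain ⟨h1, h2, h3⟩ := h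
  subst h1
  have hne : ∀ i : Fin T.length, evalPt (pol T[i]) A ≠ 0 := by
    intro i hh
    have := h2 T[i] (List.getElem_mem _)
    exact this.2 ((pol_eval this.1 A).1 hh)
  let f : Fin T.length → Poly2 := fun i => MvPolynomial.C (evalPt (pol T[i]) A)⁻¹ * pol T[i]
  have hfe : ∀ i P, evalPt (f i) P = 0 ↔ P ∈ T[i] := by
    intro i P
    have := h2 T[i] (List.getElem_mem _)
    simp only [f, evalPt_mul, evalPt_C, mul_eq_zero, inv_eq_zero, hne i, false_or]
    exact pol_eval this.1 P
  have he : ∀ P, evalPt (∏ i, f i) P = ∏ i, evalPt (f i) P := by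
    intro P; simp [evalPt]
  have hdeg : ∀ i, (f i).totalDegree = 1 := by
    intro i
    have h' := pol_deg (h2 T[i] (List.getElem_mem _)).1
    have h0 : pol T[i] ≠ 0 := by rintro h; rw [h] at h'; simp at h'
    simp only [f]
    rw [MvPolynomial.totalDegree_mul_of_isDomain _ h0, h', MvPolynomial.totalDegree_C]
    simp only [ne_eq, map_eq_zero, inv_eq_zero]
    exact hne i
  refine ⟨f, hdeg, ⟨?_, ?_, ?_⟩, ?_⟩
  · refine (MvPolynomial.totalDegree_finsetProd _ _).trans ?_
    simp [hdeg]
  · rw [he]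
    apply Finset.prod_eq_one
    intro i _
    simp only [f, evalPt_mul, evalPt_C]
    exact inv_mul_cancel₀ (hne i)
  · intro B hB hBA
    obtain ⟨L, hL, hBL⟩ := h3 B hB hBA
    obtain ⟨i, hi, rfl⟩ := List.getElem_of_mem hL
    rw [he]
    exact Finset.prod_eq_zero (Finset.mem_univ (⟨i, hi⟩ : Fin T.length)) ((hfe ⟨i, hi⟩ B).2 hBL)
  · intro L hL
    obtain ⟨i, hi, rfl⟩ := List.getElem_of_mem hL
    exact ⟨⟨i, hi⟩, fun P hP => (hfe ⟨i, hi⟩ P).2 hP⟩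

theorem gc_to {n X} (h : GC n X) : IsGC n X := by
  refine ⟨h.1, fun A hA => ?_⟩
  obtain ⟨T, hT⟩ := h.2 A hA
  obtain ⟨f, h1, h2, -⟩ := valid_prod hT
  exact ⟨_, h2, f, h1, rfl⟩

def Use (n : ℕ) (X : Finset Pt) (L : Set Pt) (A : Pt) : Prop := A ∈ X ∧ ∃ T, Valid n X A T ∧ L ∈ T

theorem fund_uniq {n X A p q} (h : GC n X) (hp : IsFund n X A p) (hq : IsFund n X A q) : p = q := by
  have := h.1.2 (p - q) ((MvPolynomial.totalDegree_sub _ _).trans (max_le hp.1 hq.1)) (by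
    intro B hB
    rw [evalPt_sub]
    by_cases hBA : B = A
    · rw [hBA, hp.2.1, hq.2.1, sub_self]
    · rw [hp.2.2 B hB hBA, hq.2.2 B hB hBA, sub_self])
  exact sub_eq_zero.1 this

theorem use_iff {n X A} {l : Poly2} (h : GC n X) (hA : A ∈ X) (hl : l.totalDegree = 1) :
    Uses n X l A ↔ Use n X (zeroSet l) A := by
  constructor
  · rintro ⟨p, hp, q, rfl⟩
    obtain ⟨T, hT⟩ := h.2 A hA
    refine ⟨hA, T, hT, ?_⟩
    by_contra hn
    obtain ⟨F, hF, hc⟩ := line_pts (isLine_zeroSet hl) (n + 1)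
    have hdeg := pols_deg (fun L hL => (hT.2.1 L hL).1)
    have hev := fun P => pols_eval (fun L hL => (hT.2.1 L hL).1) P
    have hvA : evalPt (pols T) A ≠ 0 := by
      rw [Ne, hev]
      rintro ⟨L, hL, hAL⟩
      exact (hT.2.1 L hL).2 hAL
    have hfund : IsFund n X A (MvPolynomial.C (evalPt (pols T) A)⁻¹ * pols T) := by
      refine ⟨?_, ?_, ?_⟩
      · refine (MvPolynomial.totalDegree_mul _ _).trans ?_
        rw [MvPolynomial.totalDegree_C, zero_add, ← hT.1]; exact hdeg
      · rw [evalPt_mul, evalPt_C, inv_mul_cancel₀ hvA]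
      · intro B hB hBA
        rw [evalPt_mul, (hev B).2 (hT.2.2 B hB hBA), mul_zero]
    have heq := fund_uniq h hp hfund
    have := PH (isLine_zeroSet hl) T F hF (fun M hM => ⟨(hT.2.1 M hM).1, by
      rintro rfl; exact hn hM⟩) (by
      intro P hP
      rw [← hev]
      have h1 : evalPt (l * q) P = 0 := by
        have : evalPt l P = 0 := hF P hP
        rw [evalPt_mul, this, zero_mul]
      rw [heq, evalPt_mul, evalPt_C, mul_eq_zero] at h1
      exact h1.resolve_left (inv_ne_zero hvA))
    rw [hc, hT.1] at this
    omega
  · rintro ⟨-, T, hT, hm⟩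
    obtain ⟨f, h1, h2, h3⟩ := valid_prod hT
    refine ⟨_, h2, ?_⟩
    obtain ⟨i, hi⟩ := h3 _ hm
    refine dvd_trans ?_ (Finset.dvd_prod_of_mem f (Finset.mem_univ i))
    obtain ⟨F, hF, hc⟩ := line_pts (isLine_zeroSet hl) 2
    obtain ⟨q, hq, -⟩ := dvd_of_vanish hl (h1 i).le F (fun P hP => hF P hP) hc.ge (fun P hP => hi P (hF P hP))
    exact ⟨q, hq⟩
end GCW

namespace GCW
open Classical

noncomputable def del (X : Finset Pt) (L : Set Pt) : Finset Pt := X.filter (· ∉ L)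
noncomputable def on (X : Finset Pt) (L : Set Pt) : Finset Pt := X.filter (· ∈ L)

@[simp] theorem mem_del {X L} {P : Pt} : P ∈ del X L ↔ P ∈ X ∧ P ∉ L := by simp [del]
@[simp] theorem mem_on {X L} {P : Pt} : P ∈ on X L ↔ P ∈ X ∧ P ∈ L := by simp [on]

theorem del_comm (X L M) : del (del X L) M = del (del X M) L := by
  ext P; simp; tauto

theorem card_del (X L) : (del X L).card + (on X L).card = X.card := by
  have := Finset.card_filter_add_card_filter_not (s := X) (· ∈ L)
  unfold del on; omega

def Mx (n : ℕ) (X : Finset Pt) (L : Set Pt) : Prop := IsLine L ∧ (on X L).card = n + 1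

theorem card_on_le {n X L} (h : GC n X) (hL : IsLine L) : (on X L).card ≤ n + 1 := by
  by_contra hlt
  have hne : (on X L).Nonempty := by rw [← Finset.card_pos]; omega
  obtain ⟨A, hA⟩ := hne
  obtain ⟨T, h1, h2, h3⟩ := h.2 A (mem_on.1 hA).1
  have := PH hL T ((on X L).erase A) (fun P hP => (mem_on.1 (Finset.mem_of_mem_erase hP)).2)
    (fun M hM => ⟨(h2 M hM).1, by rintro rfl; exact (h2 M hM).2 (mem_on.1 hA).2⟩)
    (fun P hP => h3 P (mem_on.1 (Finset.mem_of_mem_erase hP)).1 (Finset.ne_of_mem_erase hP))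
  rw [Finset.card_erase_of_mem hA] at this
  omega

theorem mx_mem_valid {n X A T L} (hT : Valid n X A T) (hL : Mx n X L) (hA : A ∉ L) : L ∈ T := by
  by_contra hn
  obtain ⟨h1, h2, h3⟩ := hT
  have := PH hL.1 T (on X L) (fun P hP => (mem_on.1 hP).2)
    (fun M hM => ⟨(h2 M hM).1, by rintro rfl; exact hn hM⟩)
    (fun P hP => h3 P (mem_on.1 hP).1 (by rintro rfl; exact hA (mem_on.1 hP).2))
  rw [hL.2] at this
  omega

theorem valid_del {n X A T L} (hT : Valid (n+1) X A T) (hL : L ∈ T) :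
    Valid n (del X L) A (T.erase L) := by
  obtain ⟨h1, h2, h3⟩ := hT
  refine ⟨by rw [List.length_erase_of_mem hL]; omega, fun M hM => h2 M (List.mem_of_mem_erase hM), ?_⟩
  intro B hB hne
  obtain ⟨M, hM, hBM⟩ := h3 B (mem_del.1 hB).1 hne
  refine ⟨M, (List.mem_erase_of_ne ?_).2 hM, hBM⟩
  rintro rfl
  exact (mem_del.1 hB).2 hBM

theorem valid_add {n X A T L} (hT : Valid n (del X L) A T) (hL : IsLine L) (hA : A ∉ L) :
    Valid (n+1) X A (L :: T) := by
  obtain ⟨h1, h2, h3⟩ := hT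
  refine ⟨by simp [h1], ?_, ?_⟩
  · intro M hM
    rcases List.mem_cons.1 hM with rfl | hM
    · exact ⟨hL, hA⟩
    · exact h2 M hM
  · intro B hB hne
    by_cases hBL : B ∈ L
    · exact ⟨L, List.mem_cons_self, hBL⟩
    · obtain ⟨M, hM, hBM⟩ := h3 B (mem_del.2 ⟨hB, hBL⟩) hne
      exact ⟨M, List.mem_cons_of_mem _ hM, hBM⟩

theorem gc_del {n X L} (h : GC (n+1) X) (hL : Mx (n+1) X L) : GC n (del X L) := by
  refine ⟨⟨?_, ?_⟩, ?_⟩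
  · have h1 := card_del X L
    have h2 := h.1.1
    rw [hL.2, h2, show n + 1 + 2 = (n + 2) + 1 by ring, Nat.choose_succ_succ' (n+2) 1] at h1
    simp at h1; omega
  · intro p hp hv
    have := h.1.2 (pol L * p) ((MvPolynomial.totalDegree_mul _ _).trans (by rw [pol_deg hL.1]; omega)) (by
      intro A hA
      rw [evalPt_mul, mul_eq_zero]
      by_cases hAL : A ∈ L
      · left; exact (pol_eval hL.1 A).2 hAL
      · right; exact hv A (mem_del.2 ⟨hA, hAL⟩))
    rcases mul_eq_zero.1 this with h0 | h0
    · have := pol_deg hL.1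
      rw [h0] at this; simp at this
    · exact h0
  · intro A hA
    obtain ⟨T, hT⟩ := h.2 A (mem_del.1 hA).1
    exact ⟨_, valid_del hT (mx_mem_valid hT hL (mem_del.1 hA).2)⟩

theorem gc_zero {X} (h : GC 0 X) : ∃ P, X = {P} := by
  have := h.1.1
  simp at this
  exact Finset.card_eq_one.1 this

theorem mx_zero {P : Pt} {L} : Mx 0 {P} L ↔ IsLine L ∧ P ∈ L := by
  unfold Mx on
  by_cases h : P ∈ L <;> simp [Finset.filter_singleton, h]

theorem gc_nonempty {n X} (h : GC n X) : X.Nonempty := by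
  rw [← Finset.card_pos, h.1.1]
  exact Nat.choose_pos (by omega)

theorem mx_meet {n X L M} (h : GC n X) (hL : Mx n X L) (hM : Mx n X M) (hne : L ≠ M) :
    ∃ P ∈ X, P ∈ L ∧ P ∈ M := by
  cases n with
  | zero =>
    obtain ⟨P, rfl⟩ := gc_zero h
    exact ⟨P, by simp, (mx_zero.1 hL).2, (mx_zero.1 hM).2⟩
  | succ n =>
    by_contra! hh
    have h1 := card_on_le (gc_del h hL) hM.1
    have h2 : on (del X L) M = on X M := by
      ext P; simp only [mem_on, mem_del]
      constructor
      · rintro ⟨⟨a, -⟩, b⟩; exact ⟨a, b⟩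
      · rintro ⟨a, b⟩; exact ⟨⟨a, fun c => hh P a c b⟩, b⟩
    rw [h2, hM.2] at h1
    omega

theorem card_on_del {X L M P} (hL : IsLine L) (hM : IsLine M) (hne : L ≠ M) (hP : P ∈ X) (hPL : P ∈ L)
    (hPM : P ∈ M) : (on (del X L) M).card + 1 = (on X M).card := by
  have h2 : on (del X L) M = (on X M).erase P := by
    ext Q; simp only [mem_on, mem_del, Finset.mem_erase]
    constructor
    · rintro ⟨⟨a, b⟩, c⟩; exact ⟨by rintro rfl; exact b hPL, a, c⟩
    · rintro ⟨a, b, c⟩; exact ⟨⟨b, fun d => hne (line_unique hL hM a d hPL c hPM)⟩, c⟩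
  rw [h2, Finset.card_erase_of_mem (mem_on.2 ⟨hP, hPM⟩)]
  have : 0 < (on X M).card := Finset.card_pos.2 ⟨P, mem_on.2 ⟨hP, hPM⟩⟩
  omega

theorem mx_del {n X L M} (h : GC (n+1) X) (hL : Mx (n+1) X L) (hM : Mx (n+1) X M) (hne : L ≠ M) :
    Mx n (del X L) M := by
  obtain ⟨P, hP, h1, h2⟩ := mx_meet h hL hM hne
  have := card_on_del hL.1 hM.1 hne hP h1 h2
  rw [hM.2] at this
  exact ⟨hM.1, by omega⟩

theorem mx_concur {n X L M K P} (h : GC (n+1) X) (hL : Mx (n+1) X L) (hM : Mx (n+1) X M)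
    (hK : Mx (n+1) X K) (h1 : L ≠ M) (h2 : L ≠ K) (h3 : M ≠ K) (hPL : P ∈ L) (hPM : P ∈ M)
    (hPK : P ∈ K) : False := by
  obtain ⟨Q, hQ, a, b⟩ := mx_meet (gc_del h hL) (mx_del h hL hM h1) (mx_del h hL hK h2) h3
  refine h3 (line_unique hM.1 hK.1 (?_ : P ≠ Q) hPM a hPK b)
  rintro rfl
  exact (mem_del.1 hQ).2 hPL

theorem mx_ne_del {n X L M} (hM : Mx n (del X L) M) : L ≠ M := by
  rintro rfl
  have : on (del X L) L = ∅ := by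
    apply Finset.eq_empty_of_forall_notMem
    intro P; simp
  have := hM.2
  simp_all

theorem mx_of_del {n X L M P} (hL : IsLine L) (hM : Mx n (del X L) M) (hP : P ∈ X) (hPL : P ∈ L)
    (hPM : P ∈ M) : Mx (n+1) X M := by
  have := card_on_del hL hM.1 (mx_ne_del hM) hP hPL hPM
  rw [hM.2] at this
  exact ⟨hM.1, by omega⟩

/-- n is the degree of X minus lam -/
def New (n : ℕ) (X : Finset Pt) (lam nu : Set Pt) : Prop :=
  Mx n (del X lam) nu ∧ ∀ P ∈ X, P ∈ lam → P ∉ nu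

theorem mx_del_cases {n X L M} (hL : IsLine L) (hM : Mx n (del X L) M) :
    Mx (n+1) X M ∨ New n X L M := by
  by_cases h : ∃ P ∈ X, P ∈ L ∧ P ∈ M
  · obtain ⟨P, a, b, c⟩ := h
    exact Or.inl (mx_of_del hL hM a b c)
  · push Not at h
    exact Or.inr ⟨hM, h⟩

theorem new_ne {n X L M} (h : New n X L M) : L ≠ M := mx_ne_del h.1

theorem new_not_mx {n X L M} (hX : GC (n+1) X) (hL : Mx (n+1) X L) (h : New n X L M) :
    ¬ Mx (n+1) X M := by
  intro hM
  obtain ⟨P, a, b, c⟩ := mx_meet hX hL hM (new_ne h)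
  exact h.2 P a b c

theorem new_ne_mx {n X L M K} (hX : GC (n+1) X) (hL : Mx (n+1) X L) (h : New n X L M)
    (hK : Mx (n+1) X K) : M ≠ K := by
  rintro rfl; exact new_not_mx hX hL h hK

theorem new_stab {n X L M K} (hX : GC (n+2) X) (hL : Mx (n+2) X L) (h : New (n+1) X L M)
    (hK : Mx (n+2) X K) (hne : L ≠ K) : New n (del X K) L M := by
  refine ⟨?_, fun P hP => h.2 P (mem_del.1 hP).1⟩
  rw [del_comm]
  exact mx_del (gc_del hX hL) (mx_del hX hL hK hne) h.1 (new_ne_mx hX hL h hK).symm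

/-- a new line of `L` meets any other maximal line in a node off L -/
theorem new_meet {n X L M K} (hX : GC (n+1) X) (hL : Mx (n+1) X L) (h : New n X L M)
    (hK : Mx (n+1) X K) (hne : L ≠ K) : ∃ P ∈ X, P ∈ M ∧ P ∈ K ∧ P ∉ L := by
  obtain ⟨P, hP, a, b⟩ := mx_meet (gc_del hX hL) h.1 (mx_del hX hL hK hne) (new_ne_mx hX hL h hK)
  exact ⟨P, (mem_del.1 hP).1, a, b, (mem_del.1 hP).2⟩

def Three (n : ℕ) (X : Finset Pt) : Prop :=
  ∃ a b c, a ≠ b ∧ a ≠ c ∧ b ≠ c ∧ Mx n X a ∧ Mx n X b ∧ Mx n X c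

theorem three_zero {X} (h : GC 0 X) : Three 0 X := by
  obtain ⟨P, rfl⟩ := gc_zero h
  have key : ∀ a b : ℝ, (a ≠ 0 ∨ b ≠ 0) → Mx 0 {P} {Q : Pt | a * Q.1 + b * Q.2 + (- a * P.1 - b * P.2) = 0} := by
    intro a b hab
    rw [mx_zero]
    refine ⟨⟨a, b, _, hab, rfl⟩, ?_⟩
    simp only [Set.mem_ofPred_eq]; ring
  refine ⟨_, _, _, ?_, ?_, ?_, key 1 0 (by simp), key 0 1 (by simp), key 1 1 (by simp)⟩
  · intro h
    have : (P.1, P.2 + 1) ∈ {Q : Pt | (0:ℝ) * Q.1 + 1 * Q.2 + (- 0 * P.1 - 1 * P.2) = 0} := by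
      rw [← h]; simp
    simp at this
  · intro h
    have : (P.1, P.2 + 1) ∈ {Q : Pt | (1:ℝ) * Q.1 + 1 * Q.2 + (- 1 * P.1 - 1 * P.2) = 0} := by
      rw [← h]; simp
    simp at this; linarith
  · intro h
    have : (P.1 + 1, P.2) ∈ {Q : Pt | (1:ℝ) * Q.1 + 1 * Q.2 + (- 1 * P.1 - 1 * P.2) = 0} := by
      rw [← h]; simp
    simp at this

theorem on_nonempty {n X L} (h : Mx n X L) : ∃ P ∈ X, P ∈ L := by
  have : (on X L).Nonempty := by rw [← Finset.card_pos, h.2]; omega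
  obtain ⟨P, hP⟩ := this
  exact ⟨P, mem_on.1 hP⟩

/-- lines used by nodes on a maximal line -/
theorem valid_on {n X A T L} (hT : Valid n X A T) (hL : Mx n X L) (hA : A ∈ X) (hAL : A ∈ L) :
    (∀ M ∈ T, IsLine M ∧ M ≠ L) ∧ (∀ P ∈ (on X L).erase A, ∃ M ∈ T, P ∈ M) ∧
      T.length ≤ ((on X L).erase A).card ∧ ∀ P ∈ (on X L).erase A, P ∈ L := by
  refine ⟨fun M hM => ⟨(hT.2.1 M hM).1, by rintro rfl; exact (hT.2.1 M hM).2 hAL⟩, ?_, ?_, ?_⟩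
  · intro P hP
    simp at hP
    exact hT.2.2 P hP.2.1 hP.1
  · rw [Finset.card_erase_of_mem (mem_on.2 ⟨hA, hAL⟩), hL.2, hT.1]; simp
  · intro P hP
    simp at hP
    exact hP.2.2

theorem use_del {n X L l A} (hX : GC (n+1) X) (hL : Mx (n+1) X L) (hA : A ∉ L) (hne : l ≠ L) :
    Use (n+1) X l A ↔ Use n (del X L) l A := by
  constructor
  · rintro ⟨hAX, T, hT, hl⟩
    have := mx_mem_valid hT hL hA
    exact ⟨mem_del.2 ⟨hAX, hA⟩, _, valid_del hT this, (List.mem_erase_of_ne hne).2 hl⟩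
  · rintro ⟨hAX, T, hT, hl⟩
    exact ⟨(mem_del.1 hAX).1, _, valid_add hT hL.1 hA, List.mem_cons_of_mem _ hl⟩

theorem use_disj {n X L l A} (hL : Mx n X L) (hd : ∀ P ∈ X, P ∈ L → P ∉ l) (hu : Use n X l A) :
    A ∉ L := by
  intro hAL
  obtain ⟨hA, T, hT, hl⟩ := hu
  obtain ⟨h1, h2, h3, h4⟩ := valid_on hT hL hA hAL
  obtain ⟨P, hP, hPl⟩ := PH_hit hL.1 h4 h1 h2 h3 hl
  simp at hP
  exact hd P hP.2.1 hP.2.2 hPl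

theorem use_pair {n X L M l A D} (hL : Mx n X L) (hM : Mx n X M) (hne : L ≠ M) (hlM : l ≠ M)
    (hD : D ∈ X) (hDL : D ∈ L) (hDM : D ∈ M) (hDl : D ∈ l) (hu : Use n X l A) : A ∉ L := by
  intro hAL
  obtain ⟨hA, T, hT, hl⟩ := hu
  obtain ⟨h1, h2, h3, h4⟩ := valid_on hT hL hA hAL
  have hAD : A ≠ D := by rintro rfl; exact (hT.2.1 l hl).2 hDl
  have hAM : A ∉ M := fun h => hne (line_unique hL.1 hM.1 hAD hAL hDL h hDM)
  exact hlM (PH_uniq hL.1 h4 h1 h2 h3 hl (mx_mem_valid hT hM hAM)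
    (Finset.mem_erase.2 ⟨hAD.symm, mem_on.2 ⟨hD, hDL⟩⟩) hDl hDM)

theorem use_max {n X l A} (hX : GC n X) (hl : Mx n X l) : Use n X l A ↔ A ∈ X ∧ A ∉ l := by
  constructor
  · rintro ⟨hA, T, hT, hl⟩
    exact ⟨hA, (hT.2.1 l hl).2⟩
  · rintro ⟨hA, h⟩
    obtain ⟨T, hT⟩ := hX.2 A hA
    exact ⟨hA, T, hT, mx_mem_valid hT hl h⟩

theorem use_isLine {n X l A} (h : Use n X l A) : IsLine l ∧ A ∉ l := by
  obtain ⟨hA, T, hT, hl⟩ := h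
  exact hT.2.1 l hl

theorem gc_one_max {X A} (hX : GC 1 X) {L} (hu : Use 1 X L A) : Mx 1 X L := by
  obtain ⟨hA, T, hT, hl⟩ := hu
  obtain ⟨M, rfl⟩ := List.length_eq_one_iff.1 hT.1
  simp at hl
  subst hl
  refine ⟨(hT.2.1 L (by simp)).1, ?_⟩
  have : on X L = X.erase A := by
    ext P; simp only [mem_on, Finset.mem_erase]
    constructor
    · rintro ⟨a, b⟩; exact ⟨by rintro rfl; exact (hT.2.1 L (by simp)).2 b, a⟩
    · rintro ⟨a, b⟩
      obtain ⟨M, hM, h⟩ := hT.2.2 P b a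
      simp at hM; subst hM; exact ⟨b, h⟩
  rw [this, Finset.card_erase_of_mem hA, hX.1.1]; rfl

theorem gc_one_le {X a b c d} (hX : GC 1 X) (ha : Mx 1 X a) (hb : Mx 1 X b) (hc : Mx 1 X c)
    (hd : Mx 1 X d) (hab : a ≠ b) (hac : a ≠ c) (hbc : b ≠ c) (had : a ≠ d) (hbd : b ≠ d) : c = d := by
  have hY := gc_del hX ha
  by_contra hcd
  obtain ⟨P, hP⟩ := gc_zero hY
  have h1 := mx_del hX ha hb hab
  have h2 := mx_del hX ha hc hac
  have h3 := mx_del hX ha hd had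
  rw [hP, mx_zero] at h1 h2 h3
  exact mx_concur hX hb hc hd hbc hbd hcd h1.2 h2.2 h3.2

theorem three_one {X} (hX : GC 1 X) : Three 1 X := by
  have h3 : X.card = 3 := hX.1.1
  obtain ⟨x, y, z, hxy, hxz, hyz, rfl⟩ := Finset.card_eq_three.1 h3
  have key : ∀ A ∈ ({x, y, z} : Finset Pt), ∃ L, Mx 1 {x, y, z} L ∧ A ∉ L ∧
      ∀ B ∈ ({x, y, z} : Finset Pt), B ≠ A → B ∈ L := by
    intro A hA
    obtain ⟨T, hT⟩ := hX.2 A hA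
    obtain ⟨M, rfl⟩ := List.length_eq_one_iff.1 hT.1
    refine ⟨M, gc_one_max hX ⟨hA, _, hT, by simp⟩, (hT.2.1 M (by simp)).2, ?_⟩
    intro B hB hne
    obtain ⟨N, hN, h⟩ := hT.2.2 B hB hne
    simp at hN; subst hN; exact h
  obtain ⟨a, ha, ha1, ha2⟩ := key x (by simp)
  obtain ⟨b, hb, hb1, hb2⟩ := key y (by simp)
  obtain ⟨c, hc, hc1, hc2⟩ := key z (by simp)
  refine ⟨a, b, c, ?_, ?_, ?_, ha, hb, hc⟩
  · rintro rfl; exact ha1 (hb2 x (by simp) hxy)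
  · rintro rfl; exact ha1 (hc2 x (by simp) hxz)
  · rintro rfl; exact hb1 (hc2 y (by simp) hyz)
end GCW

namespace GCW
open Classical

/-- lines in T for a node on lam are different from new lines -/
theorem valid_new_ne {n X A T lam nu} (hT : Valid (n+1) X A T) (hL : Mx (n+1) X lam) (hA : A ∈ X)
    (hAL : A ∈ lam) (hn : New n X lam nu) : nu ∉ T := by
  intro hm
  obtain ⟨h1, h2, h3, h4⟩ := valid_on hT hL hA hAL
  obtain ⟨P, hP, hP2⟩ := PH_hit hL.1 h4 h1 h2 h3 hm
  simp at hP
  exact hn.2 P hP.2.1 hP.2.2 hP2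

theorem new_hit {n X A T lam nu} (hT : Valid (n+1) X A T) (hL : Mx (n+1) X lam) (hA : A ∈ X)
    (hAL : A ∈ lam) (hn : New n X lam nu) {h : Set Pt} (hh : h ∈ T) :
    ∃ P ∈ on (del X lam) nu, P ∈ h := by
  refine PH_hit hn.1.1 (T := T) (fun P hP => (mem_on.1 hP).2) ?_ ?_ ?_ hh
  · intro M hM
    exact ⟨(hT.2.1 M hM).1, by rintro rfl; exact valid_new_ne hT hL hA hAL hn hM⟩
  · intro P hP
    simp at hP
    exact hT.2.2 P hP.1.1 (by rintro rfl; exact hP.1.2 hAL)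
  · rw [hn.1.2, hT.1]

theorem new_inj {k X lam nu nu' O h P1 P2 Q T1 T2} (hX : GC (k+2) X) (hL : Mx (k+2) X lam)
    (hn : New (k+1) X lam nu) (hn' : New (k+1) X lam nu') (hne : nu ≠ nu')
    (hO : O ∈ X) (hOl : O ∉ lam) (hOn : O ∈ nu) (hOn' : O ∈ nu')
    (hP1 : P1 ∈ X) (hP1l : P1 ∈ lam) (hP2 : P2 ∈ X) (hP2l : P2 ∈ lam) (hPP : P1 ≠ P2)
    (hT1 : Valid (k+2) X P1 T1) (hT2 : Valid (k+2) X P2 T2) (hh1 : h ∈ T1) (hh2 : h ∈ T2)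
    (hOh : O ∈ h) (hQ : Q ∈ X) (hQl : Q ∈ lam) (hQh : Q ∈ h) : False := by
  have hhl : IsLine h := (hT1.2.1 h hh1).1
  have hP1h := (hT1.2.1 h hh1).2
  have hP2h := (hT2.2.1 h hh2).2
  have hhnu : h ≠ nu := by rintro rfl; exact valid_new_ne hT1 hL hP1 hP1l hn hh1
  have hhnu' : h ≠ nu' := by rintro rfl; exact valid_new_ne hT1 hL hP1 hP1l hn' hh1
  have hhlam : h ≠ lam := by rintro rfl; exact hP1h hP1l
  have hl1 : ∀ L ∈ T1.erase h, IsLine L := fun L hL => (hT1.2.1 L (List.mem_of_mem_erase hL)).1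
  have hl2 : ∀ L ∈ T2.erase h, IsLine L := fun L hL => (hT2.2.1 L (List.mem_of_mem_erase hL)).1
  set q1 := pols (T1.erase h) with hq1
  set q2 := pols (T2.erase h) with hq2
  have d1 : q1.totalDegree ≤ k + 1 := by
    refine (pols_deg hl1).trans ?_
    rw [List.length_erase_of_mem hh1, hT1.1]; simp
  have d2 : q2.totalDegree ≤ k + 1 := by
    refine (pols_deg hl2).trans ?_
    rw [List.length_erase_of_mem hh2, hT2.1]; simp
  have v1 : ∀ A ∈ X, A ≠ P1 → A ∉ h → evalPt q1 A = 0 := by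
    intro A hA hne hAh
    rw [hq1, pols_eval hl1]
    obtain ⟨M, hM, hAM⟩ := hT1.2.2 A hA hne
    exact ⟨M, (List.mem_erase_of_ne (by rintro rfl; exact hAh hAM)).2 hM, hAM⟩
  have v2 : ∀ A ∈ X, A ≠ P2 → A ∉ h → evalPt q2 A = 0 := by
    intro A hA hne hAh
    rw [hq2, pols_eval hl2]
    obtain ⟨M, hM, hAM⟩ := hT2.2.2 A hA hne
    exact ⟨M, (List.mem_erase_of_ne (by rintro rfl; exact hAh hAM)).2 hM, hAM⟩
  have n1 : evalPt q1 P1 ≠ 0 := by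
    rw [hq1, Ne, pols_eval hl1]
    rintro ⟨M, hM, hPM⟩
    exact (hT1.2.1 M (List.mem_of_mem_erase hM)).2 hPM
  have n2 : evalPt q2 P2 ≠ 0 := by
    rw [hq2, Ne, pols_eval hl2]
    rintro ⟨M, hM, hPM⟩
    exact (hT2.2.1 M (List.mem_of_mem_erase hM)).2 hPM
  obtain ⟨α, β, hαβ, hz⟩ : ∃ α β : ℝ, (α ≠ 0 ∨ β ≠ 0) ∧ α * evalPt q1 O + β * evalPt q2 O = 0 := by
    by_cases hc : evalPt q1 O = 0
    · exact ⟨1, 0, by simp, by simp [hc]⟩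
    · exact ⟨evalPt q2 O, - evalPt q1 O, Or.inr (by simpa using hc), by ring⟩
  set r := MvPolynomial.C α * q1 + MvPolynomial.C β * q2 with hr
  have dr : r.totalDegree ≤ k + 1 := by
    refine (MvPolynomial.totalDegree_add _ _).trans (max_le ?_ ?_)
    · refine (MvPolynomial.totalDegree_mul _ _).trans ?_
      simpa using d1
    · refine (MvPolynomial.totalDegree_mul _ _).trans ?_
      simpa using d2
  have vr : ∀ A ∈ X, A ≠ P1 → A ≠ P2 → A ∉ h → evalPt r A = 0 := by
    intro A hA h1 h2 h3
    simp [hr, v1 A hA h1 h3, v2 A hA h2 h3]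
  have vrO : evalPt r O = 0 := by simpa [hr] using hz
  have hzero : ∀ A ∈ lam, evalPt r A = 0 := by
    obtain ⟨s, hs, hs'⟩ := dvd_of_vanish (pol_deg hn.1.1) dr (on (del X lam) nu)
      (fun P hP => (pol_eval hn.1.1 P).2 (mem_on.1 hP).2) (by rw [hn.1.2]) (by
        intro P hP
        simp at hP
        by_cases hPO : P = O
        · rw [hPO]; exact vrO
        · refine vr P hP.1.1 (by rintro rfl; exact hP.1.2 hP1l) (by rintro rfl; exact hP.1.2 hP2l) ?_
          intro hPh
          exact hhnu (line_unique hhl hn.1.1 hPO hPh hOh hP.2 hOn))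
    rcases hs' with hs' | hs'
    · intro A _; rw [hs']; simp
    have hvs : ∀ A ∈ X, A ≠ P1 → A ≠ P2 → A ∉ h → A ∉ nu → evalPt s A = 0 := by
      intro A hA a b c d
      have := vr A hA a b c
      rw [hs, evalPt_mul, mul_eq_zero, pol_eval hn.1.1] at this
      exact this.resolve_left d
    obtain ⟨t, ht, ht'⟩ := dvd_of_vanish (pol_deg hn'.1.1) (d := k) (p := s) (by omega)
      ((on (del X lam) nu').erase O)
      (fun P hP => (pol_eval hn'.1.1 P).2 (mem_on.1 (Finset.mem_of_mem_erase hP)).2) (by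
        rw [Finset.card_erase_of_mem (by simp [*]), hn'.1.2]; simp) (by
        intro P hP
        simp at hP
        obtain ⟨hPO, ⟨hPX, hPl⟩, hPn⟩ := hP
        refine hvs P hPX (by rintro rfl; exact hPl hP1l) (by rintro rfl; exact hPl hP2l) ?_ ?_
        · intro hPh
          exact hhnu' (line_unique hhl hn'.1.1 hPO hPh hOh hPn hOn')
        · intro hPh
          exact hne (line_unique hn.1.1 hn'.1.1 hPO hPh hOn hPn hOn'))
    rcases ht' with ht' | ht'
    · intro A _; rw [hs, ht']; simp
    have hvt : ∀ A ∈ X, A ≠ P1 → A ≠ P2 → A ∉ h → A ∉ nu → A ∉ nu' → evalPt t A = 0 := by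
      intro A hA a b c d e
      have := hvs A hA a b c d
      rw [ht, evalPt_mul, mul_eq_zero, pol_eval hn'.1.1] at this
      exact this.resolve_left e
    have hQP1 : Q ≠ P1 := by rintro rfl; exact hP1h hQh
    have hQP2 : Q ≠ P2 := by rintro rfl; exact hP2h hQh
    obtain ⟨u, hu, -⟩ := dvd_of_vanish (pol_deg hL.1) (d := k - 1) (p := t) (by omega)
      ((((on X lam).erase P1).erase P2).erase Q)
      (fun P hP => (pol_eval hL.1 P).2 (by simp at hP; exact hP.2.2.2.2)) (by
        rw [Finset.card_erase_of_mem (by simp [*]), Finset.card_erase_of_mem (by simp [*, Ne.symm hPP]),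
          Finset.card_erase_of_mem (by simp [*]), hL.2]; omega) (by
        intro P hP
        simp at hP
        obtain ⟨hPQ, hPP2, hPP1, hPX, hPl⟩ := hP
        refine hvt P hPX hPP1 hPP2 ?_ (hn.2 P hPX hPl) (hn'.2 P hPX hPl)
        intro hPh
        exact hhlam (line_unique hhl hL.1 hPQ hPh hQh hPl hQl))
    intro A hA
    rw [hs, ht, hu]
    simp [(pol_eval hL.1 A).2 hA]
  have z1 := hzero P1 hP1l
  have z2 := hzero P2 hP2l
  rw [hr] at z1 z2
  simp [v2 P1 hP1 hPP hP1h, n1] at z1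
  simp [v1 P2 hP2 (Ne.symm hPP) hP2h, n2] at z2
  rcases hαβ with h | h
  · exact h z1
  · exact h z2

theorem new_uniq_step {k X lam nu nu'} (hX : GC (k+2) X) (hL : Mx (k+2) X lam)
    (h3 : Three (k+1) (del X lam))
    (hn : New (k+1) X lam nu) (hn' : New (k+1) X lam nu') : nu = nu' := by
  by_contra hne
  have hY := gc_del hX hL
  obtain ⟨O, hO, hOn, hOn'⟩ := mx_meet hY hn.1 hn'.1 hne
  obtain ⟨hO, hOl⟩ := mem_del.1 hO
  have key : ∀ P, ∃ Q h T, P ∈ on X lam → (Q ∈ on X lam ∧ Valid (k+2) X P T ∧ h ∈ T ∧ O ∈ h ∧ Q ∈ h ∧ Q ≠ P) := by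
    intro P
    by_cases hP : P ∈ on X lam
    · have hP' := mem_on.1 hP
      obtain ⟨T, hT⟩ := hX.2 P hP'.1
      obtain ⟨h, hh, hOh⟩ := hT.2.2 O hO (by rintro rfl; exact hOl hP'.2)
      obtain ⟨h1, h2, h3, h4⟩ := valid_on hT hL hP'.1 hP'.2
      obtain ⟨Q, hQ, hQh⟩ := PH_hit hL.1 h4 h1 h2 h3 hh
      simp only [Finset.mem_erase] at hQ
      exact ⟨Q, h, T, fun _ => ⟨hQ.2, hT, hh, hOh, hQh, hQ.1⟩⟩
    · exact ⟨P, ∅, [], fun h => absurd h hP⟩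
  choose f h T key using key
  have finj : Set.InjOn f (on X lam) := by
    intro P1 hP1 P2 hP2 he
    by_contra hPP
    have hP1 : P1 ∈ on X lam := hP1
    have hP2 : P2 ∈ on X lam := hP2
    obtain ⟨a1, a2, a3, a4, a5, a6⟩ := key P1 hP1
    obtain ⟨b1, b2, b3, b4, b5, b6⟩ := key P2 hP2
    have hQO : f P1 ≠ O := by intro h; rw [h] at a1; exact hOl (mem_on.1 a1).2
    have hhe : h P1 = h P2 := line_unique (a2.2.1 _ a3).1 (b2.2.1 _ b3).1 hQO a5 a4 (he ▸ b5) b4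
    exact new_inj hX hL hn hn' hne hO hOl hOn hOn' (mem_on.1 hP1).1 (mem_on.1 hP1).2 (mem_on.1 hP2).1
      (mem_on.1 hP2).2 hPP a2 b2 a3 (hhe ▸ b3) a4 (mem_on.1 a1).1 (mem_on.1 a1).2 a5
  obtain ⟨τ, hτ, hτn, hτn'⟩ : ∃ τ, Mx (k+1) (del X lam) τ ∧ τ ≠ nu ∧ τ ≠ nu' := by
    obtain ⟨a, b, c, hab, hac, hbc, ha, hb, hc⟩ := h3
    by_cases h1 : a = nu ∨ a = nu'
    · by_cases h2 : b = nu ∨ b = nu'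
      · refine ⟨c, hc, ?_, ?_⟩
        · rintro rfl; rcases h1 with rfl | rfl
          · exact hac rfl
          · rcases h2 with rfl | rfl
            · exact hbc rfl
            · exact hab rfl
        · rintro rfl; rcases h1 with rfl | rfl
          · rcases h2 with rfl | rfl
            · exact hab rfl
            · exact hbc rfl
          · exact hac rfl
      · push Not at h2; exact ⟨b, hb, h2⟩
    · push Not at h1; exact ⟨a, ha, h1⟩
  have hOτ : O ∉ τ := fun hh => mx_concur hY hn.1 hn'.1 hτ hne hτn.symm hτn'.symm hOn hOn' hh
  rcases mx_del_cases hL.1 hτ with hτ' | hτ'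
  · obtain ⟨R, hR, hRl, hRτ⟩ := mx_meet hX hL hτ' (mx_ne_del hτ)
    have hsurj := Finset.surjOn_of_injOn_of_card_le f (s := on X lam) (t := on X lam)
      (fun P hP => (key P hP).1) finj le_rfl
    obtain ⟨P, hP, hfP⟩ := hsurj (mem_on.2 ⟨hR, hRl⟩ : R ∈ on X lam)
    have hP : P ∈ on X lam := hP
    obtain ⟨a1, a2, a3, a4, a5, a6⟩ := key P hP
    rw [hfP] at a1 a5 a6
    have hP' := mem_on.1 hP
    have hPτ : P ∉ τ := fun hh => mx_ne_del hτ (line_unique hL.1 hτ.1 a6 hRl hP'.2 hRτ hh)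
    obtain ⟨h1, h2, h3, h4⟩ := valid_on a2 hL hP'.1 hP'.2
    have := PH_uniq hL.1 h4 h1 h2 h3 a3 (mx_mem_valid a2 hτ' hPτ) (Finset.mem_erase.2 ⟨a6, a1⟩) a5 hRτ
    rw [this] at a4
    exact hOτ a4
  · have key2 : ∀ P, ∃ S, P ∈ on X lam → S ∈ on (del X lam) τ ∧ S ∈ h P := by
      intro P
      by_cases hP : P ∈ on X lam
      · have hP' := mem_on.1 hP
        obtain ⟨a1, a2, a3, a4, a5, a6⟩ := key P hP
        obtain ⟨S, hS, hS'⟩ := new_hit a2 hL hP'.1 hP'.2 hτ' a3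
        exact ⟨S, fun _ => ⟨hS, hS'⟩⟩
      · exact ⟨P, fun h => absurd h hP⟩
    choose g hg using key2
    have := Finset.card_le_card_of_injOn g (s := on X lam) (t := on (del X lam) τ)
      (fun P hP => (hg P hP).1) (by
      intro P1 hP1 P2 hP2 he
      have hP1 : P1 ∈ on X lam := hP1
      have hP2 : P2 ∈ on X lam := hP2
      obtain ⟨a1, a2, a3, a4, a5, a6⟩ := key P1 hP1
      obtain ⟨b1, b2, b3, b4, b5, b6⟩ := key P2 hP2
      obtain ⟨s1, s2⟩ := hg P1 hP1
      obtain ⟨t1, t2⟩ := hg P2 hP2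
      rw [← he] at t2
      have hSO : g P1 ≠ O := by intro h; rw [h] at s1; exact hOτ (mem_on.1 s1).2
      have hhe : h P1 = h P2 := line_unique (a2.2.1 _ a3).1 (b2.2.1 _ b3).1 hSO s2 a4 t2 b4
      apply finj hP1 hP2
      by_contra hff
      rw [hhe] at a5
      have : h P2 = lam := line_unique (b2.2.1 _ b3).1 hL.1 hff a5 b5 (mem_on.1 a1).2 (mem_on.1 b1).2
      exact (b2.2.1 _ b3).2 (this ▸ (mem_on.1 hP2).2))
    rw [hL.2, hτ.2] at this
    omega

/-- degree up to `N` well-behaved -/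
def Good (N : ℕ) : Prop :=
  (∀ m ≤ N, ∀ X, GC m X → Three m X) ∧
  (∀ m, m + 2 ≤ N → ∀ X lam nu nu', GC (m+2) X → Mx (m+2) X lam → New (m+1) X lam nu →
    New (m+1) X lam nu' → nu = nu')

theorem good_of (N : ℕ) (hGM : ∀ m ≤ N, ∀ X, GC m X → ∃ L, Mx m X L) : Good N := by
  have h3 : ∀ m ≤ N, ∀ X, GC m X → Three m X := by
    intro m
    induction m with
    | zero => intro _ X hX; exact three_zero hX
    | succ m ih =>
      intro hm X hX
      cases m with
      | zero => exact three_one hX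
      | succ k =>
        obtain ⟨lam, hL⟩ := hGM _ hm X hX
        have h3 := ih (by omega) _ (gc_del hX hL)
        have hu := fun nu nu' => new_uniq_step (nu := nu) (nu' := nu') hX hL h3
        obtain ⟨a, b, c, hab, hac, hbc, ha, hb, hc⟩ := h3
        rcases mx_del_cases hL.1 ha with ha' | ha'
        · rcases mx_del_cases hL.1 hb with hb' | hb'
          · exact ⟨lam, a, b, mx_ne_del ha, mx_ne_del hb, hab, hL, ha', hb'⟩
          · rcases mx_del_cases hL.1 hc with hc' | hc'
            · exact ⟨lam, a, c, mx_ne_del ha, mx_ne_del hc, hac, hL, ha', hc'⟩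
            · exact absurd (hu _ _ hb' hc') hbc
        · rcases mx_del_cases hL.1 hb with hb' | hb'
          · rcases mx_del_cases hL.1 hc with hc' | hc'
            · exact ⟨lam, b, c, mx_ne_del hb, mx_ne_del hc, hbc, hL, hb', hc'⟩
            · exact absurd (hu _ _ ha' hc') hac
          · exact absurd (hu _ _ ha' hb') hab
  exact ⟨h3, fun m hm X lam nu nu' hX hL => new_uniq_step hX hL (h3 (m+1) (by omega) _ (gc_del hX hL))⟩
end GCW

namespace GCW
open Classical

notation:70 a:70 "⊟" b:71 => del a b

theorem pair_gc {m Z a b} (hZ : GC (m+2) Z) (ha : Mx (m+2) Z a) (hb : New (m+1) Z a b) :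
    GC m (Z ⊟ a ⊟ b) := gc_del (gc_del hZ ha) hb.1

theorem pair_mx {m Z a b c} (hZ : GC (m+2) Z) (ha : Mx (m+2) Z a) (hb : New (m+1) Z a b)
    (hc : Mx (m+2) Z c) (hac : a ≠ c) : Mx m (Z ⊟ a ⊟ b) c :=
  mx_del (gc_del hZ ha) hb.1 (mx_del hZ ha hc hac) (new_ne_mx hZ ha hb hc)

theorem pair_new {m Z a b c d} (hZ : GC (m+3) Z) (ha : Mx (m+3) Z a) (hb : New (m+2) Z a b)
    (hc : Mx (m+3) Z c) (hd : New (m+2) Z c d) (hac : a ≠ c) : New m (Z ⊟ a ⊟ b) c d :=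
  new_stab (gc_del hZ ha) (mx_del hZ ha hc hac) (new_stab hZ hc hd ha hac.symm) hb.1
    (new_ne_mx hZ ha hb hc).symm

structure Cfg (d : ℕ) (X : Finset Pt) (l v : Fin 4 → Set Pt) : Prop where
  gc : GC (d+1) X
  inj : ∀ i j, i ≠ j → l i ≠ l j
  mx : ∀ i, Mx (d+1) X (l i)
  nw : ∀ i, New d X (l i) (v i)

namespace Cfg
variable {d e : ℕ} {X : Finset Pt} {l v : Fin 4 → Set Pt}

theorem vne (h : Cfg d X l v) {i j} (hij : i ≠ j) : v i ≠ v j := by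
  intro he
  obtain ⟨P, h1, h2, h3, -⟩ := new_meet h.gc (h.mx i) (h.nw i) (h.mx j) (h.inj _ _ hij)
  exact (h.nw j).2 P h1 h3 (he ▸ h2)

theorem lv (h : Cfg d X l v) (i j) : l i ≠ v j := (new_ne_mx h.gc (h.mx j) (h.nw j) (h.mx i)).symm

theorem del_step {m Z a c d} (hZ : GC (m+2) Z) (ha : Mx (m+2) Z a)
    (hc : Mx (m+2) Z c) (hd : New (m+1) Z c d) (hac : a ≠ c) :
    Mx (m+1) (Z ⊟ a) c ∧ New m (Z ⊟ a) c d :=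
  ⟨mx_del hZ ha hc hac, new_stab hZ hc hd ha hac.symm⟩

theorem ge6 (h : Cfg d X l v) : 5 ≤ d := by
  have l01 := h.inj 0 1 (by decide)
  have l02 := h.inj 0 2 (by decide)
  have l03 := h.inj 0 3 (by decide)
  have l12 := h.inj 1 2 (by decide)
  have l13 := h.inj 1 3 (by decide)
  have l23 := h.inj 2 3 (by decide)
  have v01 := h.vne (show (0:Fin 4) ≠ 1 by decide)
  have v02 := h.vne (show (0:Fin 4) ≠ 2 by decide)
  have v03 := h.vne (show (0:Fin 4) ≠ 3 by decide)
  have v12 := h.vne (show (1:Fin 4) ≠ 2 by decide)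
  have v13 := h.vne (show (1:Fin 4) ≠ 3 by decide)
  have v23 := h.vne (show (2:Fin 4) ≠ 3 by decide)
  have lv := h.lv
  rcases d with _ | d
  · exact absurd (gc_one_le h.gc (h.mx 0) (h.mx 1) (h.mx 2) (h.mx 3) l01 l02 l12 l03 l13) l23
  have g1 := gc_del h.gc (h.mx 0)
  have n0 := (h.nw 0).1
  obtain ⟨m1, n1⟩ := del_step h.gc (h.mx 0) (h.mx 1) (h.nw 1) l01
  obtain ⟨m2, n2⟩ := del_step h.gc (h.mx 0) (h.mx 2) (h.nw 2) l02
  obtain ⟨m3, n3⟩ := del_step h.gc (h.mx 0) (h.mx 3) (h.nw 3) l03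
  rcases d with _ | d
  · exact absurd (gc_one_le g1 m1 m2 m3 n0 l12 l13 l23 (lv _ _) (lv _ _)) (lv _ _)
  have g2 := gc_del g1 m1
  have n0 := mx_del g1 m1 n0 (lv _ _)
  have n1 := n1.1
  obtain ⟨m2, n2⟩ := del_step g1 m1 m2 n2 l12
  obtain ⟨m3, n3⟩ := del_step g1 m1 m3 n3 l13
  rcases d with _ | d
  · exact absurd (gc_one_le g2 m2 m3 n0 n1 l23 (lv _ _) (lv _ _) (lv _ _) (lv _ _)) v01
  have g3 := gc_del g2 m2
  have n0 := mx_del g2 m2 n0 (lv _ _)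
  have n1 := mx_del g2 m2 n1 (lv _ _)
  have n2 := n2.1
  obtain ⟨m3, n3⟩ := del_step g2 m2 m3 n3 l23
  rcases d with _ | d
  · exact absurd (gc_one_le g3 m3 n0 n1 n2 (lv _ _) (lv _ _) v01 (lv _ _) v02) v12
  have g4 := gc_del g3 m3
  have n0 := mx_del g3 m3 n0 (lv _ _)
  have n1 := mx_del g3 m3 n1 (lv _ _)
  have n2 := mx_del g3 m3 n2 (lv _ _)
  have n3 := n3.1
  rcases d with _ | d
  · exact absurd (gc_one_le g4 n0 n1 n2 n3 v01 v02 v12 v03 v13) v23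
  omega

/-- auxiliary hypotheses supplied by induction -/
structure Aux (e : ℕ) (X : Finset Pt) (l v : Fin 4 → Set Pt) : Prop extends Cfg (e+5) X l v where
  good : Good (e+6)
  all : ∀ t, Mx (e+6) X t → ∃ i, t = l i
  nonew : ∀ i w, ¬ New (e+4) (X ⊟ l i) (v i) w

variable {i j k p : Fin 4} {t t' : Set Pt}

theorem Aux.gc1 (h : Aux e X l v) (i) : GC (e+4) (X ⊟ l i ⊟ v i) := pair_gc h.gc (h.mx i) (h.nw i)
theorem Aux.mx1 (h : Aux e X l v) (hij : i ≠ j) : Mx (e+4) (X ⊟ l i ⊟ v i) (l j) :=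
  pair_mx h.gc (h.mx i) (h.nw i) (h.mx j) (h.inj _ _ hij)
theorem Aux.nw1 (h : Aux e X l v) (hij : i ≠ j) : New (e+3) (X ⊟ l i ⊟ v i) (l j) (v j) :=
  pair_new h.gc (h.mx i) (h.nw i) (h.mx j) (h.nw j) (h.inj _ _ hij)
theorem Aux.gc2 (h : Aux e X l v) (hij : i ≠ j) : GC (e+2) (X ⊟ l i ⊟ v i ⊟ l j ⊟ v j) :=
  pair_gc (h.gc1 i) (h.mx1 hij) (h.nw1 hij)
theorem Aux.mx2 (h : Aux e X l v) (hij : i ≠ j) (hik : i ≠ k) (hjk : j ≠ k) :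
    Mx (e+2) (X ⊟ l i ⊟ v i ⊟ l j ⊟ v j) (l k) :=
  pair_mx (h.gc1 i) (h.mx1 hij) (h.nw1 hij) (h.mx1 hik) (h.inj _ _ hjk)
theorem Aux.nw2 (h : Aux e X l v) (hij : i ≠ j) (hik : i ≠ k) (hjk : j ≠ k) :
    New (e+1) (X ⊟ l i ⊟ v i ⊟ l j ⊟ v j) (l k) (v k) :=
  pair_new (h.gc1 i) (h.mx1 hij) (h.nw1 hij) (h.mx1 hik) (h.nw1 hik) (h.inj _ _ hjk)
theorem Aux.gc3 (h : Aux e X l v) (hij : i ≠ j) (hik : i ≠ k) (hjk : j ≠ k) :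
    GC e (X ⊟ l i ⊟ v i ⊟ l j ⊟ v j ⊟ l k ⊟ v k) :=
  pair_gc (h.gc2 hij) (h.mx2 hij hik hjk) (h.nw2 hij hik hjk)
theorem Aux.mx3 (h : Aux e X l v) (hij : i ≠ j) (hik : i ≠ k) (hjk : j ≠ k)
    (hip : i ≠ p) (hjp : j ≠ p) (hkp : k ≠ p) :
    Mx e (X ⊟ l i ⊟ v i ⊟ l j ⊟ v j ⊟ l k ⊟ v k) (l p) :=
  pair_mx (h.gc2 hij) (h.mx2 hij hik hjk) (h.nw2 hij hik hjk) (h.mx2 hij hip hjp) (h.inj _ _ hkp)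

theorem Aux.c (h : Aux e X l v) (ht : Mx (e+4) (X ⊟ l i ⊟ v i) t) : ∃ j, i ≠ j ∧ t = l j := by
  have h0 := mx_ne_del ht
  rcases mx_del_cases (h.nw i).1.1 ht with h1 | h1
  · have h2 := mx_ne_del h1
    rcases mx_del_cases (h.mx i).1 h1 with h3 | h3
    · obtain ⟨j, rfl⟩ := h.all t h3
      exact ⟨j, by rintro rfl; exact h2 rfl, rfl⟩
    · exact absurd (h.good.2 (e+4) le_rfl _ _ _ _ h.gc (h.mx i) (h.nw i) h3) h0
  · exact absurd h1 (h.nonew i t)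

theorem Aux.dd (h : Aux e X l v) (hij : i ≠ j) (ht : Mx (e+3) (X ⊟ l i ⊟ v i ⊟ l j) t) :
    t = v j ∨ ∃ k, i ≠ k ∧ j ≠ k ∧ t = l k := by
  have h0 := mx_ne_del ht
  rcases mx_del_cases (h.mx j).1 ht with h1 | h1
  · obtain ⟨k, hik, rfl⟩ := h.c h1
    exact Or.inr ⟨k, hik, by rintro rfl; exact h0 rfl, rfl⟩
  · exact Or.inl (h.good.2 (e+2) (by omega) _ _ _ _ (h.gc1 i) (h.mx1 hij) h1 (h.nw1 hij))

def Tau (e : ℕ) (X : Finset Pt) (l v : Fin 4 → Set Pt) (i j : Fin 4) (t : Set Pt) : Prop :=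
  Mx (e+2) (X ⊟ l i ⊟ v i ⊟ l j ⊟ v j) t ∧ ∀ k, i ≠ k → j ≠ k → t ≠ l k

theorem Tau.symm (h : Tau e X l v i j t) : Tau e X l v j i t := by
  refine ⟨?_, fun k a b => h.2 k b a⟩
  have : X ⊟ l j ⊟ v j ⊟ l i ⊟ v i = X ⊟ l i ⊟ v i ⊟ l j ⊟ v j := by
    ext P; simp only [mem_del]; tauto
  rw [this]; exact h.1

theorem Tau.new (h : Aux e X l v) (hij : i ≠ j) (ht : Tau e X l v i j t) :
    New (e+2) (X ⊟ l i ⊟ v i ⊟ l j) (v j) t := by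
  have h0 := mx_ne_del ht.1
  rcases mx_del_cases (h.nw j).1.1 ht.1 with h1 | h1
  · rcases h.dd hij h1 with h2 | ⟨k, h2, h3, h4⟩
    · exact absurd h2.symm h0
    · exact absurd h4 (ht.2 k h2 h3)
  · exact h1

theorem Aux.exTau (h : Aux e X l v) (hij : i ≠ j) : ∃ t, Tau e X l v i j t := by
  obtain ⟨a, b, c, hab, hac, hbc, ha, hb, hc⟩ := h.good.1 (e+2) (by omega) _ (h.gc2 hij)
  by_contra! hn
  have key : ∀ t, Mx (e+2) (X ⊟ l i ⊟ v i ⊟ l j ⊟ v j) t → ∃ k, i ≠ k ∧ j ≠ k ∧ t = l k := by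
    intro t ht
    by_contra! hh
    exact hn t ⟨ht, hh⟩
  obtain ⟨k1, a1, a2, rfl⟩ := key a ha
  obtain ⟨k2, b1, b2, rfl⟩ := key b hb
  obtain ⟨k3, c1, c2, rfl⟩ := key c hc
  have h12 : k1 ≠ k2 := by rintro rfl; exact hab rfl
  have h13 : k1 ≠ k3 := by rintro rfl; exact hac rfl
  have h23 : k2 ≠ k3 := by rintro rfl; exact hbc rfl
  simp only [Ne, Fin.ext_iff] at *
  omega

theorem Tau.mx (h : Aux e X l v) (hij : i ≠ j) (hik : i ≠ k) (hjk : j ≠ k) (ht : Tau e X l v i j t) :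
    Mx (e+1) (X ⊟ l i ⊟ v i ⊟ l j ⊟ v j ⊟ l k) t :=
  mx_del (h.gc2 hij) (h.mx2 hij hik hjk) ht.1 (ht.2 k hik hjk).symm

theorem Tau.ne_v (h : Aux e X l v) (hij : i ≠ j) (hik : i ≠ k) (hjk : j ≠ k) (ht : Tau e X l v i j t) :
    t ≠ v k := by
  rintro rfl
  exact new_not_mx (h.gc2 hij) (h.mx2 hij hik hjk) (h.nw2 hij hik hjk) ht.1

theorem Tau.mx3 (h : Aux e X l v) (hij : i ≠ j) (hik : i ≠ k) (hjk : j ≠ k) (ht : Tau e X l v i j t) :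
    Mx e (X ⊟ l i ⊟ v i ⊟ l j ⊟ v j ⊟ l k ⊟ v k) t :=
  mx_del (gc_del (h.gc2 hij) (h.mx2 hij hik hjk)) (h.nw2 hij hik hjk).1 (ht.mx h hij hik hjk)
    (ht.ne_v h hij hik hjk).symm

theorem Tau.ne (h : Aux e X l v) (hij : i ≠ j) (hik : i ≠ k) (hjk : j ≠ k) (ht : Tau e X l v i j t)
    (ht' : Tau e X l v i k t') : t ≠ t' := by
  rintro rfl
  obtain ⟨P, hP, a, b⟩ := mx_meet (gc_del (h.gc2 hij) (h.mx2 hij hik hjk)) (ht.mx h hij hik hjk)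
    (h.nw2 hij hik hjk).1 (ht.ne_v h hij hik hjk)
  refine (ht'.new h hik).2 P ?_ b a
  simp only [mem_del] at hP ⊢
  tauto

theorem Aux.big (h : Aux (e+1) X l v) : False := by
  have h01 : (0 : Fin 4) ≠ 1 := by decide
  have h02 : (0 : Fin 4) ≠ 2 := by decide
  have h12 : (1 : Fin 4) ≠ 2 := by decide
  obtain ⟨t, ht⟩ := h.exTau h01
  obtain ⟨s, hs⟩ := h.exTau h02
  obtain ⟨u, hu⟩ := h.exTau h12
  have n1 := ht.ne h h01 h02 h12 hs
  have n2 := ht.symm.ne h h01.symm h12 h02 hu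
  have n3 := hs.symm.ne h h02.symm h12.symm h01 hu.symm
  have key : ∀ w, Mx (e+1) (X ⊟ l 0 ⊟ v 0 ⊟ l 1 ⊟ v 1 ⊟ l 2 ⊟ v 2) w → (∀ k, 2 ≠ k → 0 ≠ k → 1 ≠ k → w ≠ l k) →
      t ≠ w → New (e+1) (X ⊟ l 0 ⊟ v 0 ⊟ l 1 ⊟ v 1 ⊟ l 2) (v 2) w := by
    intro w hw hk htw
    have w0 := mx_ne_del hw
    rcases mx_del_cases (h.nw 2).1.1 hw with h1 | h1
    · have w1 := mx_ne_del h1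
      rcases mx_del_cases (h.mx 2).1 h1 with h3 | h3
      · by_cases hh : ∀ k, 0 ≠ k → 1 ≠ k → w ≠ l k
        · have hw : Tau (e+1) X l v 0 1 w := ⟨h3, hh⟩
          exact absurd (h.good.2 (e+2) (by omega) _ _ _ _ (gc_del (h.gc1 0) (h.mx1 h01)) (h.nw1 h01).1
            (ht.new h h01) (hw.new h h01)) htw
        · push Not at hh
          obtain ⟨k, a, b, c⟩ := hh
          by_cases h2 : 2 = k
          · subst h2; exact absurd c.symm w1
          · exact absurd c (hk k h2 a b)
      · exact absurd (h.good.2 (e+1) (by omega) _ _ _ _ (h.gc2 h01) (h.mx2 h01 h02 h12) h3 (h.nw2 h01 h02 h12)) w0.symm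
    · exact h1
  have k1 := key s (by
    have := hs.mx3 h h02 h01 h12.symm
    convert this using 1
    ext P; simp only [mem_del]; tauto) (fun k a b c => hs.2 k b a) n1
  have k2 := key u (by
    have := hu.mx3 h h12 h01.symm h02.symm
    convert this using 1
    ext P; simp only [mem_del]; tauto) (fun k a b c => hu.2 k c a) n2
  exact n3 (h.good.2 e (by omega) _ _ _ _ (gc_del (h.gc2 h01) (h.mx2 h01 h02 h12)) (h.nw2 h01 h02 h12).1 k1 k2)

end Cfg
end GCW

namespace GCW
open Classical

theorem lin4_norm {c1 c2 c3 c4 x y z x' y' z' : ℝ} (h1 : c1 + c2 + c3 + c4 = 0)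
    (h2 : c1 + c2 + x * c3 + y * c4 = 0) (h3 : c1 + x' * c2 + c3 + z * c4 = 0)
    (h4 : c1 + y' * c2 + z' * c3 + c4 = 0) (hx : x * x' = 1) (hy : y * y' = 1) (hz : z * z' = 1) :
    (c1 = 0 ∧ c2 = 0 ∧ c3 = 0 ∧ c4 = 0) ∨ x = 1 ∨ y = 1 ∨ z = 1 ∨ x * z * y' = 1 := by
  by_contra! hn
  obtain ⟨hc, nx, ny, nz, nn⟩ := hn
  have x0 : x ≠ 0 := left_ne_zero_of_mul_eq_one hx
  have y0 : y ≠ 0 := left_ne_zero_of_mul_eq_one hy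
  have z0 : z ≠ 0 := left_ne_zero_of_mul_eq_one hz
  have e1 : (x - 1) * c3 = - (y - 1) * c4 := by linear_combination h2 - h1
  have e2 : (x - 1) * c2 = x * (z - 1) * c4 := by linear_combination (x) * (h1 - h3) + c2 * hx
  have e3 : z * (1 - y) * c2 + y * (1 - z) * c3 = 0 := by
    linear_combination y * z * (h4 - h1) - z * c2 * hy - y * c3 * hz
  have x1 : x - 1 ≠ 0 := sub_ne_zero.2 nx
  have y1 : y - 1 ≠ 0 := sub_ne_zero.2 ny
  have z1 : z - 1 ≠ 0 := sub_ne_zero.2 nz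
  have e4 : (y - 1) * (z - 1) * (y - x * z) * c4 = 0 := by
    linear_combination (x - 1) * e3 - z * (1 - y) * e2 - y * (1 - z) * e1
  have hyxz : y - x * z ≠ 0 := by
    intro h
    apply nn
    linear_combination hy - y' * h
  have c40 : c4 = 0 := by
    rcases mul_eq_zero.1 e4 with h | h
    · exact absurd h (mul_ne_zero (mul_ne_zero y1 z1) hyxz)
    · exact h
  subst c40
  have c30 : c3 = 0 := by simpa [x1] using e1
  have c20 : c2 = 0 := by simpa [x1] using e2
  subst c30 c20
  exact hc (by linarith) rfl rfl rfl

theorem lin4 {M : Fin 4 → Fin 4 → ℝ} {c : Fin 4 → ℝ} (hc : c ≠ 0) (hM : ∀ i, ∑ j, M i j * c j = 0)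
    (hd : ∀ i, M i i ≠ 0) (hs : ∀ i j, M i j * M j i = M i i * M j j) :
    ∃ i j k, i ≠ j ∧ i ≠ k ∧ j ≠ k ∧ M i j * M j k * M k i = M i i * M j j * M k k := by
  have h0 : ∀ i j, M i j ≠ 0 := fun i j => left_ne_zero_of_mul (hs i j ▸ mul_ne_zero (hd i) (hd j))
  have key := @lin4_norm (M 0 0 * c 0) (M 0 1 * c 1) (M 0 2 * c 2) (M 0 3 * c 3)
    (M 1 2 * M 0 1 / (M 1 1 * M 0 2)) (M 1 3 * M 0 1 / (M 1 1 * M 0 3)) (M 2 3 * M 0 2 / (M 2 2 * M 0 3))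
    (M 2 1 * M 0 2 / (M 2 2 * M 0 1)) (M 3 1 * M 0 3 / (M 3 3 * M 0 1)) (M 3 2 * M 0 3 / (M 3 3 * M 0 2))
  simp only [Fin.sum_univ_four] at hM
  have m0 := hM 0
  have m1 := hM 1
  have m2 := hM 2
  have m3 := hM 3
  have a01 := hs 0 1
  have a02 := hs 0 2
  have a03 := hs 0 3
  have a12 := hs 1 2
  have a13 := hs 1 3
  have a23 := hs 2 3
  have t1 : ∀ i, M i 0 = M 0 0 * M i i / M 0 i := fun i => by
    rw [eq_div_iff (h0 _ _), ← hs 0 i]; ring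
  have := key m0 (by
      have := t1 1
      have e1 := h0 1 1; have e2 := h0 0 1; have e3 := h0 0 2; have e4 := h0 0 3
      field_simp
      field_simp at this
      linear_combination M 0 1 * m1 - c 0 * this) (by
      have := t1 2
      have e1 := h0 2 2; have e2 := h0 0 1; have e3 := h0 0 2; have e4 := h0 0 3
      field_simp
      field_simp at this
      linear_combination M 0 2 * m2 - c 0 * this) (by
      have := t1 3
      have e1 := h0 3 3; have e2 := h0 0 1; have e3 := h0 0 2; have e4 := h0 0 3
      field_simp
      field_simp at this
      linear_combination M 0 3 * m3 - c 0 * this) (by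
      have e1 := h0 1 1; have e2 := h0 0 1; have e3 := h0 0 2; have e4 := h0 2 2
      field_simp
      linear_combination a12) (by
      have e1 := h0 1 1; have e2 := h0 0 1; have e3 := h0 0 3; have e4 := h0 3 3
      field_simp
      linear_combination a13) (by
      have e1 := h0 2 2; have e2 := h0 0 2; have e3 := h0 0 3; have e4 := h0 3 3
      field_simp
      linear_combination a23)
  rcases this with ⟨h1, h2, h3, h4⟩ | h | h | h | h
  · exfalso; apply hc
    funext i
    fin_cases i
    · simpa [h0] using h1
    · simpa [h0] using h2
    · simpa [h0] using h3
    · simpa [h0] using h4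
  · refine ⟨0, 1, 2, by decide, by decide, by decide, ?_⟩
    have e1 := h0 1 1; have e3 := h0 0 2
    field_simp at h
    linear_combination M 2 0 * h + M 1 1 * a02
  · refine ⟨0, 1, 3, by decide, by decide, by decide, ?_⟩
    have e1 := h0 1 1; have e3 := h0 0 3
    field_simp at h
    linear_combination M 3 0 * h + M 1 1 * a03
  · refine ⟨0, 2, 3, by decide, by decide, by decide, ?_⟩
    have e1 := h0 2 2; have e3 := h0 0 3
    field_simp at h
    linear_combination M 3 0 * h + M 2 2 * a03
  · refine ⟨1, 2, 3, by decide, by decide, by decide, ?_⟩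
    have e1 := h0 1 1; have e2 := h0 0 1; have e3 := h0 0 2; have e4 := h0 0 3; have e5 := h0 2 2; have e6 := h0 3 3
    field_simp at h
    linear_combination h

theorem exists_rel (G : Fin 4 → Pt) : ∃ c : Fin 4 → ℝ, c ≠ 0 ∧ ∑ i, c i = 0 ∧
    ∑ i, c i * (G i).1 = 0 ∧ ∑ i, c i * (G i).2 = 0 := by
  let A : Matrix (Fin 3) (Fin 4) ℝ := fun r i => if r = 0 then 1 else if r = 1 then (G i).1 else (G i).2
  have : LinearMap.ker A.mulVecLin ≠ ⊥ := LinearMap.ker_ne_bot_of_finrank_lt (by simp)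
  obtain ⟨c, hc, h0⟩ := Submodule.exists_mem_ne_zero_of_ne_bot this
  refine ⟨c, h0, ?_, ?_, ?_⟩
  · have := congrFun (LinearMap.mem_ker.1 hc) 0
    rw [Matrix.mulVecLin_apply] at this
    simpa [A, Matrix.mulVec, dotProduct] using this
  · have := congrFun (LinearMap.mem_ker.1 hc) 1
    rw [Matrix.mulVecLin_apply] at this
    simpa [A, Matrix.mulVec, dotProduct, mul_comm] using this
  · have := congrFun (LinearMap.mem_ker.1 hc) 2
    rw [Matrix.mulVecLin_apply] at this
    simpa [A, Matrix.mulVec, dotProduct, mul_comm] using this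

theorem geo {a b c : Fin 4 → ℝ} {G : Fin 4 → Pt}
    (hd : ∀ i, a i * (G i).1 + b i * (G i).2 + c i ≠ 0)
    (hE : ∀ i j, i ≠ j → ∃ s : ℝ,
      (1 - s) * (a i * (G i).1 + b i * (G i).2 + c i) + s * (a i * (G j).1 + b i * (G j).2 + c i) = 0 ∧
      (1 - s) * (a j * (G i).1 + b j * (G i).2 + c j) + s * (a j * (G j).1 + b j * (G j).2 + c j) = 0)
    (hN : ∀ i j k, i ≠ j → i ≠ k → j ≠ k → ∀ x y z : ℝ, x * (G i).1 + y * (G i).2 + z = 0 →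
      x * (G j).1 + y * (G j).2 + z = 0 → x * (G k).1 + y * (G k).2 + z = 0 → x = 0 ∧ y = 0 ∧ z = 0) :
    ∃ i j, i ≠ j ∧ ∃ t : ℝ, a i = t * a j ∧ b i = t * b j ∧ c i = t * c j := by
  let M : Fin 4 → Fin 4 → ℝ := fun i j => a i * (G j).1 + b i * (G j).2 + c i
  obtain ⟨u, hu0, hu1, hu2, hu3⟩ := exists_rel G
  have hs : ∀ i j, M i j * M j i = M i i * M j j := by
    intro i j
    by_cases hij : i = j
    · subst hij; rfl
    obtain ⟨s, h1, h2⟩ := hE i j hij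
    change (1 - s) * M i i + s * M i j = 0 at h1
    change (1 - s) * M j i + s * M j j = 0 at h2
    have e1 : s * (M i j * M j i - M i i * M j j) = 0 := by linear_combination M j i * h1 - M i i * h2
    have e2 : (1 - s) * (M i j * M j i - M i i * M j j) = 0 := by linear_combination M i j * h2 - M j j * h1
    linear_combination e1 + e2
  have hMc : ∀ i, ∑ j, M i j * u j = 0 := by
    intro i
    have : ∑ j, M i j * u j = a i * ∑ j, u j * (G j).1 + b i * ∑ j, u j * (G j).2 + c i * ∑ j, u j := by
      simp only [Finset.mul_sum, ← Finset.sum_add_distrib]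
      apply Finset.sum_congr rfl
      intro j _
      simp only [M]; ring
    rw [this, hu1, hu2, hu3]; ring
  obtain ⟨i, j, k, hij, hik, hjk, h⟩ := lin4 hu0 hMc hd hs
  have hki : M k i ≠ 0 := left_ne_zero_of_mul (hs k i ▸ mul_ne_zero (hd k) (hd i) : M k i * M i k ≠ 0)
  have hjj : M j j ≠ 0 := hd j
  have h3 : M j j * M i k - M i j * M j k = 0 := by
    have : M k i * (M j j * M i k - M i j * M j k) = 0 := by linear_combination M j j * hs i k - h
    simpa [hki] using this
  have := hN i j k hij hik hjk (M j j * a i - M i j * a j) (M j j * b i - M i j * b j) (M j j * c i - M i j * c j)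
    (by have := hs i j; simp only [M] at this ⊢; linear_combination -this)
    (by simp only [M]; ring)
    (by simp only [M] at h3 ⊢; linear_combination h3)
  obtain ⟨e1, e2, e3⟩ := this
  refine ⟨i, j, hij, M i j / M j j, ?_, ?_, ?_⟩ <;> field_simp <;> linarith

theorem affine_comb {x y z : ℝ} (hxy : x ≠ 0 ∨ y ≠ 0) {P Q E : Pt} (hPQ : P ≠ Q)
    (hP : x * P.1 + y * P.2 + z = 0) (hQ : x * Q.1 + y * Q.2 + z = 0) (hE : x * E.1 + y * E.2 + z = 0) :
    ∃ s : ℝ, E.1 = (1 - s) * P.1 + s * Q.1 ∧ E.2 = (1 - s) * P.2 + s * Q.2 := by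
  obtain ⟨p, p'⟩ := P
  obtain ⟨q, q'⟩ := Q
  obtain ⟨e, e'⟩ := E
  simp only at *
  have det : (e - p) * (q' - p') - (e' - p') * (q - p) = 0 := by
    rcases hxy with h | h
    · have : x * ((e - p) * (q' - p') - (e' - p') * (q - p)) = 0 := by
        linear_combination (q' - p') * (hE - hP) - (e' - p') * (hQ - hP)
      simpa [h] using this
    · have : y * ((e - p) * (q' - p') - (e' - p') * (q - p)) = 0 := by
        linear_combination (e - p) * (hQ - hP) - (q - p) * (hE - hP)
      simpa [h] using this
  by_cases h : q - p = 0
  · have h' : q' - p' ≠ 0 := by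
      intro h'
      exact hPQ (by ext <;> simp <;> linarith)
    have : e - p = 0 := by
      have : (e - p) * (q' - p') = 0 := by linear_combination det + (e' - p') * h
      simpa [h'] using this
    refine ⟨(e' - p') / (q' - p'), ?_, ?_⟩
    · have h1 : q = p := by linarith
      have h2 : e = p := by linarith
      rw [h1, h2]; ring
    · field_simp; ring
  · refine ⟨(e - p) / (q - p), ?_, ?_⟩
    · field_simp; ring
    · field_simp; linear_combination - det

theorem fin4_compl (i j : Fin 4) (hij : i ≠ j) : ∃ k p : Fin 4, i ≠ k ∧ j ≠ k ∧ i ≠ p ∧ j ≠ p ∧ k ≠ p := by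
  have hne : (Finset.univ \ {i, j} : Finset (Fin 4)).card = 2 := by
    rw [Finset.card_sdiff_of_subset (Finset.subset_univ _), Finset.card_pair hij]; simp
  obtain ⟨k, p, h, he⟩ := Finset.card_eq_two.1 hne
  have hk : k ∈ (Finset.univ \ {i, j} : Finset (Fin 4)) := by rw [he]; simp
  have hp : p ∈ (Finset.univ \ {i, j} : Finset (Fin 4)) := by rw [he]; simp
  simp at hk hp
  exact ⟨k, p, Ne.symm hk.1, Ne.symm hk.2, Ne.symm hp.1, Ne.symm hp.2, h⟩

theorem fin4_four {i j k p : Fin 4} (hij : i ≠ j) (hik : i ≠ k) (hjk : j ≠ k) (hip : i ≠ p) (hjp : j ≠ p)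
    (hkp : k ≠ p) (q : Fin 4) (h1 : q ≠ i) (h2 : q ≠ j) (h3 : q ≠ k) : q = p := by
  simp only [Ne, Fin.ext_iff] at *
  omega

namespace Cfg
variable {X : Finset Pt} {l v : Fin 4 → Set Pt}

theorem Aux.exG (h : Aux 0 X l v) (i : Fin 4) : ∃ G : Pt, (∀ P, (P ∈ X ∧ ∀ j, j ≠ i → P ∉ l j ∧ P ∉ v j) ↔ P = G)
    ∧ G ∈ l i ∧ ∀ j t, i ≠ j → ∀ k p, i ≠ k → j ≠ k → i ≠ p → j ≠ p → k ≠ p → Tau 0 X l v k p t → G ∈ t := by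
  obtain ⟨j, hij⟩ : ∃ j, i ≠ j := ⟨i + 1, by simp⟩
  obtain ⟨k, p, hik, hjk, hip, hjp, hkp⟩ := fin4_compl i j hij
  have hg := h.gc3 hjk hjp hkp
  obtain ⟨G, hG⟩ := gc_zero hg
  have key : ∀ P, (P ∈ X ∧ ∀ j, j ≠ i → P ∉ l j ∧ P ∉ v j) ↔ P = G := by
    intro P
    rw [← Finset.mem_singleton, ← hG]
    simp only [mem_del]
    constructor
    · rintro ⟨a, b⟩
      have := b j hij.symm
      have := b k hik.symm
      have := b p hip.symm
      tauto
    · rintro ⟨⟨⟨⟨⟨⟨a, b⟩, c⟩, d⟩, e⟩, f⟩, g⟩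
      refine ⟨a, fun q hq => ?_⟩
      by_cases h1 : q = j
      · subst h1; exact ⟨b, c⟩
      by_cases h2 : q = k
      · subst h2; exact ⟨d, e⟩
      have := fin4_four hij hik hjk hip hjp hkp q hq h1 h2
      subst this; exact ⟨f, g⟩
  refine ⟨G, key, ?_, ?_⟩
  · have := h.mx3 hjk hjp hkp hij.symm hik.symm hip.symm
    rw [hG, mx_zero] at this
    exact this.2
  · intro j t hij k p hik hjk hip hjp hkp ht
    have hm := ht.mx3 h hkp hjk.symm hjp.symm
    obtain ⟨Q, hQ⟩ := gc_zero (h.gc3 hkp hjk.symm hjp.symm)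
    rw [hQ, mx_zero] at hm
    have hQ' : Q ∈ X ⊟ l k ⊟ v k ⊟ l p ⊟ v p ⊟ l j ⊟ v j := by rw [hQ]; simp
    have : Q = G := by
      rw [← key]
      simp only [mem_del] at hQ'
      obtain ⟨⟨⟨⟨⟨⟨a, b⟩, c⟩, d⟩, e⟩, f⟩, g⟩ := hQ'
      refine ⟨a, fun q hq => ?_⟩
      by_cases h1 : q = j
      · subst h1; exact ⟨f, g⟩
      by_cases h2 : q = k
      · subst h2; exact ⟨b, c⟩
      have := fin4_four hij hik hjk hip hjp hkp q hq h1 h2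
      subst this; exact ⟨d, e⟩
    rw [← this]; exact hm.2

theorem Aux.exE (h : Aux 0 X l v) {i j k p : Fin 4} (hij : i ≠ j) (hik : i ≠ k) (hjk : j ≠ k) (hip : i ≠ p) (hjp : j ≠ p)
    (hkp : k ≠ p) {t} (ht : Tau 0 X l v k p t) : ∃ e : Pt, e ∈ v i ∧ e ∈ v j ∧ e ∈ t := by
  have g2 := h.gc2 hkp
  have m1 := h.mx2 hkp hik.symm hip.symm
  have n1 := h.nw2 hkp hik.symm hip.symm
  have m2 := h.mx2 hkp hjk.symm hjp.symm
  have n2 := h.nw2 hkp hjk.symm hjp.symm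
  have g3 := gc_del g2 m1
  have m2' := mx_del g2 m1 m2 (h.inj _ _ hij)
  have n2' := new_stab g2 m2 n2 m1 (h.inj _ _ hij).symm
  have g4 := gc_del g3 m2'
  have a1 := mx_del g3 m2' n1.1 (h.lv _ _)
  have a2 := n2'.1
  have a3 := mx_del g3 m2' (ht.mx h hkp hik.symm hip.symm) (ht.2 j hjk.symm hjp.symm).symm
  obtain ⟨e, he⟩ := gc_zero g4
  rw [he, mx_zero] at a1 a2 a3
  exact ⟨e, a1.2, a2.2, a3.2⟩

theorem Aux.small (h : Aux 0 X l v) : False := by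
  choose G hG hGl hGt using h.exG
  have hGX : ∀ i, G i ∈ X := fun i => ((hG i (G i)).2 rfl).1
  have hGo : ∀ i j, j ≠ i → G i ∉ l j := fun i j hj => (((hG i (G i)).2 rfl).2 j hj).1
  have hGne : ∀ i j, i ≠ j → G i ≠ G j := by
    intro i j hij he
    exact hGo j i hij (he ▸ hGl i)
  have hGv : ∀ i, G i ∉ v i := fun i => (h.nw i).2 _ (hGX i) (hGl i)
  have hvl : ∀ i, IsLine (v i) := fun i => (h.nw i).1.1
  choose a b c hab hv using hvl
  have mem : ∀ i P, P ∈ v i ↔ a i * P.1 + b i * P.2 + c i = 0 := by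
    intro i P; rw [hv i]; rfl
  obtain ⟨i, j, hij, s, e1, e2, e3⟩ := @geo a b c G (fun i hi => hGv i ((mem i (G i)).2 hi)) (by
    intro i j hij
    obtain ⟨k, p, hik, hjk, hip, hjp, hkp⟩ := fin4_compl i j hij
    obtain ⟨t, ht⟩ := h.exTau hkp
    obtain ⟨e, he1, he2, he3⟩ := h.exE hij hik hjk hip hjp hkp ht
    have hi := hGt i j t hij k p hik hjk hip hjp hkp ht
    have hj := hGt j i t hij.symm k p hjk hik hjp hip hkp ht
    obtain ⟨x, y, z, hxy, rfl⟩ := ht.1.1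
    obtain ⟨s, hs1, hs2⟩ := affine_comb hxy (hGne i j hij) hi hj he3
    rw [mem] at he1 he2
    rw [hs1, hs2] at he1 he2
    exact ⟨s, by linear_combination he1, by linear_combination he2⟩) (by
    intro i j k hij hik hjk x y z h1 h2 h3
    by_cases hxy : x ≠ 0 ∨ y ≠ 0
    · exfalso
      have hL : IsLine {P : Pt | x * P.1 + y * P.2 + z = 0} := ⟨x, y, z, hxy, rfl⟩
      obtain ⟨p, hip, hjp, hkp⟩ : ∃ p, i ≠ p ∧ j ≠ p ∧ k ≠ p := by
        obtain ⟨p, q, hip, hjp, hiq, hjq, hpq⟩ := fin4_compl i j hij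
        by_cases hk : k = p
        · exact ⟨q, hiq, hjq, hk ▸ hpq⟩
        · exact ⟨p, hip, hjp, hk⟩
      obtain ⟨t, ht⟩ := h.exTau hkp
      obtain ⟨t', ht'⟩ := h.exTau hjp
      have q1 := hGt i j t hij k p hik hjk hip hjp hkp ht
      have q2 := hGt j i t hij.symm k p hjk hik hjp hip hkp ht
      have q3 := hGt i k t' hik j p hij hjk.symm hip hkp hjp ht'
      have q4 := hGt k i t' hik.symm j p hjk.symm hij hkp hip hjp ht'
      have := line_unique ht.1.1 hL (hGne _ _ hij) q1 q2 h1 h2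
      have := line_unique ht'.1.1 hL (hGne _ _ hik) q3 q4 h1 h3
      exact ht.symm.ne h hkp.symm hjp.symm hjk.symm ht'.symm (by simp_all)
    · push Not at hxy
      obtain ⟨rfl, rfl⟩ := hxy
      exact ⟨rfl, rfl, by linarith⟩)
  apply h.vne hij.symm
  obtain ⟨P, hP, Q, hQ, hPQ⟩ : ∃ P ∈ v j, ∃ Q ∈ v j, P ≠ Q := by
    have hm := h.nw j
    have : 1 < (on (X ⊟ l j) (v j)).card := by rw [hm.1.2]; omega
    obtain ⟨P, hP, Q, hQ, hPQ⟩ := Finset.one_lt_card.1 this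
    exact ⟨P, (mem_on.1 hP).2, Q, (mem_on.1 hQ).2, hPQ⟩
  have sub : ∀ P, P ∈ v j → P ∈ v i := by
    intro P hP
    rw [mem] at hP ⊢
    rw [e1, e2, e3]; linear_combination s * hP
  exact line_unique (h.nw j).1.1 (h.nw i).1.1 hPQ hP hQ (sub _ hP) (sub _ hQ)

end Cfg

theorem Good.mono {N m} (h : Good N) (hm : m ≤ N) : Good m :=
  ⟨fun k hk => h.1 k (by omega), fun k hk => h.2 k (by omega)⟩

theorem FF {N} (hN : Good N) : ∀ d, d + 1 ≤ N → ∀ X l v, ¬ Cfg d X l v := by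
  intro d
  induction d with
  | zero => intro _ X l v h; have := h.ge6; omega
  | succ d ih =>
    intro hd X l v h
    have h6 := h.ge6
    obtain ⟨e, rfl⟩ : ∃ e, d = e + 4 := ⟨d - 4, by omega⟩
    have aux : Cfg.Aux e X l v := by
      refine ⟨h, hN.mono (by omega), ?_, ?_⟩
      · intro t ht
        by_contra! hn
        refine ih (by omega) (X ⊟ t) l v ⟨gc_del h.gc ht, h.inj, ?_, ?_⟩
        · intro i; exact mx_del h.gc ht (h.mx i) (hn i)
        · intro i; exact new_stab h.gc (h.mx i) (h.nw i) ht (hn i).symm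
      · intro i w hw
        have hw1 := (h.nw i).1
        refine ih (by omega) (X ⊟ l i) (Function.update l i (v i)) (Function.update v i w) ⟨gc_del h.gc (h.mx i), ?_, ?_, ?_⟩
        · intro j k hjk
          by_cases hj : j = i
          · subst hj
            rw [Function.update_self, Function.update_of_ne hjk.symm]
            exact (h.lv _ _).symm
          · rw [Function.update_of_ne hj]
            by_cases hk : k = i
            · subst hk
              rw [Function.update_self]
              exact h.lv _ _
            · rw [Function.update_of_ne hk]; exact h.inj _ _ hjk
        · intro j
          by_cases hj : j = i
          · subst hj
            rw [Function.update_self]; exact hw1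
          · rw [Function.update_of_ne hj]
            exact mx_del h.gc (h.mx i) (h.mx j) (h.inj _ _ (Ne.symm hj))
        · intro j
          by_cases hj : j = i
          · subst hj
            rw [Function.update_self, Function.update_self]; exact hw
          · rw [Function.update_of_ne hj, Function.update_of_ne hj]
            exact new_stab h.gc (h.mx j) (h.nw j) (h.mx i) (h.inj _ _ hj)
    rcases e with _ | e
    · exact aux.small
    · exact aux.big

end GCW

namespace GCW
open Classical MvPolynomial

theorem dvd_of_vanish' {l p : Poly2} {d : ℕ} (hl : l.totalDegree = 1) (hp : p.totalDegree ≤ d + 1) (F : Finset Pt)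
    (hF : ∀ P ∈ F, evalPt l P = 0) (hc : d + 2 ≤ F.card) (hv : ∀ P ∈ F, evalPt p P = 0) :
    ∃ q : Poly2, p = l * q ∧ q.totalDegree ≤ d := by
  obtain ⟨q, h1, h2⟩ := dvd_of_vanish hl hp F hF (by omega) hv
  rcases h2 with rfl | h2
  · exact ⟨0, by simp, by simp⟩
  · exact ⟨q, h1, by omega⟩

theorem exists_pt {r c1 c2 c3 : Poly2} (hr : r.totalDegree = 1) (h1 : c1.totalDegree = 1)
    (h2 : c2.totalDegree = 1) (h3 : c3.totalDegree = 1) {g1 g2 g3 : Pt}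
    (r1 : evalPt r g1 = 0) (r2 : evalPt r g2 = 0) (r3 : evalPt r g3 = 0)
    (e1 : evalPt c1 g1 = 0) (e2 : evalPt c2 g2 = 0) (e3 : evalPt c3 g3 = 0)
    (n1 : evalPt c1 g2 ≠ 0) (n2 : evalPt c2 g1 ≠ 0) (n3 : evalPt c3 g1 ≠ 0) :
    ∃ Z, evalPt r Z = 0 ∧ evalPt c1 Z ≠ 0 ∧ evalPt c2 Z ≠ 0 ∧ evalPt c3 Z ≠ 0 := by
  obtain ⟨F, hF, hc⟩ := line_pts (isLine_zeroSet hr) 4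
  have : ∃ Z ∈ F, Z ∉ ({g1, g2, g3} : Finset Pt) := by
    apply Finset.exists_mem_notMem_of_card_lt_card
    rw [hc]
    exact lt_of_le_of_lt Finset.card_le_three (by norm_num)
  obtain ⟨Z, hZ, hn⟩ := this
  simp only [Finset.mem_insert, Finset.mem_singleton, not_or] at hn
  have hZr : evalPt r Z = 0 := hF Z hZ
  have key : ∀ (c : Poly2) (g g' : Pt), c.totalDegree = 1 → evalPt r g = 0 → evalPt c g = 0 → evalPt r g' = 0 →
      evalPt c g' ≠ 0 → Z ≠ g → evalPt c Z ≠ 0 := by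
    intro c g g' hc hrg hcg hrg' hcg' hZg hcZ
    have : zeroSet c = zeroSet r := line_unique (isLine_zeroSet hc) (isLine_zeroSet hr) hZg hcZ hcg hZr hrg
    exact hcg' ((Set.ext_iff.1 this g').2 hrg')
  exact ⟨Z, hZr, key c1 g1 g2 h1 r1 e1 r2 n1 hn.1, key c2 g2 g1 h2 r2 e2 r1 n2 hn.2.1,
    key c3 g3 g1 h3 r3 e3 r1 n3 hn.2.2⟩

theorem totalDegree_mul3 {a b c : Poly2} (ha : a.totalDegree = 1) (hb : b.totalDegree = 1) (hc : c.totalDegree = 1) :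
    (a * b * c).totalDegree ≤ 3 := by
  have h1 := totalDegree_mul (a * b) c
  have h2 := totalDegree_mul a b
  omega

theorem ne_of_eval {p : Poly2} {P Q : Pt} (hP : evalPt p P = 0) (hQ : evalPt p Q ≠ 0) : P ≠ Q := by
  rintro rfl; exact hQ hP

/-- Cayley-Bacharach type lemma for a 3 by 3 grid. -/
theorem CB {r c : Fin 3 → Poly2} {g : Fin 3 → Fin 3 → Pt} {F : Poly2}
    (hr : ∀ i, (r i).totalDegree = 1) (hc : ∀ i, (c i).totalDegree = 1)
    (hrg : ∀ i j, evalPt (r i) (g i j) = 0) (hcg : ∀ i j, evalPt (c j) (g i j) = 0)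
    (hrn : ∀ i i' j, i ≠ i' → evalPt (r i) (g i' j) ≠ 0)
    (hcn : ∀ i j j', j ≠ j' → evalPt (c j) (g i j') ≠ 0)
    (hF : F.totalDegree ≤ 3) (hv : ∀ i j, ¬ (i = 0 ∧ j = 0) → evalPt F (g i j) = 0) :
    evalPt F (g 0 0) = 0 := by
  have gne : ∀ i j j', j ≠ j' → g i j ≠ g i j' := fun i j j' h => ne_of_eval (hcg i j) (hcn i j j' h)
  obtain ⟨Z, hZ, z1, z2, z3⟩ := exists_pt (hr 1) (hc 0) (hc 1) (hc 2) (hrg 1 0) (hrg 1 1) (hrg 1 2) (hcg 1 0) (hcg 1 1)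
    (hcg 1 2) (hcn 1 0 1 (by decide)) (hcn 1 1 0 (by decide)) (hcn 1 2 0 (by decide))
  set K := c 0 * c 1 * c 2 with hK
  have hKZ : evalPt K Z ≠ 0 := by simp [hK, z1, z2, z3]
  have hKg : ∀ i j, evalPt K (g i j) = 0 := by
    intro i j
    have := hcg i j
    fin_cases j <;> simp at this <;> simp [hK, this]
  set F' := F - C (evalPt F Z / evalPt K Z) * K with hF'
  have hF'g : ∀ i j, ¬ (i = 0 ∧ j = 0) → evalPt F' (g i j) = 0 := by
    intro i j h
    simp [hF', hv i j h, hKg]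
  have hF'Z : evalPt F' Z = 0 := by
    simp [hF', hKZ]
  have hF'd : F'.totalDegree ≤ 2 + 1 := by
    refine le_trans (totalDegree_sub _ _) (max_le hF ?_)
    refine le_trans (totalDegree_mul _ _) ?_
    rw [totalDegree_C]
    have := totalDegree_mul3 (hc 0) (hc 1) (hc 2)
    rw [zero_add]; exact this
  have n01 := gne 1 0 1 (by decide)
  have n02 := gne 1 0 2 (by decide)
  have n12 := gne 1 1 2 (by decide)
  have hZg : ∀ j, g 1 j ≠ Z := by
    intro j hj
    exact hKZ (hj ▸ hKg 1 j)
  obtain ⟨q, hq, hqd⟩ := dvd_of_vanish' (hr 1) hF'd {g 1 0, g 1 1, g 1 2, Z} (by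
      simp [hrg, hZ]) (by
      rw [Finset.card_insert_of_notMem, Finset.card_insert_of_notMem, Finset.card_insert_of_notMem, Finset.card_singleton] <;>
        simp [n01, n02, n12, hZg]) (by
      simp [hF'Z, hF'g])
  have hq2 : ∀ j, evalPt q (g 2 j) = 0 := by
    intro j
    have := hF'g 2 j (by simp)
    rw [hq, evalPt_mul] at this
    exact (mul_eq_zero.1 this).resolve_left (hrn 1 2 j (by decide))
  have m01 := gne 2 0 1 (by decide)
  have m02 := gne 2 0 2 (by decide)
  have m12 := gne 2 1 2 (by decide)
  obtain ⟨s, hs, hsd⟩ := dvd_of_vanish' (d := 1) (hr 2) hqd {g 2 0, g 2 1, g 2 2} (by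
      simp [hrg]) (by
      rw [Finset.card_insert_of_notMem, Finset.card_insert_of_notMem, Finset.card_singleton] <;>
        simp [m01, m02, m12]) (by
      simp [hq2])
  have hs0 : ∀ j, j ≠ 0 → evalPt s (g 0 j) = 0 := by
    intro j hj
    have := hF'g 0 j (by simp [hj])
    rw [hq, hs, evalPt_mul, evalPt_mul] at this
    have := (mul_eq_zero.1 this).resolve_left (hrn 1 0 j (by decide))
    exact (mul_eq_zero.1 this).resolve_left (hrn 2 0 j (by decide))
  have k12 := gne 0 1 2 (by decide)
  obtain ⟨u, hu, hud⟩ := dvd_of_vanish' (d := 0) (hr 0) hsd {g 0 1, g 0 2} (by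
      simp [hrg]) (by
      rw [Finset.card_pair k12]) (by
      simp [hs0])
  have : evalPt F' (g 0 0) = 0 := by
    rw [hq, hs, hu]; simp [hrg]
  simpa [hF', hKg] using this

/-- Abstract dual configuration. -/
structure Dual (n : ℕ) (A B C : ℕ → Pt) (r : ℕ → ℕ → Poly2) : Prop where
  deg : ∀ j k, j < n → k < n → j + k ≤ n → (r j k).totalDegree = 1
  iA : ∀ j k i, j < n → k < n → j + k ≤ n → 1 ≤ i → i = j + k → evalPt (r j k) (A i) = 0
  iB : ∀ j k, j < n → k < n → j + k ≤ n → evalPt (r j k) (B j) = 0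
  iC : ∀ j k, j < n → k < n → j + k ≤ n → evalPt (r j k) (C k) = 0
  nA : ∀ j k i, j < n → k < n → j + k ≤ n → 1 ≤ i → i ≤ n → i ≠ j + k → ¬ (j + k = n ∧ i = 1) →
    evalPt (r j k) (A i) ≠ 0
  nB : ∀ j k j', j < n → k < n → j + k ≤ n → j' < n → j' ≠ j → ¬ (j = 0 ∧ j' + 1 = n) →
    evalPt (r j k) (B j') ≠ 0
  nC : ∀ j k k', j < n → k < n → j + k ≤ n → k' < n → k' ≠ k → ¬ (k = 0 ∧ k' + 1 = n) →
    evalPt (r j k) (C k') ≠ 0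

namespace Dual
variable {n : ℕ} {A B C : ℕ → Pt} {r : ℕ → ℕ → Poly2}

theorem swap (h : Dual n A B C r) : Dual n A C B (fun j k => r k j) where
  deg j k a b c := h.deg k j b a (by omega)
  iA j k i a b c d e := h.iA k j i b a (by omega) d (by omega)
  iB j k a b c := h.iC k j b a (by omega)
  iC j k a b c := h.iB k j b a (by omega)
  nA j k i a b c d e f g := h.nA k j i b a (by omega) d e (by omega) (by omega)
  nB j k j' a b c d e f := h.nC k j j' b a (by omega) d e f
  nC j k j' a b c d e f := h.nB k j j' b a (by omega) d e f

/-- the points, indexed by type and number -/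
def pt (A B C : ℕ → Pt) (s : ℕ × ℕ) : Pt := if s.1 = 0 then A s.2 else if s.1 = 1 then B s.2 else C s.2

def Inc (s p : ℕ × ℕ) : Prop :=
  (s.1 = 0 ∧ 1 ≤ s.2 ∧ s.2 = p.1 + p.2) ∨ (s.1 = 1 ∧ s.2 = p.1) ∨ (s.1 = 2 ∧ s.2 = p.2)

def NInc (n : ℕ) (s p : ℕ × ℕ) : Prop :=
  (s.1 = 0 ∧ 1 ≤ s.2 ∧ s.2 ≤ n ∧ s.2 ≠ p.1 + p.2 ∧ ¬ (p.1 + p.2 = n ∧ s.2 = 1)) ∨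
  (s.1 = 1 ∧ s.2 < n ∧ s.2 ≠ p.1 ∧ ¬ (p.1 = 0 ∧ s.2 + 1 = n)) ∨
  (s.1 = 2 ∧ s.2 < n ∧ s.2 ≠ p.2 ∧ ¬ (p.2 = 0 ∧ s.2 + 1 = n))

def Ok (n : ℕ) (p : ℕ × ℕ) : Prop := p.1 < n ∧ p.2 < n ∧ p.1 + p.2 ≤ n

theorem inc (h : Dual n A B C r) {s p : ℕ × ℕ} (hp : Ok n p) (hi : Inc s p) :
    evalPt (r p.1 p.2) (pt A B C s) = 0 := by
  obtain ⟨t, i⟩ := s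
  obtain ⟨a, b, c⟩ := hp
  rcases hi with ⟨h1, h2, h3⟩ | ⟨h1, h2⟩ | ⟨h1, h2⟩ <;> simp only at h1 <;> subst h1
  · exact h.iA _ _ _ a b c h2 h3
  · simp only at h2; subst h2; exact h.iB _ _ a b c
  · simp only at h2; subst h2; exact h.iC _ _ a b c

theorem ninc (h : Dual n A B C r) {s p : ℕ × ℕ} (hp : Ok n p) (hi : NInc n s p) :
    evalPt (r p.1 p.2) (pt A B C s) ≠ 0 := by
  obtain ⟨t, i⟩ := s
  obtain ⟨a, b, c⟩ := hp
  rcases hi with ⟨h1, h2, h3, h4, h5⟩ | ⟨h1, h2, h3, h4⟩ | ⟨h1, h2, h3, h4⟩ <;> simp only at h1 <;> subst h1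
  · exact h.nA _ _ _ a b c h2 h3 h4 h5
  · exact h.nB _ _ _ a b c h2 h3 h4
  · exact h.nC _ _ _ a b c h2 h3 h4

def Kn (a b c : ℕ) (s : ℕ × ℕ) : Prop :=
  (s.1 = 0 ∧ 1 ≤ s.2 ∧ s.2 ≤ a) ∨ (s.1 = 1 ∧ s.2 < b) ∨ (s.1 = 2 ∧ s.2 < c)

theorem kn {F : Poly2} {a b c : ℕ} (vA : ∀ i, 1 ≤ i → i ≤ a → evalPt F (A i) = 0)
    (vB : ∀ i, i < b → evalPt F (B i) = 0) (vC : ∀ i, i < c → evalPt F (C i) = 0) {s : ℕ × ℕ} (h : Kn a b c s) :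
    evalPt F (pt A B C s) = 0 := by
  obtain ⟨t, i⟩ := s
  rcases h with ⟨h1, h2, h3⟩ | ⟨h1, h2⟩ | ⟨h1, h2⟩ <;> simp only at h1 <;> subst h1
  · exact vA _ h2 h3
  · exact vB _ h2
  · exact vC _ h2

theorem grid (h : Dual n A B C r) {F : Poly2} (hF : F.totalDegree ≤ 3) (g : Fin 3 → Fin 3 → ℕ × ℕ)
    (ρ κ : Fin 3 → ℕ × ℕ)
    (hρ : ∀ i, Ok n (ρ i)) (hκ : ∀ i, Ok n (κ i))
    (h1 : ∀ i j, Inc (g i j) (ρ i) ∧ Inc (g i j) (κ j))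
    (h3 : ∀ i i' j, i ≠ i' → NInc n (g i' j) (ρ i))
    (h4 : ∀ i j j', j ≠ j' → NInc n (g i j') (κ j))
    (hv : ∀ i j, ¬ (i = 0 ∧ j = 0) → evalPt F (pt A B C (g i j)) = 0) : evalPt F (pt A B C (g 0 0)) = 0 :=
  CB (r := fun i => r (ρ i).1 (ρ i).2) (c := fun i => r (κ i).1 (κ i).2) (g := fun i j => pt A B C (g i j))
    (fun i => h.deg _ _ (hρ i).1 (hρ i).2.1 (hρ i).2.2) (fun i => h.deg _ _ (hκ i).1 (hκ i).2.1 (hκ i).2.2)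
    (fun i j => h.inc (hρ i) (h1 i j).1) (fun i j => h.inc (hκ j) (h1 i j).2)
    (fun i i' j hi => h.ninc (hρ i) (h3 i i' j hi)) (fun i j j' hj => h.ninc (hκ j) (h4 i j j' hj)) hF hv

set_option maxHeartbeats 1000000 in
theorem stepC (h : Dual n A B C r) {F : Poly2} (hF : F.totalDegree ≤ 3) (m : ℕ) (hm : m + 4 ≤ n)
    (vA : ∀ i, 1 ≤ i → i ≤ m + 4 → evalPt F (A i) = 0)
    (vB : ∀ i, i < m + 3 → evalPt F (B i) = 0)
    (vC : ∀ i, i < m + 3 → evalPt F (C i) = 0) : evalPt F (C (m+3)) = 0 := by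
  refine h.grid hF ![![(2, m+3), (0, m+3), (1, 0)], ![(0, m+4), (1, 2), (2, m+2)], ![(1, 1), (2, m+1), (0, m+2)]]
    ![(0,m+3),(2,m+2),(1,m+1)] ![(1,m+3),(2,m+1),(0,m+2)] ?_ ?_ ?_ ?_ ?_ ?_
  · intro i; fin_cases i <;> simp [Ok] <;> omega
  · intro i; fin_cases i <;> simp [Ok] <;> omega
  · intro i j; fin_cases i <;> fin_cases j <;> simp [Inc] <;> omega
  · intro i i' j; fin_cases i <;> fin_cases i' <;> fin_cases j <;> simp [NInc] <;> omega
  · intro i j j'; fin_cases i <;> fin_cases j <;> fin_cases j' <;> simp [NInc] <;> omega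
  · intro i j hij
    refine kn vA vB vC ?_
    revert hij
    fin_cases i <;> fin_cases j <;> simp [Kn]

set_option maxHeartbeats 1000000 in
theorem stepA (h : Dual n A B C r) {F : Poly2} (hF : F.totalDegree ≤ 3) (m : ℕ) (hm : m + 5 ≤ n)
    (vA : ∀ i, 1 ≤ i → i ≤ m + 4 → evalPt F (A i) = 0)
    (vB : ∀ i, i < m + 4 → evalPt F (B i) = 0)
    (vC : ∀ i, i < m + 4 → evalPt F (C i) = 0) : evalPt F (A (m+5)) = 0 := by
  refine h.grid hF ![![(0, m+5), (1, 2), (2, m+3)], ![(1, 3), (2, m), (0, m+3)], ![(2, m+2), (0, m+2), (1, 0)]]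
    ![(2,m+3),(3,m),(0,m+2)] ![(3,m+2),(2,m),(0,m+3)] ?_ ?_ ?_ ?_ ?_ ?_
  · intro i; fin_cases i <;> simp [Ok] <;> omega
  · intro i; fin_cases i <;> simp [Ok] <;> omega
  · intro i j; fin_cases i <;> fin_cases j <;> simp [Inc] <;> omega
  · intro i i' j; fin_cases i <;> fin_cases i' <;> fin_cases j <;> simp [NInc] <;> omega
  · intro i j j'; fin_cases i <;> fin_cases j <;> fin_cases j' <;> simp [NInc] <;> omega
  · intro i j hij
    refine kn vA vB vC ?_
    revert hij
    fin_cases i <;> fin_cases j <;> simp [Kn]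

set_option maxHeartbeats 1000000 in
theorem stepA4 (h : Dual n A B C r) {F : Poly2} (hF : F.totalDegree ≤ 3) (hm : 4 ≤ n)
    (vA : ∀ i, 1 ≤ i → i ≤ 3 → evalPt F (A i) = 0)
    (vB : ∀ i, i < 4 → evalPt F (B i) = 0)
    (vC : ∀ i, i < 3 → evalPt F (C i) = 0) : evalPt F (A 4) = 0 := by
  refine h.grid hF ![![(0, 4), (1, 2), (2, 2)], ![(1, 3), (2, 0), (0, 3)], ![(2, 1), (0, 2), (1, 1)]]
    ![(2,2),(3,0),(1,1)] ![(3,1),(2,0),(1,2)] ?_ ?_ ?_ ?_ ?_ ?_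
  · intro i; fin_cases i <;> simp [Ok] <;> omega
  · intro i; fin_cases i <;> simp [Ok] <;> omega
  · intro i j; fin_cases i <;> fin_cases j <;> simp [Inc]
  · intro i i' j; fin_cases i <;> fin_cases i' <;> fin_cases j <;> simp [NInc] <;> omega
  · intro i j j'; fin_cases i <;> fin_cases j <;> fin_cases j' <;> simp [NInc] <;> omega
  · intro i j hij
    refine kn vA vB vC ?_
    revert hij
    fin_cases i <;> fin_cases j <;> simp [Kn]

theorem all (h : Dual n A B C r) {F : Poly2} (hF : F.totalDegree ≤ 3) (hn : 4 ≤ n)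
    (vA : ∀ i, 1 ≤ i → i ≤ 3 → evalPt F (A i) = 0)
    (vB : ∀ i, i < 4 → evalPt F (B i) = 0)
    (vC : ∀ i, i < 3 → evalPt F (C i) = 0) : ∀ m, m + 4 ≤ n →
    (∀ i, 1 ≤ i → i ≤ m + 4 → evalPt F (A i) = 0) ∧ (∀ i, i < m + 4 → evalPt F (B i) = 0) ∧
      (∀ i, i < m + 4 → evalPt F (C i) = 0) := by
  intro m
  induction m with
  | zero =>
    intro _
    have h4 := h.stepA4 hF hn vA vB vC
    have vA' : ∀ i, 1 ≤ i → i ≤ 0 + 4 → evalPt F (A i) = 0 := by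
      intro i h1 h2
      by_cases hi : i = 4
      · subst hi; exact h4
      · exact vA i h1 (by omega)
    refine ⟨vA', vB, ?_⟩
    intro i hi
    by_cases h3 : i = 3
    · subst h3; exact h.stepC hF 0 hn vA' (fun i hi => vB i (by omega)) vC
    · exact vC i (by omega)
  | succ m ih =>
    intro hm
    obtain ⟨a, b, c⟩ := ih (by omega)
    have h5 := h.stepA hF m (by omega) a b c
    have vA' : ∀ i, 1 ≤ i → i ≤ m + 1 + 4 → evalPt F (A i) = 0 := by
      intro i h1 h2
      by_cases hi : i = m + 5
      · subst hi; exact h5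
      · exact a i h1 (by omega)
    refine ⟨vA', ?_, ?_⟩
    · intro i hi
      by_cases h3 : i = m + 4
      · subst h3; exact h.swap.stepC hF (m+1) hm vA' c b
      · exact b i (by omega)
    · intro i hi
      by_cases h3 : i = m + 4
      · subst h3; exact h.stepC hF (m+1) hm vA' b c
      · exact c i (by omega)

theorem main (h : Dual n A B C r) {b c : ℕ} (hb : 2 ≤ b) (hc : 2 ≤ c) (hbc : b + c = n)
    (hB : evalPt (r b c) (A 1) = 0) : False := by
  have I := @h.inc
  have J := @h.ninc
  set R := r 1 2 * r 2 0 * r 0 1 with hR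
  set K := r 2 1 * r 1 0 * r 0 2 with hK
  have dg : ∀ j k, j < n → k < n → j + k ≤ n → (r j k).totalDegree = 1 := h.deg
  have RD : R.totalDegree ≤ 3 := totalDegree_mul3 (dg _ _ (by omega) (by omega) (by omega))
    (dg _ _ (by omega) (by omega) (by omega)) (dg _ _ (by omega) (by omega) (by omega))
  have KD : K.totalDegree ≤ 3 := totalDegree_mul3 (dg _ _ (by omega) (by omega) (by omega))
    (dg _ _ (by omega) (by omega) (by omega)) (dg _ _ (by omega) (by omega) (by omega))
  have r0 : ∀ j k, j < n → k < n → j + k ≤ n → r j k ≠ 0 := by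
    intro j k h1 h2 h3 he
    have := dg j k h1 h2 h3
    rw [he] at this; simp at this
  have R0 : R ≠ 0 := mul_ne_zero (mul_ne_zero (r0 _ _ (by omega) (by omega) (by omega))
    (r0 _ _ (by omega) (by omega) (by omega))) (r0 _ _ (by omega) (by omega) (by omega))
  obtain ⟨α, β, hαβ, h3⟩ : ∃ α β : ℝ, (α ≠ 0 ∨ β ≠ 0) ∧ α * evalPt R (B 3) + β * evalPt K (B 3) = 0 := by
    by_cases hR : evalPt R (B 3) = 0
    · exact ⟨1, 0, by simp, by simp [hR]⟩
    · exact ⟨evalPt K (B 3), - evalPt R (B 3), by simp [hR], by ring⟩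
  set F := MvPolynomial.C α * R + MvPolynomial.C β * K with hFdef
  have hFd : F.totalDegree ≤ 3 := by
    refine le_trans (totalDegree_add _ _) (max_le ?_ ?_) <;>
    · refine le_trans (totalDegree_mul _ _) ?_
      rw [totalDegree_C]; omega
  have F0 : F ≠ 0 := by
    intro hF0
    obtain ⟨Z, hZ, z1, z2, z3⟩ := @exists_pt (r 1 2) (r 2 1) (r 1 0) (r 0 2)
      (dg _ _ (by omega) (by omega) (by omega)) (dg _ _ (by omega) (by omega) (by omega))
      (dg _ _ (by omega) (by omega) (by omega)) (dg _ _ (by omega) (by omega) (by omega)) (A 3) (B 1) (C 2)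
      (h.iA _ _ _ (by omega) (by omega) (by omega) (by omega) (by omega))
      (h.iB _ _ (by omega) (by omega) (by omega)) (h.iC _ _ (by omega) (by omega) (by omega))
      (h.iA _ _ _ (by omega) (by omega) (by omega) (by omega) (by omega))
      (h.iB _ _ (by omega) (by omega) (by omega)) (h.iC _ _ (by omega) (by omega) (by omega))
      (h.nB _ _ _ (by omega) (by omega) (by omega) (by omega) (by omega) (by omega))
      (h.nA _ _ _ (by omega) (by omega) (by omega) (by omega) (by omega) (by omega) (by omega))
      (h.nA _ _ _ (by omega) (by omega) (by omega) (by omega) (by omega) (by omega) (by omega))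
    have : evalPt F Z = β * evalPt K Z := by simp [hFdef, hR, hZ]
    rw [hF0, evalPt_zero] at this
    have hb0 : β = 0 := by
      rcases mul_eq_zero.1 this.symm with h | h
      · exact h
      · simp [hK, z1, z2, z3] at h
    have ha0 : α ≠ 0 := by rcases hαβ with h | h; exact h; exact absurd hb0 h
    rw [hFdef, hb0] at hF0
    simp [ha0, R0] at hF0
  have base : ∀ P, evalPt R P = 0 → evalPt K P = 0 → evalPt F P = 0 := by
    intro P h1 h2; simp [hFdef, h1, h2]
  have a1 : evalPt F (A 1) = 0 := base _ (by
    have := h.iA 0 1 1 (by omega) (by omega) (by omega) (by omega) (by omega); simp [hR, this]) (by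
    have := h.iA 1 0 1 (by omega) (by omega) (by omega) (by omega) (by omega); simp [hK, this])
  have a2 : evalPt F (A 2) = 0 := base _ (by
    have := h.iA 2 0 2 (by omega) (by omega) (by omega) (by omega) (by omega); simp [hR, this]) (by
    have := h.iA 0 2 2 (by omega) (by omega) (by omega) (by omega) (by omega); simp [hK, this])
  have a3 : evalPt F (A 3) = 0 := base _ (by
    have := h.iA 1 2 3 (by omega) (by omega) (by omega) (by omega) (by omega); simp [hR, this]) (by
    have := h.iA 2 1 3 (by omega) (by omega) (by omega) (by omega) (by omega); simp [hK, this])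
  have b0 : evalPt F (B 0) = 0 := base _ (by
    have := h.iB 0 1 (by omega) (by omega) (by omega); simp [hR, this]) (by
    have := h.iB 0 2 (by omega) (by omega) (by omega); simp [hK, this])
  have b1 : evalPt F (B 1) = 0 := base _ (by
    have := h.iB 1 2 (by omega) (by omega) (by omega); simp [hR, this]) (by
    have := h.iB 1 0 (by omega) (by omega) (by omega); simp [hK, this])
  have b2 : evalPt F (B 2) = 0 := base _ (by
    have := h.iB 2 0 (by omega) (by omega) (by omega); simp [hR, this]) (by
    have := h.iB 2 1 (by omega) (by omega) (by omega); simp [hK, this])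
  have b3 : evalPt F (B 3) = 0 := by simp [hFdef, h3]
  have c0 : evalPt F (C 0) = 0 := base _ (by
    have := h.iC 2 0 (by omega) (by omega) (by omega); simp [hR, this]) (by
    have := h.iC 1 0 (by omega) (by omega) (by omega); simp [hK, this])
  have c1 : evalPt F (C 1) = 0 := base _ (by
    have := h.iC 0 1 (by omega) (by omega) (by omega); simp [hR, this]) (by
    have := h.iC 2 1 (by omega) (by omega) (by omega); simp [hK, this])
  have c2 : evalPt F (C 2) = 0 := base _ (by
    have := h.iC 1 2 (by omega) (by omega) (by omega); simp [hR, this]) (by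
    have := h.iC 0 2 (by omega) (by omega) (by omega); simp [hK, this])
  obtain ⟨vA, vB, vC⟩ := h.all hFd (by omega) (by intro i h1 h2; interval_cases i <;> assumption)
    (by intro i h2; interval_cases i <;> assumption) (by intro i h2; interval_cases i <;> assumption) (n - 4) (by omega)
  have vA' : ∀ i, 1 ≤ i → i ≤ n → evalPt F (A i) = 0 := fun i a b => vA i a (by omega)
  have vB' : ∀ i, i < n → evalPt F (B i) = 0 := fun i b => vB i (by omega)
  have vC' : ∀ i, i < n → evalPt F (C i) = 0 := fun i b => vC i (by omega)
  have n1 : A 1 ≠ A n := ne_of_eval (p := r 0 1) (h.iA _ _ _ (by omega) (by omega) (by omega) (by omega) (by omega))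
    (h.nA _ _ _ (by omega) (by omega) (by omega) (by omega) (by omega) (by omega) (by omega))
  have n2 : A 1 ≠ B b := ne_of_eval (p := r 1 0) (h.iA _ _ _ (by omega) (by omega) (by omega) (by omega) (by omega))
    (h.nB _ _ _ (by omega) (by omega) (by omega) (by omega) (by omega) (by omega))
  have n3 : A 1 ≠ C c := ne_of_eval (p := r 0 1) (h.iA _ _ _ (by omega) (by omega) (by omega) (by omega) (by omega))
    (h.nC _ _ _ (by omega) (by omega) (by omega) (by omega) (by omega) (by omega))
  have n4 : B b ≠ A n := ne_of_eval (p := r b 0) (h.iB _ _ (by omega) (by omega) (by omega))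
    (h.nA _ _ _ (by omega) (by omega) (by omega) (by omega) (by omega) (by omega) (by omega))
  have n5 : C c ≠ A n := ne_of_eval (p := r 0 c) (h.iC _ _ (by omega) (by omega) (by omega))
    (h.nA _ _ _ (by omega) (by omega) (by omega) (by omega) (by omega) (by omega) (by omega))
  have n6 : B b ≠ C c := ne_of_eval (p := r b 0) (h.iB _ _ (by omega) (by omega) (by omega))
    (h.nC _ _ _ (by omega) (by omega) (by omega) (by omega) (by omega) (by omega))
  obtain ⟨Q, hQ, hQd⟩ := dvd_of_vanish' (d := 2) (dg b c (by omega) (by omega) (by omega)) hFd {A 1, A n, B b, C c} (by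
      intro P hP
      simp only [Finset.mem_insert, Finset.mem_singleton] at hP
      rcases hP with rfl | rfl | rfl | rfl
      · exact hB
      · exact h.iA _ _ _ (by omega) (by omega) (by omega) (by omega) (by omega)
      · exact h.iB _ _ (by omega) (by omega) (by omega)
      · exact h.iC _ _ (by omega) (by omega) (by omega)) (by
      rw [Finset.card_insert_of_notMem, Finset.card_insert_of_notMem, Finset.card_insert_of_notMem, Finset.card_singleton] <;>
        simp [n1, n2, n3, n4.symm, n5.symm, n6]) (by
      intro P hP
      simp only [Finset.mem_insert, Finset.mem_singleton] at hP
      rcases hP with rfl | rfl | rfl | rfl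
      · exact vA' _ (by omega) (by omega)
      · exact vA' _ (by omega) (by omega)
      · exact vB' _ (by omega)
      · exact vC' _ (by omega))
  have vQ : ∀ P, evalPt F P = 0 → evalPt (r b c) P ≠ 0 → evalPt Q P = 0 := by
    intro P h1 h2
    rw [hQ, evalPt_mul] at h1
    exact (mul_eq_zero.1 h1).resolve_left h2
  have q1 : evalPt Q (B 0) = 0 := vQ _ b0 (h.nB _ _ _ (by omega) (by omega) (by omega) (by omega) (by omega) (by omega))
  have q2 : evalPt Q (B 1) = 0 := vQ _ b1 (h.nB _ _ _ (by omega) (by omega) (by omega) (by omega) (by omega) (by omega))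
  have q3 : evalPt Q (C 0) = 0 := vQ _ c0 (h.nC _ _ _ (by omega) (by omega) (by omega) (by omega) (by omega) (by omega))
  have q4 : evalPt Q (C 1) = 0 := vQ _ c1 (h.nC _ _ _ (by omega) (by omega) (by omega) (by omega) (by omega) (by omega))
  have q5 : evalPt Q (A 2) = 0 := vQ _ a2 (h.nA _ _ _ (by omega) (by omega) (by omega) (by omega) (by omega) (by omega) (by omega))
  have q6 : evalPt Q (A 3) = 0 := vQ _ a3 (h.nA _ _ _ (by omega) (by omega) (by omega) (by omega) (by omega) (by omega) (by omega))
  have m1 : B 1 ≠ A 2 := ne_of_eval (p := r 1 0) (h.iB _ _ (by omega) (by omega) (by omega))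
    (h.nA _ _ _ (by omega) (by omega) (by omega) (by omega) (by omega) (by omega) (by omega))
  have m2 : C 1 ≠ A 2 := ne_of_eval (p := r 0 1) (h.iC _ _ (by omega) (by omega) (by omega))
    (h.nA _ _ _ (by omega) (by omega) (by omega) (by omega) (by omega) (by omega) (by omega))
  have m3 : B 1 ≠ C 1 := ne_of_eval (p := r 1 0) (h.iB _ _ (by omega) (by omega) (by omega))
    (h.nC _ _ _ (by omega) (by omega) (by omega) (by omega) (by omega) (by omega))
  obtain ⟨S, hS, hSd⟩ := dvd_of_vanish' (d := 1) (dg 1 1 (by omega) (by omega) (by omega)) hQd {A 2, B 1, C 1} (by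
      intro P hP
      simp only [Finset.mem_insert, Finset.mem_singleton] at hP
      rcases hP with rfl | rfl | rfl
      · exact h.iA _ _ _ (by omega) (by omega) (by omega) (by omega) (by omega)
      · exact h.iB _ _ (by omega) (by omega) (by omega)
      · exact h.iC _ _ (by omega) (by omega) (by omega)) (by
      rw [Finset.card_insert_of_notMem, Finset.card_insert_of_notMem, Finset.card_singleton] <;>
        simp [m1.symm, m2.symm, m3]) (by
      intro P hP
      simp only [Finset.mem_insert, Finset.mem_singleton] at hP
      rcases hP with rfl | rfl | rfl <;> assumption)
  have vS : ∀ P, evalPt Q P = 0 → evalPt (r 1 1) P ≠ 0 → evalPt S P = 0 := by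
    intro P h1 h2
    rw [hS, evalPt_mul] at h1
    exact (mul_eq_zero.1 h1).resolve_left h2
  have s1 : evalPt S (B 0) = 0 := vS _ q1 (h.nB _ _ _ (by omega) (by omega) (by omega) (by omega) (by omega) (by omega))
  have s2 : evalPt S (C 0) = 0 := vS _ q3 (h.nC _ _ _ (by omega) (by omega) (by omega) (by omega) (by omega) (by omega))
  have s3 : evalPt S (A 3) = 0 := vS _ q6 (h.nA _ _ _ (by omega) (by omega) (by omega) (by omega) (by omega) (by omega) (by omega))
  have m4 : B 0 ≠ C 0 := ne_of_eval (p := r 0 1) (h.iB _ _ (by omega) (by omega) (by omega))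
    (h.nC _ _ _ (by omega) (by omega) (by omega) (by omega) (by omega) (by omega))
  obtain ⟨U, hU, hUd⟩ := dvd_of_vanish' (d := 0) (dg 0 0 (by omega) (by omega) (by omega)) hSd {B 0, C 0} (by
      intro P hP
      simp only [Finset.mem_insert, Finset.mem_singleton] at hP
      rcases hP with rfl | rfl
      · exact h.iB _ _ (by omega) (by omega) (by omega)
      · exact h.iC _ _ (by omega) (by omega) (by omega)) (by
      rw [Finset.card_pair m4]) (by
      intro P hP
      simp only [Finset.mem_insert, Finset.mem_singleton] at hP
      rcases hP with rfl | rfl <;> assumption)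
  have hU0 : U = MvPolynomial.C (U.coeff 0) := totalDegree_eq_zero_iff_eq_C.1 (by omega)
  have : evalPt U (A 3) = 0 := by
    rw [hU, evalPt_mul] at s3
    exact (mul_eq_zero.1 s3).resolve_left
      (h.nA _ _ _ (by omega) (by omega) (by omega) (by omega) (by omega) (by omega) (by omega))
  rw [hU0, evalPt_C] at this
  rw [this] at hU0
  apply F0
  rw [hQ, hS, hU, hU0]; simp

end Dual
end GCW

namespace GCW
open Classical

structure Tri (n : ℕ) (X : Finset Pt) (p q r : Set Pt) : Prop where
  gc : GC n X
  pq : p ≠ q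
  pr : p ≠ r
  qr : q ≠ r
  mp : Mx n X p
  mq : Mx n X q
  mr : Mx n X r
  only : ∀ t, Mx n X t → t = p ∨ t = q ∨ t = r

theorem Tri.rot {n X p q r} (h : Tri n X p q r) : Tri n X q r p :=
  ⟨h.gc, h.qr, h.pq.symm, h.pr.symm, h.mq, h.mr, h.mp, fun t ht => by have := h.only t ht; tauto⟩

theorem Tri.swap {n X p q r} (h : Tri n X p q r) : Tri n X q p r :=
  ⟨h.gc, h.pq.symm, h.qr, h.pr, h.mq, h.mp, h.mr, fun t ht => by have := h.only t ht; tauto⟩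

theorem tri_del {N m Z p q r p'} (hN : Good N) (hm : m + 2 ≤ N) (h : Tri (m+2) Z p q r)
    (hn : New (m+1) Z p p') : Tri (m+1) (Z ⊟ p) p' q r where
  gc := gc_del h.gc h.mp
  pq := new_ne_mx h.gc h.mp hn h.mq
  pr := new_ne_mx h.gc h.mp hn h.mr
  qr := h.qr
  mp := hn.1
  mq := mx_del h.gc h.mp h.mq h.pq
  mr := mx_del h.gc h.mp h.mr h.pr
  only t ht := by
    have h0 := mx_ne_del ht
    rcases mx_del_cases h.mp.1 ht with h1 | h1
    · rcases h.only t h1 with rfl | h2 | h2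
      · exact absurd rfl h0
      · exact Or.inr (Or.inl h2)
      · exact Or.inr (Or.inr h2)
    · exact Or.inl (hN.2 m hm _ _ _ _ h.gc h.mp h1 hn)

theorem tri_ex {N m Z p q r} (hN : Good N) (hm : m + 2 ≤ N) (h : Tri (m+2) Z p q r) :
    ∃ p', New (m+1) Z p p' := by
  by_contra! hn
  obtain ⟨a, b, c, hab, hac, hbc, ha, hb, hc⟩ := hN.1 (m+1) (by omega) _ (gc_del h.gc h.mp)
  have key : ∀ t, Mx (m+1) (Z ⊟ p) t → t = q ∨ t = r := by
    intro t ht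
    have h0 := mx_ne_del ht
    rcases mx_del_cases h.mp.1 ht with h1 | h1
    · rcases h.only t h1 with rfl | h2 | h2
      · exact absurd rfl h0
      · exact Or.inl h2
      · exact Or.inr h2
    · exact absurd h1 (hn t)
  rcases key a ha with rfl | rfl <;> rcases key b hb with rfl | rfl <;> rcases key c hc with rfl | rfl <;> simp_all

noncomputable def D1 (X : Finset Pt) (a : ℕ → Set Pt) (x : ℕ) : Finset Pt := X.filter fun P => ∀ i < x, P ∉ a i

theorem mem_D1 {X a x P} : P ∈ D1 X a x ↔ P ∈ X ∧ ∀ i < x, P ∉ a i := by simp [D1]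

theorem D1_zero {X a} : D1 X a 0 = X := by ext; simp [mem_D1]
theorem forall_lt_succ' {p : ℕ → Prop} {x} : (∀ i < x + 1, p i) ↔ (∀ i < x, p i) ∧ p x := by
  constructor
  · intro h; exact ⟨fun i hi => h i (by omega), h x (by omega)⟩
  · rintro ⟨h1, h2⟩ i hi
    rcases Nat.lt_succ_iff_lt_or_eq.1 hi with h | rfl
    · exact h1 i h
    · exact h2
theorem D1_succ {X a x} : D1 X a (x+1) = D1 X a x ⊟ a x := by
  ext P; simp only [mem_D1, mem_del, forall_lt_succ']; tauto
theorem forall_lt_shift {p : ℕ → Prop} {x} : (∀ i < x + 1, p i) ↔ p 0 ∧ (∀ i < x, p (i+1)) := by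
  constructor
  · intro h; exact ⟨h 0 (by omega), fun i hi => h (i+1) (by omega)⟩
  · rintro ⟨h1, h2⟩ i hi
    rcases i with _ | i
    · exact h1
    · exact h2 i (by omega)
theorem D1_shift {X a x} : D1 X a (x+1) = D1 (X ⊟ a 0) (fun i => a (i+1)) x := by
  ext P; simp only [mem_D1, mem_del, forall_lt_shift]; tauto

theorem chain {N} (hN : Good N) : ∀ n, n ≤ N → ∀ X p q r, Tri n X p q r → ∃ a : ℕ → Set Pt, a 0 = p ∧
    ∀ x m, x + m + 2 = n → New (m+1) (D1 X a x) (a x) (a (x+1)) := by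
  intro n
  induction n with
  | zero => intro _ X p q r _; exact ⟨fun _ => p, rfl, fun x m h => by omega⟩
  | succ n ih =>
    intro hn X p q r h
    rcases n with _ | n
    · exact ⟨fun _ => p, rfl, fun x m h => by omega⟩
    obtain ⟨p', hp'⟩ := tri_ex hN hn h
    obtain ⟨a, ha0, ha⟩ := ih (by omega) _ _ _ _ (tri_del hN hn h hp')
    refine ⟨fun i => if i = 0 then p else a (i-1), by simp, ?_⟩
    intro x m hx
    rcases x with _ | x
    · obtain rfl : m = n := by omega
      simpa [D1_zero, ha0] using hp'
    · have := ha x m (by omega)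
      rw [D1_shift]; simpa using this

noncomputable def R (X : Finset Pt) (a b c : ℕ → Set Pt) (x y z : ℕ) : Finset Pt :=
  X.filter fun P => (∀ i < x, P ∉ a i) ∧ (∀ i < y, P ∉ b i) ∧ (∀ i < z, P ∉ c i)

section
variable {X : Finset Pt} {a b c : ℕ → Set Pt} {x y z : ℕ} {P : Pt}

theorem mem_R : P ∈ R X a b c x y z ↔ P ∈ X ∧ (∀ i < x, P ∉ a i) ∧ (∀ i < y, P ∉ b i) ∧ (∀ i < z, P ∉ c i) := by
  simp [R]
theorem R_rot : R X a b c x y z = R X b c a y z x := by ext P; simp only [mem_R]; tauto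
theorem R_swap : R X a b c x y z = R X b a c y x z := by ext P; simp only [mem_R]; tauto
theorem R_a : R X a b c (x+1) y z = R X a b c x y z ⊟ a x := by
  ext P; simp only [mem_R, mem_del, forall_lt_succ']; tauto
theorem R_b : R X a b c x (y+1) z = R X a b c x y z ⊟ b y := by
  ext P; simp only [mem_R, mem_del, forall_lt_succ']; tauto
theorem R_c : R X a b c x y (z+1) = R X a b c x y z ⊟ c z := by
  ext P; simp only [mem_R, mem_del, forall_lt_succ']; tauto
theorem R_0 : R X a b c 0 0 0 = X := by ext P; simp [mem_R]
theorem R_x00 : R X a b c x 0 0 = D1 X a x := by ext P; simp [mem_R, mem_D1]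
theorem R_0y0 : R X a b c 0 y 0 = D1 X b y := by ext P; simp [mem_R, mem_D1]
theorem R_00z : R X a b c 0 0 z = D1 X c z := by ext P; simp [mem_R, mem_D1]
theorem R_shift : R (X ⊟ a 0) (fun i => a (i+1)) b c x y z = R X a b c (x+1) y z := by
  ext P; simp only [mem_R, mem_del, forall_lt_shift]; tauto
end

structure Lat (n : ℕ) (X : Finset Pt) (a b c : ℕ → Set Pt) : Prop where
  tri : ∀ x y z m, x + y + z + m + 1 = n → Tri (m+1) (R X a b c x y z) (a x) (b y) (c z)
  na : ∀ x y z m, x + y + z + m + 2 = n → New (m+1) (R X a b c x y z) (a x) (a (x+1))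
  nb : ∀ x y z m, x + y + z + m + 2 = n → New (m+1) (R X a b c x y z) (b y) (b (y+1))
  nc : ∀ x y z m, x + y + z + m + 2 = n → New (m+1) (R X a b c x y z) (c z) (c (z+1))

theorem lat_of {N n X p q r} (hN : Good N) (hn : n ≤ N) (h : Tri n X p q r) :
    ∃ a b c : ℕ → Set Pt, a 0 = p ∧ b 0 = q ∧ c 0 = r ∧ Lat n X a b c := by
  obtain ⟨a, ha0, ha⟩ := chain hN n hn X p q r h
  obtain ⟨b, hb0, hb⟩ := chain hN n hn X q r p h.rot
  obtain ⟨c, hc0, hc⟩ := chain hN n hn X r p q h.rot.rot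
  refine ⟨a, b, c, ha0, hb0, hc0, ?_⟩
  have key : ∀ s x y z, x + y + z = s →
      (∀ m, s + m + 1 = n → Tri (m+1) (R X a b c x y z) (a x) (b y) (c z)) ∧
      (∀ m, s + m + 2 = n → New (m+1) (R X a b c x y z) (a x) (a (x+1)) ∧
        New (m+1) (R X a b c x y z) (b y) (b (y+1)) ∧ New (m+1) (R X a b c x y z) (c z) (c (z+1))) := by
    intro s
    induction s with
    | zero =>
      intro x y z hs
      obtain ⟨rfl, rfl, rfl⟩ : x = 0 ∧ y = 0 ∧ z = 0 := by omega
      rw [R_0]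
      refine ⟨?_, ?_⟩
      · rintro m hm
        obtain rfl : n = m + 1 := by omega
        rw [ha0, hb0, hc0]; exact h
      · rintro m hm
        have h1 := ha 0 m hm
        have h2 := hb 0 m hm
        have h3 := hc 0 m hm
        rw [D1_zero] at h1 h2 h3
        exact ⟨h1, h2, h3⟩
    | succ s ih =>
      intro x y z hs
      refine ⟨?_, ?_⟩
      · intro m hm
        by_cases hx : 0 < x
        · obtain ⟨x, rfl⟩ : ∃ x', x = x' + 1 := ⟨x - 1, by omega⟩
          obtain ⟨h1, h2⟩ := ih x y z (by omega)
          rw [R_a]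
          exact tri_del hN (by omega) (h1 (m+1) (by omega)) (h2 m (by omega)).1
        by_cases hy : 0 < y
        · obtain ⟨y, rfl⟩ : ∃ x', y = x' + 1 := ⟨y - 1, by omega⟩
          obtain ⟨h1, h2⟩ := ih x y z (by omega)
          rw [R_b]
          exact (tri_del hN (by omega) (h1 (m+1) (by omega)).swap (h2 m (by omega)).2.1).swap
        · obtain ⟨z, rfl⟩ : ∃ x', z = x' + 1 := ⟨z - 1, by omega⟩
          obtain ⟨h1, h2⟩ := ih x y z (by omega)
          rw [R_c]
          exact (tri_del hN (by omega) (h1 (m+1) (by omega)).rot.rot (h2 m (by omega)).2.2).rot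
      · intro m hm
        have sa : 0 < x → New (m+1) (R X a b c x y z) (b y) (b (y+1)) ∧ New (m+1) (R X a b c x y z) (c z) (c (z+1)) := by
          intro hx
          obtain ⟨x, rfl⟩ : ∃ x', x = x' + 1 := ⟨x - 1, by omega⟩
          obtain ⟨h1, h2⟩ := ih x y z (by omega)
          have t := h1 (m+2) (by omega)
          have w := h2 (m+1) (by omega)
          rw [R_a]
          exact ⟨new_stab t.gc t.mq w.2.1 t.mp t.pq.symm, new_stab t.gc t.mr w.2.2 t.mp t.pr.symm⟩
        have sb : 0 < y → New (m+1) (R X a b c x y z) (a x) (a (x+1)) ∧ New (m+1) (R X a b c x y z) (c z) (c (z+1)) := by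
          intro hx
          obtain ⟨y, rfl⟩ : ∃ x', y = x' + 1 := ⟨y - 1, by omega⟩
          obtain ⟨h1, h2⟩ := ih x y z (by omega)
          have t := h1 (m+2) (by omega)
          have w := h2 (m+1) (by omega)
          rw [R_b]
          exact ⟨new_stab t.gc t.mp w.1 t.mq t.pq, new_stab t.gc t.mr w.2.2 t.mq t.qr.symm⟩
        have sc : 0 < z → New (m+1) (R X a b c x y z) (a x) (a (x+1)) ∧ New (m+1) (R X a b c x y z) (b y) (b (y+1)) := by
          intro hx
          obtain ⟨z, rfl⟩ : ∃ x', z = x' + 1 := ⟨z - 1, by omega⟩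
          obtain ⟨h1, h2⟩ := ih x y z (by omega)
          have t := h1 (m+2) (by omega)
          have w := h2 (m+1) (by omega)
          rw [R_c]
          exact ⟨new_stab t.gc t.mp w.1 t.mr t.pr, new_stab t.gc t.mq w.2.1 t.mr t.qr⟩
        refine ⟨?_, ?_, ?_⟩
        · by_cases hy : 0 < y
          · exact (sb hy).1
          by_cases hz : 0 < z
          · exact (sc hz).1
          obtain ⟨rfl, rfl⟩ : y = 0 ∧ z = 0 := by omega
          rw [R_x00]; exact ha x m (by omega)
        · by_cases hy : 0 < x
          · exact (sa hy).1
          by_cases hz : 0 < z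
          · exact (sc hz).2
          obtain ⟨rfl, rfl⟩ : x = 0 ∧ z = 0 := by omega
          rw [R_0y0]; exact hb y m (by omega)
        · by_cases hy : 0 < x
          · exact (sa hy).2
          by_cases hz : 0 < y
          · exact (sb hz).2
          obtain ⟨rfl, rfl⟩ : x = 0 ∧ y = 0 := by omega
          rw [R_00z]; exact hc z m (by omega)
  exact ⟨fun x y z m hm => (key _ x y z rfl).1 m hm, fun x y z m hm => ((key _ x y z rfl).2 m hm).1,
    fun x y z m hm => ((key _ x y z rfl).2 m hm).2.1, fun x y z m hm => ((key _ x y z rfl).2 m hm).2.2⟩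

namespace Lat
variable {n : ℕ} {X : Finset Pt} {a b c : ℕ → Set Pt}

theorem rot (h : Lat n X a b c) : Lat n X b c a where
  tri y z x m hm := by rw [← R_rot]; exact (h.tri x y z m (by omega)).rot
  na y z x m hm := by rw [← R_rot]; exact (h.nb x y z m (by omega))
  nb y z x m hm := by rw [← R_rot]; exact (h.nc x y z m (by omega))
  nc y z x m hm := by rw [← R_rot]; exact (h.na x y z m (by omega))

theorem swap (h : Lat n X a b c) : Lat n X b a c where
  tri y x z m hm := by rw [← R_swap]; exact (h.tri x y z m (by omega)).swap
  na y x z m hm := by rw [← R_swap]; exact (h.nb x y z m (by omega))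
  nb y x z m hm := by rw [← R_swap]; exact (h.na x y z m (by omega))
  nc y x z m hm := by rw [← R_swap]; exact (h.nc x y z m (by omega))

theorem shift (h : Lat (n+1) X a b c) : Lat n (X ⊟ a 0) (fun i => a (i+1)) b c where
  tri x y z m hm := by rw [R_shift]; exact h.tri (x+1) y z m (by omega)
  na x y z m hm := by rw [R_shift]; exact h.na (x+1) y z m (by omega)
  nb x y z m hm := by rw [R_shift]; exact h.nb (x+1) y z m (by omega)
  nc x y z m hm := by rw [R_shift]; exact h.nc (x+1) y z m (by omega)

theorem shiftb (h : Lat (n+1) X a b c) : Lat n (X ⊟ b 0) a (fun i => b (i+1)) c := h.swap.shift.swap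
theorem shiftc (h : Lat (n+1) X a b c) : Lat n (X ⊟ c 0) a b (fun i => c (i+1)) := h.rot.shiftb.rot.rot

theorem shifts (h : Lat n X a b c) (k : ℕ) (hk : k ≤ n) : Lat (n - k) (R X a b c k 0 0) (fun i => a (i+k)) b c := by
  induction k with
  | zero => rw [R_0]; exact h
  | succ k ih =>
    have := ih (by omega)
    rw [show n - k = (n - (k+1)) + 1 by omega] at this
    have := this.shift
    rw [R_a]
    simpa [add_assoc, add_comm, add_left_comm] using this

theorem line (h : Lat n X a b c) {x : ℕ} (hx : x < n) : IsLine (a x) :=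
  (h.tri x 0 0 (n - x - 1) (by omega)).mp.1

theorem gc (h : Lat n X a b c) (hn : 0 < n) : GC n X := by
  have := (h.tri 0 0 0 (n-1) (by omega)).gc
  rw [R_0, show n - 1 + 1 = n by omega] at this
  exact this

/-- nodes -/
theorem node (h : Lat n X a b c) {x y z : ℕ} (hs : x + y + z = n) (hn : 0 < n) :
    ∃ P, R X a b c x y z = {P} ∧ (0 < y ∨ 0 < z → P ∈ a x) ∧ (0 < x ∨ 0 < z → P ∈ b y) ∧
      (0 < x ∨ 0 < y → P ∈ c z) := by
  have sa : 0 < x → ∃ P, R X a b c x y z = {P} ∧ P ∈ b y ∧ P ∈ c z := by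
    intro hx
    obtain ⟨x, rfl⟩ : ∃ x', x = x' + 1 := ⟨x - 1, by omega⟩
    have t := h.tri x y z 0 (by omega)
    rw [R_a]
    obtain ⟨P, hP⟩ := gc_zero (gc_del t.gc t.mp)
    have h1 := mx_del t.gc t.mp t.mq t.pq
    have h2 := mx_del t.gc t.mp t.mr t.pr
    rw [hP, mx_zero] at h1 h2
    exact ⟨P, hP, h1.2, h2.2⟩
  have sb : 0 < y → ∃ P, R X a b c x y z = {P} ∧ P ∈ a x ∧ P ∈ c z := by
    intro hx
    obtain ⟨y, rfl⟩ : ∃ x', y = x' + 1 := ⟨y - 1, by omega⟩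
    have t := h.tri x y z 0 (by omega)
    rw [R_b]
    obtain ⟨P, hP⟩ := gc_zero (gc_del t.gc t.mq)
    have h1 := mx_del t.gc t.mq t.mp t.pq.symm
    have h2 := mx_del t.gc t.mq t.mr t.qr
    rw [hP, mx_zero] at h1 h2
    exact ⟨P, hP, h1.2, h2.2⟩
  have sc : 0 < z → ∃ P, R X a b c x y z = {P} ∧ P ∈ a x ∧ P ∈ b y := by
    intro hx
    obtain ⟨z, rfl⟩ : ∃ x', z = x' + 1 := ⟨z - 1, by omega⟩
    have t := h.tri x y z 0 (by omega)
    rw [R_c]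
    obtain ⟨P, hP⟩ := gc_zero (gc_del t.gc t.mr)
    have h1 := mx_del t.gc t.mr t.mp t.pr.symm
    have h2 := mx_del t.gc t.mr t.mq t.qr.symm
    rw [hP, mx_zero] at h1 h2
    exact ⟨P, hP, h1.2, h2.2⟩
  have : ∃ P, R X a b c x y z = {P} := by
    by_cases hx : 0 < x
    · obtain ⟨P, h, -⟩ := sa hx; exact ⟨P, h⟩
    by_cases hy : 0 < y
    · obtain ⟨P, h, -⟩ := sb hy; exact ⟨P, h⟩
    · obtain ⟨P, h, -⟩ := sc (by omega); exact ⟨P, h⟩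
  obtain ⟨P, hP⟩ := this
  refine ⟨P, hP, ?_, ?_, ?_⟩
  · rintro (h | h)
    · obtain ⟨Q, h1, h2, h3⟩ := sb h
      rw [hP, Finset.singleton_inj] at h1; subst h1; exact h2
    · obtain ⟨Q, h1, h2, h3⟩ := sc h
      rw [hP, Finset.singleton_inj] at h1; subst h1; exact h2
  · rintro (h | h)
    · obtain ⟨Q, h1, h2, h3⟩ := sa h
      rw [hP, Finset.singleton_inj] at h1; subst h1; exact h2
    · obtain ⟨Q, h1, h2, h3⟩ := sc h
      rw [hP, Finset.singleton_inj] at h1; subst h1; exact h3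
  · rintro (h | h)
    · obtain ⟨Q, h1, h2, h3⟩ := sa h
      rw [hP, Finset.singleton_inj] at h1; subst h1; exact h3
    · obtain ⟨Q, h1, h2, h3⟩ := sb h
      rw [hP, Finset.singleton_inj] at h1; subst h1; exact h3

theorem exnode (h : Lat n X a b c) {P : Pt} : ∀ m x y z, x + y + z + m = n → P ∈ R X a b c x y z →
    ∃ x' y' z', x ≤ x' ∧ x' + y' + z' = n ∧ P ∈ R X a b c x' y' z' := by
  intro m
  induction m with
  | zero => intro x y z hs hP; exact ⟨x, y, z, le_rfl, hs, hP⟩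
  | succ m ih =>
    intro x y z hs hP
    have t := h.tri x y z m (by omega)
    by_cases h1 : P ∈ a x
    · by_cases h2 : P ∈ b y
      · have h3 : P ∉ c z := fun h3 => mx_concur t.gc t.mp t.mq t.mr t.pq t.pr t.qr h1 h2 h3
        exact ih x y (z+1) (by omega) (by rw [R_c, mem_del]; exact ⟨hP, h3⟩)
      · exact ih x (y+1) z (by omega) (by rw [R_b, mem_del]; exact ⟨hP, h2⟩)
    · obtain ⟨x', y', z', q1, q2, q3⟩ := ih (x+1) y z (by omega) (by rw [R_a, mem_del]; exact ⟨hP, h1⟩)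
      exact ⟨x', y', z', by omega, q2, q3⟩

theorem used (h : Lat n X a b c) {P : Pt} {l : Set Pt} : ∀ m x y z T, x + y + z + m = n → P ∈ R X a b c x y z →
    Valid m (R X a b c x y z) P T → l ∈ T → ∃ j, j < n ∧ (l = a j ∨ l = b j ∨ l = c j) := by
  intro m
  induction m with
  | zero =>
    intro x y z T hs hP hT hl
    have := List.length_eq_zero_iff.1 hT.1
    subst this; simp at hl
  | succ m ih =>
    intro x y z T hs hP hT hl
    have t := h.tri x y z m (by omega)
    have go : ∀ L, L ∈ T → l = L ∨ l ∈ T.erase L := by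
      intro L hL
      by_cases h : l = L
      · exact Or.inl h
      · exact Or.inr ((List.mem_erase_of_ne h).2 hl)
    by_cases h1 : P ∈ a x
    · by_cases h2 : P ∈ b y
      · have h3 : P ∉ c z := fun h3 => mx_concur t.gc t.mp t.mq t.mr t.pq t.pr t.qr h1 h2 h3
        have hL := mx_mem_valid hT t.mr h3
        rcases go _ hL with h | h
        · exact ⟨z, by omega, by tauto⟩
        · exact ih x y (z+1) _ (by omega) (by rw [R_c, mem_del]; exact ⟨hP, h3⟩) (by rw [R_c]; exact valid_del hT hL) h
      · have hL := mx_mem_valid hT t.mq h2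
        rcases go _ hL with h | h
        · exact ⟨y, by omega, by tauto⟩
        · exact ih x (y+1) z _ (by omega) (by rw [R_b, mem_del]; exact ⟨hP, h2⟩) (by rw [R_b]; exact valid_del hT hL) h
    · have hL := mx_mem_valid hT t.mp h1
      rcases go _ hL with h | h
      · exact ⟨x, by omega, by tauto⟩
      · exact ih (x+1) y z _ (by omega) (by rw [R_a, mem_del]; exact ⟨hP, h1⟩) (by rw [R_a]; exact valid_del hT hL) h

theorem used' (h : Lat n X a b c) {P : Pt} {l : Set Pt} (hu : Use n X l P) :
    ∃ j, j < n ∧ (l = a j ∨ l = b j ∨ l = c j) := by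
  obtain ⟨hP, T, hT, hl⟩ := hu
  exact h.used n 0 0 0 T (by omega) (by rw [R_0]; exact hP) (by rw [R_0]; exact hT) hl

end Lat
end GCW

namespace GCW
open Classical

theorem exists_off {T : List (Set Pt)} (hT : ∀ L ∈ T, IsLine L) : ∃ Q : Pt, ∀ L ∈ T, Q ∉ L := by
  have hne : pols T ≠ 0 := by
    induction T with
    | nil => simp
    | cons L T ih =>
      rw [pols_cons]
      refine mul_ne_zero ?_ (ih fun M hM => hT M (by simp [hM]))
      intro h0
      have := pol_deg (hT L (by simp))
      rw [h0] at this; simp at this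
  by_contra! hcon
  apply hne
  apply MvPolynomial.funext
  intro v
  obtain ⟨L, hL, hQ⟩ := hcon (v 0, v 1)
  have h0 := (pols_eval hT (v 0, v 1)).2 ⟨L, hL, hQ⟩
  rw [map_zero, ← h0, evalPt]
  congr 1
  congr 1
  funext i
  fin_cases i <;> simp

theorem dual_line {L : Set Pt} {Q : Pt} (hL : IsLine L) (hQ : Q ∉ L) :
    ∃ u : Pt, ∀ P : Pt, P ∈ L ↔ (P.1 - Q.1) * u.1 + (P.2 - Q.2) * u.2 + (-1) = 0 := by
  obtain ⟨a, b, c, hab, rfl⟩ := hL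
  simp only [Set.mem_ofPred_eq] at hQ ⊢
  refine ⟨(-a / (a * Q.1 + b * Q.2 + c), -b / (a * Q.1 + b * Q.2 + c)), fun P => ?_⟩
  have e : (P.1 - Q.1) * (-a / (a * Q.1 + b * Q.2 + c)) + (P.2 - Q.2) * (-b / (a * Q.1 + b * Q.2 + c)) + (-1)
      = -(a * P.1 + b * P.2 + c) / (a * Q.1 + b * Q.2 + c) := by
    have hc : c = (a * Q.1 + b * Q.2 + c) - a * Q.1 - b * Q.2 := by ring
    have hQ' : a * Q.1 + b * Q.2 + c ≠ 0 := hQ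
    generalize a * Q.1 + b * Q.2 + c = e at hc hQ'
    rw [eq_div_iff hQ', add_mul, add_mul, mul_assoc, mul_assoc, div_mul_cancel₀ _ hQ', div_mul_cancel₀ _ hQ', hc]
    ring
  rw [e]
  simp [div_eq_zero_iff, hQ]
  constructor
  · intro h; linarith
  · intro h; linarith

namespace Lat
variable {n : ℕ} {X : Finset Pt} {a b c : ℕ → Set Pt}

def EP (n : ℕ) : Prop := ∀ X a b c, Lat n X a b c → ∀ j, 0 < j → j < n → ∀ P ∈ X, P ∈ a 0 → P ∉ a j

theorem inc (hE : ∀ m < n, EP m) (h : Lat n X a b c) {x y z x' : ℕ} {P : Pt} (hs : x + y + z = n)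
    (hP : P ∈ R X a b c x y z) (hx' : x' < n) (hne : x' ≠ x) (hex : ¬ (x = 0 ∧ x' + 1 = n)) : P ∉ a x' := by
  have hR := mem_R.1 hP
  rcases lt_or_gt_of_ne hne with hlt | hgt
  · exact hR.2.1 _ hlt
  have hyz : 0 < y ∨ 0 < z := by omega
  have hPa : P ∈ a x := by
    obtain ⟨Q, hQ, hQa, -⟩ := h.node hs (by omega)
    rw [hQ, Finset.mem_singleton] at hP
    rw [hP]; exact hQa hyz
  by_cases hx : x = 0
  · subst hx
    obtain ⟨n, rfl⟩ : ∃ k, n = k + 1 := ⟨n - 1, by omega⟩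
    rcases hyz with hy | hz
    · exact hE n (by omega) _ _ _ _ h.shiftb x' (by omega) (by omega) P (mem_del.2 ⟨hR.1, hR.2.2.1 0 hy⟩) hPa
    · exact hE n (by omega) _ _ _ _ h.shiftc x' (by omega) (by omega) P (mem_del.2 ⟨hR.1, hR.2.2.2 0 hz⟩) hPa
  · have := hE (n - x) (by omega) _ _ _ _ (h.shifts x (by omega)) (x' - x) (by omega) (by omega) P
      (mem_R.2 ⟨hR.1, hR.2.1, by simp, by simp⟩) (by simpa using hPa)
    simpa [Nat.sub_add_cancel hgt.le] using this

theorem off_b0 (h : Lat n X a b c) {j : ℕ} (hj : 0 < j) (hjn : j < n) {P : Pt} (h0 : P ∈ a 0)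
    (h1 : P ∈ a j) : P ∉ b 0 := by
  intro hb
  have t := h.tri j 0 0 (n - 1 - j) (by omega)
  obtain ⟨Q, hQ, hQa, hQb⟩ := mx_meet t.gc t.mp t.mq t.pq
  have : Q ≠ P := by rintro rfl; exact (mem_R.1 hQ).2.1 0 hj h0
  exact t.pq (line_unique t.mp.1 t.mq.1 this hQa h1 hQb hb)

theorem off_b1 (h : Lat n X a b c) (hn : 3 ≤ n) {P : Pt} (h0 : P ∈ a 0)
    (h1 : P ∈ a (n - 1)) : P ∉ b 1 := by
  intro hb
  obtain ⟨Q, hQ, hQa, hQb, -⟩ := h.node (x := n - 1) (y := 1) (z := 0) (by omega) (by omega)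
  have hQR : Q ∈ R X a b c (n - 1) 1 0 := by rw [hQ]; simp
  have : Q ≠ P := by rintro rfl; exact (mem_R.1 hQR).2.1 0 (by omega) h0
  have e := line_unique (h.line (by omega)) (h.rot.line (by omega)) this (hQa (by omega)) h1 (hQb (by omega)) hb
  have t := h.tri (n - 2) 1 0 0 (by omega)
  obtain ⟨S, hS, hSa, hSb⟩ := mx_meet t.gc t.mp t.mq t.pq
  have nw := h.na (n - 2) 0 0 0 (by omega)
  have hS' := mem_R.1 hS
  refine nw.2 S (mem_R.2 ⟨hS'.1, hS'.2.1, by simp, by simp⟩) hSa ?_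
  rw [show n - 2 + 1 = n - 1 by omega, e]; exact hSb

set_option maxHeartbeats 1000000 in
theorem dual_main (hE : ∀ m < n, EP m) (h : Lat n X a b c) {j k : ℕ} (hj : 2 ≤ j) (hk : 2 ≤ k) (hjk : j + k = n)
    {P : Pt} (hP : P ∈ R X a b c 0 j k) (hPa : P ∈ a (n - 1)) : False := by
  obtain ⟨Q, hQ⟩ := exists_off (T := (List.range n).map a ++ (List.range n).map b ++ (List.range n).map c) (by
    intro L hL
    simp only [List.mem_append, List.mem_map, List.mem_range] at hL
    rcases hL with (⟨i, hi, rfl⟩ | ⟨i, hi, rfl⟩) | ⟨i, hi, rfl⟩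
    · exact h.line hi
    · exact h.rot.line hi
    · exact h.rot.rot.line hi)
  have hQa : ∀ i < n, Q ∉ a i := fun i hi => hQ _ (by simp; exact Or.inl ⟨i, hi, rfl⟩)
  have hQb : ∀ i < n, Q ∉ b i := fun i hi => hQ _ (by simp; exact Or.inr (Or.inl ⟨i, hi, rfl⟩))
  have hQc : ∀ i < n, Q ∉ c i := fun i hi => hQ _ (by simp; exact Or.inr (Or.inr ⟨i, hi, rfl⟩))
  have hd : ∀ L : Set Pt, ∃ u : Pt, IsLine L → Q ∉ L → ∀ P : Pt, P ∈ L ↔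
      (P.1 - Q.1) * u.1 + (P.2 - Q.2) * u.2 + (-1) = 0 := by
    intro L
    by_cases hL : IsLine L ∧ Q ∉ L
    · obtain ⟨u, hu⟩ := dual_line hL.1 hL.2
      exact ⟨u, fun _ _ => hu⟩
    · exact ⟨0, fun h1 h2 => absurd ⟨h1, h2⟩ hL⟩
  choose d hd using hd
  have hN : ∀ j k, ∃ P : Pt, j < n → k < n → j + k ≤ n → P ∈ R X a b c (n - j - k) j k ∧
      (1 ≤ j + k → P ∈ a (n - (j + k))) ∧ P ∈ b j ∧ P ∈ c k := by
    intro j k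
    by_cases hh : j < n ∧ k < n ∧ j + k ≤ n
    · obtain ⟨P, h1, h2, h3, h4⟩ := h.node (x := n - j - k) (y := j) (z := k) (by omega) (by omega)
      refine ⟨P, fun _ _ _ => ⟨by rw [h1]; simp, fun h5 => ?_, h3 (by omega), h4 (by omega)⟩⟩
      rw [← Nat.sub_sub]; exact h2 (by omega)
    · exact ⟨0, fun h1 h2 h3 => absurd ⟨h1, h2, h3⟩ hh⟩
  choose N hN using hN
  have ev : ∀ j k L, IsLine L → Q ∉ L →
      (evalPt (lineP ((N j k).1 - Q.1) ((N j k).2 - Q.2) (-1)) (d L) = 0 ↔ N j k ∈ L) := by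
    intro j k L h1 h2
    rw [evalPt_lineP, hd L h1 h2]
  have eva : ∀ j k i, 1 ≤ i → i ≤ n →
      (evalPt (lineP ((N j k).1 - Q.1) ((N j k).2 - Q.2) (-1)) (d (a (n - i))) = 0 ↔ N j k ∈ a (n - i)) :=
    fun j k i h1 h2 => ev j k _ (h.line (by omega)) (hQa _ (by omega))
  have evb : ∀ j k i, i < n →
      (evalPt (lineP ((N j k).1 - Q.1) ((N j k).2 - Q.2) (-1)) (d (b i)) = 0 ↔ N j k ∈ b i) :=
    fun j k i h1 => ev j k _ (h.rot.line (by omega)) (hQb _ (by omega))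
  have evc : ∀ j k i, i < n →
      (evalPt (lineP ((N j k).1 - Q.1) ((N j k).2 - Q.2) (-1)) (d (c i)) = 0 ↔ N j k ∈ c i) :=
    fun j k i h1 => ev j k _ (h.rot.rot.line (by omega)) (hQc _ (by omega))
  have D : Dual n (fun i => d (a (n - i))) (fun j => d (b j)) (fun k => d (c k))
      (fun j k => lineP ((N j k).1 - Q.1) ((N j k).2 - Q.2) (-1)) := by
    constructor
    · intro j k hj hk hjk
      apply lineP_deg
      by_contra! hcon
      obtain ⟨-, -, h3, -⟩ := hN j k hj hk hjk
      apply hQb j hj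
      have : Q = N j k := Prod.ext (by linarith [hcon.1]) (by linarith [hcon.2])
      rw [this]; exact h3
    · intro j k i hj hk hjk hi e
      subst e
      exact (eva _ _ _ hi hjk).2 ((hN j k hj hk hjk).2.1 hi)
    · intro j k hj hk hjk
      exact (evb _ _ _ hj).2 (hN j k hj hk hjk).2.2.1
    · intro j k hj hk hjk
      exact (evc _ _ _ hk).2 (hN j k hj hk hjk).2.2.2
    · intro j k i hj hk hjk hi hin hne hex
      rw [Ne, eva _ _ _ hi hin]
      exact inc hE h (by omega) (hN j k hj hk hjk).1 (by omega) (by omega) (by omega)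
    · intro j k j' hj hk hjk hj' hne hex
      rw [Ne, evb _ _ _ hj']
      exact inc hE h.rot (x := j) (y := k) (z := n - j - k) (by omega) (by rw [← R_rot]; exact (hN j k hj hk hjk).1)
        (by omega) (by omega) (by omega)
    · intro j k j' hj hk hjk hj' hne hex
      rw [Ne, evc _ _ _ hj']
      exact inc hE h.rot.rot (x := k) (y := n - j - k) (z := j) (by omega)
        (by rw [← R_rot, ← R_rot]; exact (hN j k hj hk hjk).1) (by omega) (by omega) (by omega)
  refine D.main hj hk hjk ?_
  refine (eva _ _ _ le_rfl (by omega)).2 ?_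
  obtain ⟨P', hP', -⟩ := h.node (x := 0) (y := j) (z := k) (by omega) (by omega)
  have h1 := (hN j k (by omega) (by omega) (by omega)).1
  rw [show n - j - k = 0 by omega] at h1
  rw [hP', Finset.mem_singleton] at h1 hP
  rw [h1, ← hP]; exact hPa

theorem ep : ∀ n, EP n := by
  intro n
  induction n using Nat.strong_induction_on with
  | _ n IH =>
  intro X a b c h j hj hjn P hP h0 h1
  by_cases hj1 : j = 1
  · subst hj1
    have := h.na 0 0 0 (n - 2) (by omega)
    exact this.2 P (by rw [R_0]; exact hP) h0 h1
  have hb0 := h.off_b0 hj hjn h0 h1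
  have hjn1 : j = n - 1 := by
    by_contra hne
    obtain ⟨n, rfl⟩ : ∃ k, n = k + 1 := ⟨n - 1, by omega⟩
    exact IH n (by omega) _ _ _ _ h.shiftb j hj (by omega) P (mem_del.2 ⟨hP, hb0⟩) h0 h1
  have hS : Lat n X a c b := h.swap.rot
  have hc0 := hS.off_b0 hj hjn h0 h1
  subst hjn1
  have hb1 := h.off_b1 (by omega) h0 h1
  have hc1 := hS.off_b1 (by omega) h0 h1
  obtain ⟨x', y', z', -, hs, hPR⟩ := h.exnode n 0 0 0 (by omega) (by rw [R_0]; exact hP)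
  have hx0 : x' = 0 := by
    by_contra hx
    exact (mem_R.1 hPR).2.1 0 (by omega) h0
  subst hx0
  obtain ⟨P', hP', -, hPb, hPc⟩ := h.node hs (by omega)
  have e : P = P' := by rw [hP', Finset.mem_singleton] at hPR; exact hPR
  subst e
  have hM := mem_R.1 hPR
  have hy : 2 ≤ y' := by
    by_contra hlt
    rcases (show y' = 0 ∨ y' = 1 by omega) with rfl | rfl
    · exact hb0 (hPb (by omega))
    · exact hb1 (hPb (by omega))
  have hz : 2 ≤ z' := by
    by_contra hlt
    rcases (show z' = 0 ∨ z' = 1 by omega) with rfl | rfl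
    · exact hc0 (hPc (by omega))
    · exact hc1 (hPc (by omega))
  exact dual_main IH h hy hz (by omega) hPR h1

end Lat
end GCW

namespace GCW
open Classical

/-- `a x` meets `d` in a node not on the earlier lines of the chain -/
def Act (X : Finset Pt) (d : Set Pt) (a : ℕ → Set Pt) (x : ℕ) : Prop :=
  ∃ P ∈ X, P ∈ d ∧ P ∈ a x ∧ ∀ i < x, P ∉ a i

structure Ext (m : ℕ) (X : Finset Pt) (d : Set Pt) (a b c : ℕ → Set Pt) (i j k : ℕ) : Prop where
  gc : GC (m+1) X
  md : Mx (m+1) X d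
  lat : Lat m (X ⊟ d) a b c
  aa : ∀ x < i, Act X d a x
  bb : ∀ x < j, Act X d b x
  cc : ∀ x < k, Act X d c x

theorem R_del {X : Finset Pt} {d : Set Pt} {a b c : ℕ → Set Pt} {x y z : ℕ} :
    R X a b c x y z ⊟ d = R (X ⊟ d) a b c x y z := by
  ext P; simp only [mem_R, mem_del]; tauto

theorem Lat.ne_ab {n X a b c} (h : Lat n X a b c) {x y : ℕ} (hs : x + 1 + y ≤ n) (hx : x + 1 < n) (hy : y < n) :
    a (x + 1) ≠ b y := by
  intro e
  have t := h.tri x y 0 (n - 1 - x - y) (by omega)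
  obtain ⟨S, hS, hSa, hSb⟩ := mx_meet t.gc t.mp t.mq t.pq
  have nw := h.na x 0 0 (n - 2 - x) (by omega)
  have hS' := mem_R.1 hS
  refine nw.2 S (mem_R.2 ⟨hS'.1, hS'.2.1, by simp, by simp⟩) hSa ?_
  rw [e]; exact hSb

namespace Ext
variable {m : ℕ} {X : Finset Pt} {d : Set Pt}

theorem rot {a b c i j k} (h : Ext m X d a b c i j k) : Ext m X d b c a j k i :=
  ⟨h.gc, h.md, h.lat.rot, h.bb, h.cc, h.aa⟩

theorem swap {a b c i j k} (h : Ext m X d a b c i j k) : Ext m X d b a c j i k :=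
  ⟨h.gc, h.md, h.lat.swap, h.bb, h.aa, h.cc⟩

theorem key : ∀ s, ∀ a b c i j k, Ext m X d a b c i j k → ∀ x y z t, x + y + z = s → s + t = m →
    x ≤ i → y ≤ j → z ≤ k → (GC (t+1) (R X a b c x y z) ∧ Mx (t+1) (R X a b c x y z) d ∧
      (x < i → ∃ P ∈ R X a b c x y z, P ∈ d ∧ P ∈ a x) ∧
      (0 < t → x < i → Mx (t+1) (R X a b c x y z) (a x))) := by
  intro s
  induction s using Nat.strong_induction_on with
  | _ s IH =>
  intro a b c i j k h x y z t hs ht hx hy hz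
  have step : ∀ a b c i j k, Ext m X d a b c i j k → ∀ x y z, x + 1 + y + z = s →
      x + 1 ≤ i → y ≤ j → z ≤ k → (GC (t+1) (R X a b c (x+1) y z) ∧ Mx (t+1) (R X a b c (x+1) y z) d) := by
    intro a b c i j k h x y z hs hx hy hz
    obtain ⟨g, md, -, ma⟩ := IH (x + y + z) (by omega) a b c i j k h x y z (t+1) rfl (by omega) (by omega) hy hz
    have ma := ma (by omega) (by omega)
    rw [R_a]
    have tr := h.lat.tri x y z t (by omega)
    have hne : d ≠ a x := by
      have := tr.mp
      rw [← R_del] at this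
      exact mx_ne_del this
    exact ⟨gc_del g ma, mx_del g ma md hne.symm⟩
  have base : GC (t+1) (R X a b c x y z) ∧ Mx (t+1) (R X a b c x y z) d := by
    rcases Nat.eq_zero_or_pos x with hx0 | hx0
    · rcases Nat.eq_zero_or_pos y with hy0 | hy0
      · rcases Nat.eq_zero_or_pos z with hz0 | hz0
        · subst hx0 hy0 hz0
          have : t = m := by omega
          subst this
          rw [R_0]; exact ⟨h.gc, h.md⟩
        · obtain ⟨z, rfl⟩ : ∃ w, z = w + 1 := ⟨z - 1, by omega⟩
          rw [R_rot, R_rot]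
          exact step c a b k i j h.rot.rot z x y (by omega) hz hx hy
      · obtain ⟨y, rfl⟩ : ∃ w, y = w + 1 := ⟨y - 1, by omega⟩
        rw [R_rot]
        exact step b c a j k i h.rot y z x (by omega) hy hz hx
    · obtain ⟨x, rfl⟩ : ∃ w, x = w + 1 := ⟨x - 1, by omega⟩
      exact step a b c i j k h x y z (by omega) hx hy hz
  -- points of `a x ∩ d` avoid the earlier lines of the other chains
  have avoid : ∀ a b c i j k, Ext m X d a b c i j k → ∀ x y, x + y < s → x < i → y < j →
      ∀ P, P ∈ d → P ∈ a x → P ∉ b y := by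
    intro a b c i j k h x y hxy hxi hyj P hPd hPa hPb
    obtain ⟨g, md, -, ma⟩ := IH (x + y + 0) (by omega) a b c i j k h x y 0 (m - x - y) rfl (by omega)
      (by omega) (by omega) (by omega)
    obtain ⟨-, -, -, mb⟩ := IH (y + 0 + x) (by omega) b c a j k i h.rot y 0 x (m - x - y) rfl (by omega)
      (by omega) (by omega) (by omega)
    have ma := ma (by omega) hxi
    have mb := mb (by omega) hyj
    rw [← R_rot] at mb
    have tr := h.lat.tri x y 0 (m - x - y - 1) (by omega)
    rw [← R_del] at tr
    exact mx_concur g md ma mb (mx_ne_del tr.mp) (mx_ne_del tr.mq) tr.pq hPd hPa hPb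
  have pt : x < i → ∃ P ∈ R X a b c x y z, P ∈ d ∧ P ∈ a x := by
    intro hxi
    obtain ⟨P, hP, hPd, hPa, hPi⟩ := h.aa x hxi
    refine ⟨P, mem_R.2 ⟨hP, hPi, fun y' hy' => ?_, fun z' hz' => ?_⟩, hPd, hPa⟩
    · exact avoid a b c i j k h x y' (by omega) hxi (by omega) P hPd hPa
    · exact avoid a c b i k j h.swap.rot x z' (by omega) hxi (by omega) P hPd hPa
  refine ⟨base.1, base.2, pt, fun ht0 hxi => ?_⟩
  obtain ⟨P, hP, hPd, hPa⟩ := pt hxi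
  obtain ⟨t, rfl⟩ : ∃ w, t = w + 1 := ⟨t - 1, by omega⟩
  have tr := h.lat.tri x y z t (by omega)
  rw [← R_del] at tr
  exact mx_of_del h.md.1 tr.mp hP hPd hPa

theorem disj {a b c i j k} (h : Ext m X d a b c i j k) {x y : ℕ} (hxi : x < i) (hyj : y < j) (hxy : x + y < m) {P : Pt}
    (hPd : P ∈ d) (hPa : P ∈ a x) (hPb : P ∈ b y) : False := by
  obtain ⟨g, md, -, ma⟩ := key (x + y + 0) a b c i j k h x y 0 (m - x - y) rfl (by omega)
    (by omega) (by omega) (by omega)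
  obtain ⟨-, -, -, mb⟩ := key (y + 0 + x) b c a j k i h.rot y 0 x (m - x - y) rfl (by omega)
    (by omega) (by omega) (by omega)
  have ma := ma (by omega) hxi
  have mb := mb (by omega) hyj
  rw [← R_rot] at mb
  have tr := h.lat.tri x y 0 (m - x - y - 1) (by omega)
  rw [← R_del] at tr
  exact mx_concur g md ma mb (mx_ne_del tr.mp) (mx_ne_del tr.mq) tr.pq hPd hPa hPb

theorem not_mx {a b c i j k} (h : Ext m X d a b c i j k) {x y z t : ℕ} (hs : x + y + z + t = m) (ht : 0 < t) (hx : x ≤ i)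
    (hy : y ≤ j) (hz : z ≤ k) (hA : ¬ Act X d a x) : ¬ Mx (t+1) (R X a b c x y z) (a x) := by
  intro hM
  obtain ⟨g, md, -, -⟩ := key (x + y + z) a b c i j k h x y z t rfl (by omega) hx hy hz
  obtain ⟨t, rfl⟩ : ∃ w, t = w + 1 := ⟨t - 1, by omega⟩
  have tr := h.lat.tri x y z t (by omega)
  rw [← R_del] at tr
  obtain ⟨P, hP, h1, h2⟩ := mx_meet g md hM (mx_ne_del tr.mp)
  have hP := mem_R.1 hP
  exact hA ⟨P, hP.1, h1, h2, hP.2.1⟩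

/-- step (1) -/
theorem ge {N a b c i j k} (hN : Good N) (hm : m + 1 ≤ N) (h : Ext m X d a b c i j k) (hi : i = m ∨ ¬ Act X d a i)
    (hj : j = m ∨ ¬ Act X d b j) : m ≤ i + j := by
  by_contra hlt
  have hi : ¬ Act X d a i := by rcases hi with hi | hi; omega; exact hi
  have hj : ¬ Act X d b j := by rcases hj with hi | hi; omega; exact hi
  obtain ⟨t, ht⟩ : ∃ t, i + j + 0 + (t + 1) = m := ⟨m - i - j - 1, by omega⟩
  obtain ⟨g, md, -, -⟩ := key (i + j + 0) a b c i j k h i j 0 (t+1) rfl (by omega) le_rfl le_rfl (by omega)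
  have n1 := h.not_mx ht (by omega) le_rfl le_rfl (by omega) hi
  have n2 := h.swap.not_mx (x := j) (y := i) (z := 0) (t := t + 1) (by omega) (by omega) le_rfl le_rfl (by omega) hj
  rw [← R_swap] at n2
  have tr := h.lat.tri i j 0 t (by omega)
  rw [← R_del] at tr
  have all : ∀ l, Mx (t+1+1) (R X a b c i j 0) l → l = d ∨ l = c 0 := by
    intro l hl
    by_cases hd : l = d
    · exact Or.inl hd
    right
    rcases tr.only l (mx_del g md hl (Ne.symm hd)) with e | e | e
    · rw [e] at hl; exact absurd hl n1
    · rw [e] at hl; exact absurd hl n2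
    · exact e
  obtain ⟨p, q, r, hpq, hpr, hqr, hp, hq, hr⟩ := hN.1 (t+1+1) (by omega) _ g
  rcases all p hp with e1 | e1 <;> rcases all q hq with e2 | e2 <;> rcases all r hr with e3 | e3 <;>
    first
    | exact hpq (e1.trans e2.symm)
    | exact hpr (e1.trans e3.symm)
    | exact hqr (e2.trans e3.symm)

/-- step (2) -/
theorem le {a b c i j k} (h : Ext m X d a b c i j k) (hi : i ≤ m) (hj : j ≤ m) (hk : 1 ≤ k) : i + j ≤ m + 1 := by
  by_contra hlt
  obtain ⟨x, rfl⟩ : ∃ w, i = w + 2 := ⟨i - 2, by omega⟩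
  obtain ⟨y, hy⟩ : ∃ y, x + 1 + y = m := ⟨m - x - 1, by omega⟩
  obtain ⟨g, md, pa, -⟩ := key (x + 1 + y + 0) a b c _ j k h (x+1) y 0 0 rfl (by omega) (by omega) (by omega) (by omega)
  obtain ⟨-, -, pb, -⟩ := key (y + 0 + (x+1)) b c a j k _ h.rot y 0 (x+1) 0 rfl (by omega) (by omega) (by omega) (by omega)
  obtain ⟨-, -, pc, -⟩ := key (0 + (x+1) + y) c a b k _ j h.rot.rot 0 (x+1) y 0 rfl (by omega) (by omega) (by omega) (by omega)
  rw [← R_rot] at pb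
  rw [← R_rot, ← R_rot] at pc
  obtain ⟨Q, hQ, qa, qb, qc⟩ := h.lat.node (x := x + 1) (y := y) (z := 0) (by omega) (by omega)
  have qa := qa (by omega)
  have qb := qb (by omega)
  have qc := qc (by omega)
  have hQd : Q ∈ R X a b c (x+1) y 0 ∧ Q ∉ d := by
    rw [← mem_del, R_del, hQ]; simp
  have mk : ∀ l, IsLine l → Q ∈ l → (∃ P ∈ R X a b c (x+1) y 0, P ∈ d ∧ P ∈ l) → Mx 1 (R X a b c (x+1) y 0) l := by
    rintro l hl hQl ⟨P, hP, hPd, hPl⟩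
    refine ⟨hl, le_antisymm (card_on_le g hl) ?_⟩
    have hne : P ≠ Q := by rintro rfl; exact hQd.2 hPd
    rw [show 1 + 1 = 2 from rfl, ← Finset.card_pair hne]
    apply Finset.card_le_card
    intro S hS
    simp only [Finset.mem_insert, Finset.mem_singleton] at hS
    rcases hS with rfl | rfl
    · exact mem_on.2 ⟨hP, hPl⟩
    · exact mem_on.2 ⟨hQd.1, hQl⟩
  have ma := mk (a (x+1)) (h.lat.line (by omega)) qa (pa (by omega))
  have mb := mk (b y) (h.lat.rot.line (by omega)) qb (pb (by omega))
  have mc := mk (c 0) (h.lat.rot.rot.line (by omega)) qc (pc (by omega))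
  have ne1 : a (x+1) ≠ b y := h.lat.ne_ab (by omega) (by omega) (by omega)
  have ne2 : a (x+1) ≠ c 0 := h.lat.swap.rot.ne_ab (by omega) (by omega) (by omega)
  have ne3 : b y ≠ c 0 := by
    have := h.lat.tri 0 y 0 (m - 1 - y) (by omega)
    exact this.qr
  refine hQd.2 ?_
  rw [← gc_one_le g ma mb mc md ne1 ne2 ne3 (by rintro e; exact hQd.2 (e ▸ qa)) (by rintro e; exact hQd.2 (e ▸ qb))]
  exact qc

/-- step (3) -/
theorem sum_le {a b c i j k} (h : Ext m X d a b c i j k) (hij : i + j ≤ m + 1) (hjk : j + k ≤ m + 1)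
    (hik : i + k ≤ m + 1) : i + j + k ≤ m + 2 := by
  have ha : ∀ x : Fin i, ∃ P ∈ X, P ∈ d ∧ P ∈ a x ∧ ∀ i < x.1, P ∉ a i := fun x => h.aa x x.2
  have hb : ∀ x : Fin j, ∃ P ∈ X, P ∈ d ∧ P ∈ b x ∧ ∀ i < x.1, P ∉ b i := fun x => h.bb x x.2
  have hc : ∀ x : Fin k, ∃ P ∈ X, P ∈ d ∧ P ∈ c x ∧ ∀ i < x.1, P ∉ c i := fun x => h.cc x x.2
  choose A A1 A2 A3 A4 using ha
  choose B B1 B2 B3 B4 using hb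
  choose C C1 C2 C3 C4 using hc
  have inj : ∀ {l : ℕ} (e : ℕ → Set Pt) (F : Fin l → Pt), (∀ x : Fin l, F x ∈ e x) → (∀ x : Fin l, ∀ i < x.1, F x ∉ e i) →
      Function.Injective F := by
    intro l e F h1 h2 x y hxy
    rcases lt_trichotomy x.1 y.1 with hlt | heq | hgt
    · exact absurd (hxy ▸ h1 x) (h2 y _ hlt)
    · exact Fin.ext heq
    · exact absurd (hxy ▸ h1 y) (h2 x _ hgt)
  have iA := inj a A A3 A4
  have iB := inj b B B3 B4
  have iC := inj c C C3 C4
  let f : (Fin i ⊕ Fin j) ⊕ Fin k → Pt := Sum.elim (Sum.elim A B) C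
  have hf : Function.Injective f := by
    refine Function.Injective.sumElim (Function.Injective.sumElim iA iB ?_) iC ?_
    · intro x y e
      exact h.disj x.2 y.2 (by omega) (A2 x) (A3 x) (e ▸ B3 y)
    · rintro (x | x) y e
      · exact h.swap.rot.disj x.2 y.2 (by omega) (A2 x) (A3 x) (show A x ∈ c y from (show A x = C y from e) ▸ C3 y)
      · exact h.rot.disj x.2 y.2 (by omega) (B2 x) (B3 x) (show B x ∈ c y from (show B x = C y from e) ▸ C3 y)
  have : (Finset.univ.image f).card ≤ (on X d).card := by
    apply Finset.card_le_card
    intro P hP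
    obtain ⟨s, -, rfl⟩ := Finset.mem_image.1 hP
    rcases s with (x | x) | x
    · exact mem_on.2 ⟨A1 x, A2 x⟩
    · exact mem_on.2 ⟨B1 x, B2 x⟩
    · exact mem_on.2 ⟨C1 x, C2 x⟩
  rw [Finset.card_image_of_injective _ hf, h.md.2] at this
  simpa using this

end Ext

theorem ex_act (X : Finset Pt) (d : Set Pt) (a : ℕ → Set Pt) (m : ℕ) (hm : 1 ≤ m) (h0 : Act X d a 0) :
    ∃ i, 1 ≤ i ∧ i ≤ m ∧ (∀ x < i, Act X d a x) ∧ (i = m ∨ ¬ Act X d a i) := by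
  have hex : ∃ i, i = m ∨ ¬ Act X d a i := ⟨m, Or.inl rfl⟩
  refine ⟨Nat.find hex, ?_, Nat.find_min' hex (Or.inl rfl), fun x hx => ?_, Nat.find_spec hex⟩
  · rw [Nat.one_le_iff_ne_zero]
    intro e
    rcases (Nat.find_eq_zero hex).1 e with h | h
    · omega
    · exact h h0
  · have := Nat.find_min hex hx
    tauto

theorem le5 {N m X d a b c} (hN : Good N) (hm : m + 1 ≤ N) (hm1 : 1 ≤ m) (hX : GC (m+1) X) (hd : Mx (m+1) X d)
    (h : Lat m (X ⊟ d) a b c) (ha : Mx (m+1) X (a 0)) (hb : Mx (m+1) X (b 0)) (hc : Mx (m+1) X (c 0)) :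
    m ≤ 4 ∧ (m = 4 → ¬ Mx 3 (R X a b c 2 0 0) (a 2)) := by
  have tr := h.tri 0 0 0 (m - 1) (by omega)
  rw [R_0] at tr
  have act0 : ∀ e : ℕ → Set Pt, d ≠ e 0 → Mx (m+1) X (e 0) → Act X d e 0 := by
    intro e hne he
    obtain ⟨P, hP, h1, h2⟩ := mx_meet hX hd he hne
    exact ⟨P, hP, h1, h2, by simp⟩
  obtain ⟨i, i1, i2, i3, i4⟩ := ex_act X d a m hm1 (act0 a (mx_ne_del tr.mp) ha)
  obtain ⟨j, j1, j2, j3, j4⟩ := ex_act X d b m hm1 (act0 b (mx_ne_del tr.mq) hb)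
  obtain ⟨k, k1, k2, k3, k4⟩ := ex_act X d c m hm1 (act0 c (mx_ne_del tr.mr) hc)
  have E : Ext m X d a b c i j k := ⟨hX, hd, h, i3, j3, k3⟩
  have g1 := E.ge hN hm i4 j4
  have g2 := E.rot.ge hN hm j4 k4
  have g3 := E.rot.rot.ge hN hm k4 i4
  have l1 := E.le i2 j2 k1
  have l2 := E.rot.le j2 k2 i1
  have l3 := E.rot.rot.le k2 i2 j1
  have s := E.sum_le l1 l2 (by omega)
  refine ⟨by omega, fun h4 => ?_⟩
  have hi : i = 2 := by omega
  subst h4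
  refine E.not_mx (x := 2) (y := 0) (z := 0) (t := 2) (by omega) (by omega) (by omega) (by omega) (by omega) ?_
  rw [hi] at i4
  rcases i4 with h | h
  · omega
  · exact h

end GCW

namespace GCW
open Classical

def Dich (n : ℕ) (X : Finset Pt) (l : Set Pt) : Prop :=
  Mx n X l ∨ (∃ t, Mx n X t ∧ ∀ P ∈ X, P ∈ t → P ∉ l) ∨
    ∃ t t' D, t ≠ t' ∧ Mx n X t ∧ Mx n X t' ∧ D ∈ X ∧ D ∈ t ∧ D ∈ t' ∧ D ∈ l

def DP (n : ℕ) : Prop := ∀ X l A, GC n X → Use n X l A → Dich n X l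

theorem dich_lat {n X a b c l A} (hn : 0 < n) (h : Lat n X a b c) (hu : Use n X l A) : Dich n X l := by
  have key : ∀ a b c : ℕ → Set Pt, Lat n X a b c → ∀ j < n, l = a j → Dich n X l := by
    intro a b c h j hj e
    have t := h.tri 0 0 0 (n - 1) (by omega)
    rw [R_0, show n - 1 + 1 = n by omega] at t
    rcases Nat.eq_zero_or_pos j with h0 | h0
    · subst h0; left; rw [e]; exact t.mp
    · right; left
      refine ⟨a 0, t.mp, fun P hP h1 => ?_⟩
      rw [e]; exact Lat.ep n X a b c h j h0 hj P hP h1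
  obtain ⟨j, hj, e | e | e⟩ := h.used' hu
  · exact key a b c h j hj e
  · exact key b c a h.rot j hj e
  · exact key c a b h.rot.rot j hj e

structure Ctx (m : ℕ) (X : Finset Pt) (l : Set Pt) (A : Pt) : Prop where
  gc : GC (m+2) X
  use : Use (m+2) X l A
  hl : ¬ Mx (m+2) X l
  h1 : ∀ t, Mx (m+2) X t → ∃ B ∈ X, B ∈ t ∧ B ∈ l
  h2 : ∀ t t', Mx (m+2) X t → Mx (m+2) X t' → t ≠ t' → ∀ D ∈ X, D ∈ t → D ∈ t' → D ∉ l

/-- the special new line of `u` -/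
def Nu (m : ℕ) (X : Finset Pt) (l : Set Pt) (A : Pt) (u v : Set Pt) : Prop :=
  New (m+1) X u v ∧ A ∉ v ∧ v ≠ l ∧ ∀ P ∈ X, P ∈ v → P ∈ l → ∃ t, Mx (m+2) X t ∧ t ≠ u ∧ A ∉ t ∧ P ∈ t

theorem nodes_le {n X k} (hk : Mx n X k) (s : List Pt) (hs : s.Nodup) (h : ∀ P ∈ s, P ∈ X ∧ P ∈ k) :
    s.length ≤ n + 1 := by
  rw [← hk.2, ← List.toFinset_card_of_nodup hs]
  apply Finset.card_le_card
  intro P hP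
  exact mem_on.2 (h P (List.mem_toFinset.1 hP))

namespace Ctx
variable {N m : ℕ} {X : Finset Pt} {l : Set Pt} {A : Pt}

theorem nu (h : Ctx m X l A) (hN : Good N) (hm : m + 2 ≤ N) (IH : DP (m+1)) {u : Set Pt} (hu : Mx (m+2) X u)
    (hA : A ∉ u) : ∃ v, Nu m X l A u v := by
  have hlu : l ≠ u := by rintro rfl; exact h.hl hu
  have hU := (use_del h.gc hu hA hlu).1 h.use
  have nl : ¬ New (m+1) X u l := by
    intro hn
    obtain ⟨B, hB, b1, b2⟩ := h.h1 u hu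
    exact hn.2 B hB b1 b2
  have mixed : ∀ t v D, New (m+1) X u v → Mx (m+2) X t → Mx (m+1) (X ⊟ u) t → v ≠ t → D ∈ X ⊟ u → D ∈ v → D ∈ t → D ∈ l →
      ∃ v, Nu m X l A u v := by
    intro t v D hv ht ht' hne hD hDv hDt hDl
    have hvl : v ≠ l := by rintro rfl; exact nl hv
    have hlt : l ≠ t := by rintro rfl; exact h.hl ht
    refine ⟨v, hv, use_pair hv.1 ht' hne hlt hD hDv hDt hDl hU, hvl, fun P hP hPv hPl => ?_⟩
    have e : P = D := by
      by_contra hPD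
      exact hvl (line_unique hv.1.1 (use_isLine h.use).1 hPD hPv hDv hPl hDl)
    subst e
    exact ⟨t, ht, (mx_ne_del ht').symm, use_pair ht' hv.1 hne.symm hvl.symm hD hDt hDv hDl hU, hDt⟩
  rcases IH _ _ _ (gc_del h.gc hu) hU with h3 | ⟨t, ht, hd⟩ | ⟨t, t', D, hne, ht, ht', hD, d1, d2, d3⟩
  · rcases mx_del_cases hu.1 h3 with h4 | h4
    · exact absurd h4 h.hl
    · exact absurd h4 nl
  · rcases mx_del_cases hu.1 ht with h4 | h4
    · obtain ⟨B, hB, b1, b2⟩ := h.h1 t h4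
      by_cases hBu : B ∈ u
      · exact absurd b2 (h.h2 u t hu h4 (mx_ne_del ht) B hB hBu b1)
      · exact absurd b2 (hd B (mem_del.2 ⟨hB, hBu⟩) b1)
    · refine ⟨t, h4, use_disj ht hd hU, by rintro rfl; exact nl h4, fun P hP hPv hPl => ?_⟩
      exact absurd hPl (hd P (mem_del.2 ⟨hP, fun hPu => h4.2 P hP hPu hPv⟩) hPv)
  · have hDX := (mem_del.1 hD).1
    rcases mx_del_cases hu.1 ht with h4 | h4 <;> rcases mx_del_cases hu.1 ht' with h5 | h5
    · exact absurd d3 (h.h2 t t' h4 h5 hne D hDX d1 d2)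
    · exact mixed t t' D h5 h4 ht hne.symm hD d2 d1 d3
    · exact mixed t' t D h4 h5 ht' hne hD d1 d2 d3
    · exact absurd (hN.2 m hm X u t t' h.gc hu h4 h5) hne

/-- Intersection of `v` and `k` is not on `l`. -/
theorem nB (h : Ctx m X l A) {u v k : Set Pt} (hv : Nu m X l A u v) (hk : Mx (m+2) X k) (hA : A ∈ k) {P : Pt} (hP : P ∈ X)
    (hPv : P ∈ v) (hPk : P ∈ k) : P ∉ l := by
  intro hPl
  obtain ⟨t, ht, -, hAt, hPt⟩ := hv.2.2.2 P hP hPv hPl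
  exact h.h2 k t hk ht (by rintro rfl; exact hAt hA) P hP hPk hPt hPl

end Ctx

section
variable {m : ℕ} {X : Finset Pt}

theorem nPP (h : GC (m+2) X) {u u' k P Q} (hu : Mx (m+2) X u) (hu' : Mx (m+2) X u') (hk : Mx (m+2) X k)
    (h1 : u ≠ u') (h2 : u ≠ k) (h3 : u' ≠ k) (hP : P ∈ u) (hPk : P ∈ k) (hQ : Q ∈ u') : P ≠ Q := by
  rintro rfl
  exact mx_concur h hu hu' hk h1 h2 h3 hP hQ hPk

theorem nFP (h : GC (m+2) X) {u v u' k P Q} (hu : Mx (m+2) X u) (hv : New (m+1) X u v) (hu' : Mx (m+2) X u')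
    (hk : Mx (m+2) X k) (h1 : u ≠ u') (h2 : u ≠ k) (h3 : u' ≠ k) (hP : P ∈ v) (hPk : P ∈ k) (hQ : Q ∈ u') : P ≠ Q := by
  rintro rfl
  exact mx_concur (gc_del h hu) hv.1 (mx_del h hu hu' h1) (mx_del h hu hk h2) (new_ne_mx h hu hv hu') (new_ne_mx h hu hv hk) h3
    hP hQ hPk

theorem nFP' {u v P Q} (hv : New (m+1) X u v) (hP : P ∈ v) (hPX : P ∈ X) (hQ : Q ∈ u) : P ≠ Q := by
  rintro rfl
  exact hv.2 P hPX hQ hP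

theorem vne (h : GC (m+2) X) {u v u' v'} (hu : Mx (m+2) X u) (hv : New (m+1) X u v) (hu' : Mx (m+2) X u')
    (hv' : New (m+1) X u' v') (h1 : u ≠ u') : v ≠ v' := by
  rintro rfl
  obtain ⟨P, hP, a, b, -⟩ := new_meet h hu hv hu' h1
  exact hv'.2 P hP b a

theorem nFF (h : GC (m+3) X) {u v u' v' k P Q} (hu : Mx (m+3) X u) (hv : New (m+2) X u v) (hu' : Mx (m+3) X u')
    (hv' : New (m+2) X u' v') (hk : Mx (m+3) X k) (h1 : u ≠ u') (h2 : u ≠ k) (h3 : u' ≠ k) (hP : P ∈ v) (hPk : P ∈ k)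
    (hQ : Q ∈ v') : P ≠ Q := by
  rintro rfl
  have g := gc_del (gc_del h hu) (mx_del h hu hu' h1)
  have k1 := mx_del (gc_del h hu) (mx_del h hu hu' h1) (mx_del h hu hk h2) h3
  have w1 := (new_stab h hu hv hu' h1).1
  have w2 := (new_stab h hu' hv' hu h1.symm).1
  rw [del_comm] at w1
  exact mx_concur g w1 w2 k1 (vne (m := m+1) h hu hv hu' hv' h1) (new_ne_mx h hu hv hk) (new_ne_mx h hu' hv' hk) hP hQ hPk

end
end GCW

namespace GCW
open Classical

theorem ff4 {N n X} {k : Fin 4 → Set Pt} (hN : Good N) (hn : n + 1 ≤ N) (hX : GC (n+1) X) (inj : Function.Injective k)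
    (hk : ∀ i, Mx (n+1) X (k i)) (hv : ∀ i, ∃ v, New n X (k i) v) : False := by
  choose v hv using hv
  exact FF hN n hn X k v ⟨hX, fun i j hij => inj.ne hij, hk, hv⟩

theorem inj4 {u1 u2 u3 k : Set Pt} (h12 : u1 ≠ u2) (h13 : u1 ≠ u3) (h23 : u2 ≠ u3) (h1 : u1 ≠ k) (h2 : u2 ≠ k)
    (h3 : u3 ≠ k) : Function.Injective ![u1, u2, u3, k] := by
  have := h12.symm
  have := h13.symm
  have := h23.symm
  have := h1.symm
  have := h2.symm
  have := h3.symm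
  intro i j hij
  fin_cases i <;> fin_cases j <;> simp_all

theorem all4 {u1 u2 u3 k : Set Pt} {p : Set Pt → Prop} (h1 : p u1) (h2 : p u2) (h3 : p u3) (h4 : p k) :
    ∀ i, p (![u1, u2, u3, k] i) := by
  intro i
  fin_cases i
  · exact h1
  · exact h2
  · exact h3
  · exact h4

theorem tri_of {n X u1 u2 u3 k} (hX : GC (n+1) X) (hk : Mx (n+1) X k) (hno : ¬ ∃ v, New n X k v)
    (h1 : Mx (n+1) X u1) (h2 : Mx (n+1) X u2) (h3 : Mx (n+1) X u3) (h12 : u1 ≠ u2) (h13 : u1 ≠ u3) (h23 : u2 ≠ u3)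
    (k1 : u1 ≠ k) (k2 : u2 ≠ k) (k3 : u3 ≠ k) (all : ∀ t, Mx (n+1) X t → t = u1 ∨ t = u2 ∨ t = u3 ∨ t = k) :
    Tri n (X ⊟ k) u1 u2 u3 := by
  refine ⟨gc_del hX hk, h12, h13, h23, mx_del hX hk h1 k1.symm, mx_del hX hk h2 k2.symm, mx_del hX hk h3 k3.symm, ?_⟩
  intro t ht
  rcases mx_del_cases hk.1 ht with h | h
  · rcases all t h with e | e | e | e
    · exact Or.inl e
    · exact Or.inr (Or.inl e)
    · exact Or.inr (Or.inr e)
    · exact absurd e.symm (mx_ne_del ht)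
  · exact absurd ⟨t, h⟩ hno

theorem pts {m X u v k} (hX : GC (m+2) X) (hu : Mx (m+2) X u) (hv : New (m+1) X u v) (hk : Mx (m+2) X k) (hne : u ≠ k) :
    ∃ P F, (P ∈ X ∧ P ∈ k) ∧ P ∈ u ∧ (F ∈ X ∧ F ∈ k) ∧ F ∈ v := by
  obtain ⟨P, hP, a, b⟩ := mx_meet hX hu hk hne
  obtain ⟨F, hF, c, d, -⟩ := new_meet hX hu hv hk hne
  exact ⟨P, F, ⟨hP, b⟩, a, ⟨hF, d⟩, c⟩

namespace Ctx
variable {N m : ℕ} {X : Finset Pt} {l : Set Pt} {A : Pt}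

theorem neK {k u : Set Pt} (hk : A ∈ k) (hu : A ∉ u) : u ≠ k := by rintro rfl; exact hu hk

/-- counting on `k` with three lines `u` avoiding `A`, and possibly one further line `k'` -/
theorem count3 (h : Ctx m X l A) {u1 u2 u3 v1 v2 v3 k : Set Pt} (hu1 : Mx (m+2) X u1) (hu2 : Mx (m+2) X u2)
    (hu3 : Mx (m+2) X u3) (a1 : A ∉ u1) (a2 : A ∉ u2) (a3 : A ∉ u3) (h12 : u1 ≠ u2) (h13 : u1 ≠ u3) (h23 : u2 ≠ u3)
    (hv1 : Nu m X l A u1 v1) (hv2 : Nu m X l A u2 v2) (hv3 : Nu m X l A u3 v3)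
    (hk : Mx (m+2) X k) (ak : A ∈ k) :
    4 ≤ m ∧ ((∃ k', Mx (m+2) X k' ∧ A ∈ k' ∧ k' ≠ k) → 5 ≤ m) := by
  have e1 := neK ak a1
  have e2 := neK ak a2
  have e3 := neK ak a3
  obtain ⟨P1, F1, p1, q1, f1, g1⟩ := pts h.gc hu1 hv1.1 hk e1
  obtain ⟨P2, F2, p2, q2, f2, g2⟩ := pts h.gc hu2 hv2.1 hk e2
  obtain ⟨P3, F3, p3, q3, f3, g3⟩ := pts h.gc hu3 hv3.1 hk e3
  obtain ⟨B, hB, b1, b2⟩ := h.h1 k hk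
  have x12 : P1 ≠ P2 := nPP h.gc hu1 hu2 hk h12 e1 e2 q1 p1.2 q2
  have x13 : P1 ≠ P3 := nPP h.gc hu1 hu3 hk h13 e1 e3 q1 p1.2 q3
  have x23 : P2 ≠ P3 := nPP h.gc hu2 hu3 hk h23 e2 e3 q2 p2.2 q3
  have y11 : P1 ≠ F1 := (nFP' hv1.1 g1 f1.1 q1).symm
  have y22 : P2 ≠ F2 := (nFP' hv2.1 g2 f2.1 q2).symm
  have y33 : P3 ≠ F3 := (nFP' hv3.1 g3 f3.1 q3).symm
  have y12 : P1 ≠ F2 := (nFP h.gc hu2 hv2.1 hu1 hk h12.symm e2 e1 g2 f2.2 q1).symm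
  have y13 : P1 ≠ F3 := (nFP h.gc hu3 hv3.1 hu1 hk h13.symm e3 e1 g3 f3.2 q1).symm
  have y23 : P2 ≠ F3 := (nFP h.gc hu3 hv3.1 hu2 hk h23.symm e3 e2 g3 f3.2 q2).symm
  have y21 : P2 ≠ F1 := (nFP h.gc hu1 hv1.1 hu2 hk h12 e1 e2 g1 f1.2 q2).symm
  have y31 : P3 ≠ F1 := (nFP h.gc hu1 hv1.1 hu3 hk h13 e1 e3 g1 f1.2 q3).symm
  have y32 : P3 ≠ F2 := (nFP h.gc hu2 hv2.1 hu3 hk h23 e2 e3 g2 f2.2 q3).symm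
  have c4 := nodes_le hk [P1, P2, P3, F1] (by simp [x12, x13, x23, y11, y21, y31])
    (by simp [p1, p2, p3, f1])
  simp only [List.length_cons, List.length_nil] at c4
  obtain ⟨m, rfl⟩ : ∃ w, m = w + 1 := ⟨m - 1, by omega⟩
  have z12 : F1 ≠ F2 := nFF h.gc hu1 hv1.1 hu2 hv2.1 hk h12 e1 e2 g1 f1.2 g2
  have z13 : F1 ≠ F3 := nFF h.gc hu1 hv1.1 hu3 hv3.1 hk h13 e1 e3 g1 f1.2 g3
  have z23 : F2 ≠ F3 := nFF h.gc hu2 hv2.1 hu3 hv3.1 hk h23 e2 e3 g2 f2.2 g3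
  have w1 : P1 ≠ B := by rintro rfl; exact h.h2 u1 k hu1 hk e1 P1 hB q1 b1 b2
  have w2 : P2 ≠ B := by rintro rfl; exact h.h2 u2 k hu2 hk e2 P2 hB q2 b1 b2
  have w3 : P3 ≠ B := by rintro rfl; exact h.h2 u3 k hu3 hk e3 P3 hB q3 b1 b2
  have t1 : F1 ≠ B := by rintro rfl; exact h.nB hv1 hk ak hB g1 b1 b2
  have t2 : F2 ≠ B := by rintro rfl; exact h.nB hv2 hk ak hB g2 b1 b2
  have t3 : F3 ≠ B := by rintro rfl; exact h.nB hv3 hk ak hB g3 b1 b2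
  refine ⟨?_, ?_⟩
  · have c7 := nodes_le hk [P1, P2, P3, F1, F2, F3, B]
      (by simp [x12, x13, x23, y11, y12, y13, y21, y22, y23, y31, y32, y33, z12, z13, z23, w1, w2, w3, t1, t2, t3])
      (by simp [p1, p2, p3, f1, f2, f3, hB, b1])
    simp only [List.length_cons, List.length_nil] at c7
    omega
  · rintro ⟨k', hk', ak', hne⟩
    have e1' := neK ak' a1
    have e2' := neK ak' a2
    have e3' := neK ak' a3
    obtain ⟨Q, hQ, r1, r2⟩ := mx_meet h.gc hk' hk hne
    have s1 : Q ≠ P1 := nPP h.gc hk' hu1 hk e1'.symm hne e1 r1 r2 q1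
    have s2 : Q ≠ P2 := nPP h.gc hk' hu2 hk e2'.symm hne e2 r1 r2 q2
    have s3 : Q ≠ P3 := nPP h.gc hk' hu3 hk e3'.symm hne e3 r1 r2 q3
    have s4 : Q ≠ F1 := (nFP h.gc hu1 hv1.1 hk' hk e1' e1 hne g1 f1.2 r1).symm
    have s5 : Q ≠ F2 := (nFP h.gc hu2 hv2.1 hk' hk e2' e2 hne g2 f2.2 r1).symm
    have s6 : Q ≠ F3 := (nFP h.gc hu3 hv3.1 hk' hk e3' e3 hne g3 f3.2 r1).symm
    have s7 : Q ≠ B := by rintro rfl; exact h.h2 k' k hk' hk hne Q hB r1 b1 b2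
    have c7 := nodes_le hk [Q, P1, P2, P3, F1, F2, F3, B]
      (by simp [s1, s2, s3, s4, s5, s6, s7, x12, x13, x23, y11, y12, y13, y21, y22, y23, y31, y32, y33, z12, z13, z23, w1, w2, w3, t1, t2, t3])
      (by simp [p1, p2, p3, f1, f2, f3, hB, b1, hQ, r2])
    simp only [List.length_cons, List.length_nil] at c7
    omega

theorem case13 (h : Ctx m X l A) (hN : Good N) (hm : m + 2 ≤ N) (IH : DP (m+1)) {u1 u2 u3 k : Set Pt}
    (hu1 : Mx (m+2) X u1) (hu2 : Mx (m+2) X u2)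
    (hu3 : Mx (m+2) X u3) (a1 : A ∉ u1) (a2 : A ∉ u2) (a3 : A ∉ u3) (h12 : u1 ≠ u2) (h13 : u1 ≠ u3) (h23 : u2 ≠ u3)
    (hk : Mx (m+2) X k) (ak : A ∈ k) (all : ∀ t, Mx (m+2) X t → t = u1 ∨ t = u2 ∨ t = u3 ∨ t = k) : False := by
  obtain ⟨v1, hv1⟩ := h.nu hN hm IH hu1 a1
  obtain ⟨v2, hv2⟩ := h.nu hN hm IH hu2 a2
  obtain ⟨v3, hv3⟩ := h.nu hN hm IH hu3 a3
  have e1 := neK ak a1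
  have e2 := neK ak a2
  have e3 := neK ak a3
  have c := (h.count3 hu1 hu2 hu3 a1 a2 a3 h12 h13 h23 hv1 hv2 hv3 hk ak).1
  have hno : ¬ ∃ v, New (m+1) X k v := fun hv4 => ff4 hN hm h.gc (inj4 h12 h13 h23 e1 e2 e3) (all4 hu1 hu2 hu3 hk)
    (all4 (p := fun u => ∃ v, New (m+1) X u v) ⟨v1, hv1.1⟩ ⟨v2, hv2.1⟩ ⟨v3, hv3.1⟩ hv4)
  have t := tri_of h.gc hk hno hu1 hu2 hu3 h12 h13 h23 e1 e2 e3 all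
  obtain ⟨a, b, c', rfl, rfl, rfl, hL⟩ := lat_of hN (by omega) t
  have := (le5 hN hm (by omega) h.gc hk hL hu1 hu2 hu3).1
  omega

theorem case23 (h : Ctx m X l A) (hN : Good N) (hm : m + 2 ≤ N) (IH : DP (m+1)) {u1 u2 u3 k k' : Set Pt}
    (hu1 : Mx (m+2) X u1) (hu2 : Mx (m+2) X u2)
    (hu3 : Mx (m+2) X u3) (a1 : A ∉ u1) (a2 : A ∉ u2) (a3 : A ∉ u3) (h12 : u1 ≠ u2) (h13 : u1 ≠ u3) (h23 : u2 ≠ u3)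
    (hk : Mx (m+2) X k) (ak : A ∈ k) (hk' : Mx (m+2) X k') (ak' : A ∈ k') (hkk : k' ≠ k)
    (all : ∀ t, Mx (m+2) X t → t = u1 ∨ t = u2 ∨ t = u3 ∨ t = k' ∨ t = k) : False := by
  obtain ⟨v1, hv1⟩ := h.nu hN hm IH hu1 a1
  obtain ⟨v2, hv2⟩ := h.nu hN hm IH hu2 a2
  obtain ⟨v3, hv3⟩ := h.nu hN hm IH hu3 a3
  have e1 := neK ak a1
  have e2 := neK ak a2
  have e3 := neK ak a3
  have e1' := neK ak' a1
  have e2' := neK ak' a2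
  have e3' := neK ak' a3
  have c := (h.count3 hu1 hu2 hu3 a1 a2 a3 h12 h13 h23 hv1 hv2 hv3 hk ak).2 ⟨k', hk', ak', hkk⟩
  have hno : ¬ ∃ v, New (m+1) X k v := fun hv4 => ff4 hN hm h.gc (inj4 h12 h13 h23 e1 e2 e3) (all4 hu1 hu2 hu3 hk)
    (all4 (p := fun u => ∃ v, New (m+1) X u v) ⟨v1, hv1.1⟩ ⟨v2, hv2.1⟩ ⟨v3, hv3.1⟩ hv4)
  have G := gc_del h.gc hk
  have m1 := mx_del h.gc hk hu1 e1.symm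
  have m2 := mx_del h.gc hk hu2 e2.symm
  have m3 := mx_del h.gc hk hu3 e3.symm
  have m4 := mx_del h.gc hk hk' hkk.symm
  have hno' : ¬ ∃ v, New m (X ⊟ k) k' v := fun hv4 => ff4 hN (by omega) G (inj4 h12 h13 h23 e1' e2' e3') (all4 m1 m2 m3 m4)
    (all4 (p := fun u => ∃ v, New m (X ⊟ k) u v) ⟨v1, new_stab h.gc hu1 hv1.1 hk e1⟩ ⟨v2, new_stab h.gc hu2 hv2.1 hk e2⟩
      ⟨v3, new_stab h.gc hu3 hv3.1 hk e3⟩ hv4)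
  have t := tri_of G m4 hno' m1 m2 m3 h12 h13 h23 e1' e2' e3' (by
    intro t ht
    rcases mx_del_cases hk.1 ht with hh | hh
    · rcases all t hh with e | e | e | e | e
      · tauto
      · tauto
      · tauto
      · tauto
      · exact absurd e.symm (mx_ne_del ht)
    · exact absurd ⟨t, hh⟩ hno)
  obtain ⟨a, b, c', rfl, rfl, rfl, hL⟩ := lat_of hN (by omega) t
  have := (le5 hN (by omega) (by omega) G m4 hL m1 m2 m3).1
  omega

theorem count2 (h : Ctx m X l A) {u1 u2 k' v1 v2 k : Set Pt} (hu1 : Mx (m+2) X u1) (hu2 : Mx (m+2) X u2)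
    (a1 : A ∉ u1) (a2 : A ∉ u2) (h12 : u1 ≠ u2)
    (hv1 : Nu m X l A u1 v1) (hv2 : Nu m X l A u2 v2)
    (hk : Mx (m+2) X k) (ak : A ∈ k) (hk' : Mx (m+2) X k') (ak' : A ∈ k') (hne : k' ≠ k) : 3 ≤ m := by
  have e1 := neK ak a1
  have e2 := neK ak a2
  have e1' := neK ak' a1
  have e2' := neK ak' a2
  obtain ⟨P1, F1, p1, q1, f1, g1⟩ := pts h.gc hu1 hv1.1 hk e1
  obtain ⟨P2, F2, p2, q2, f2, g2⟩ := pts h.gc hu2 hv2.1 hk e2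
  obtain ⟨B, hB, b1, b2⟩ := h.h1 k hk
  obtain ⟨Q, hQ, r1, r2⟩ := mx_meet h.gc hk' hk hne
  have s1 : Q ≠ P1 := nPP h.gc hk' hu1 hk e1'.symm hne e1 r1 r2 q1
  have s2 : Q ≠ P2 := nPP h.gc hk' hu2 hk e2'.symm hne e2 r1 r2 q2
  have s4 : Q ≠ F1 := (nFP h.gc hu1 hv1.1 hk' hk e1' e1 hne g1 f1.2 r1).symm
  have s5 : Q ≠ F2 := (nFP h.gc hu2 hv2.1 hk' hk e2' e2 hne g2 f2.2 r1).symm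
  have s7 : Q ≠ B := by rintro rfl; exact h.h2 k' k hk' hk hne Q hB r1 b1 b2
  have x12 : P1 ≠ P2 := nPP h.gc hu1 hu2 hk h12 e1 e2 q1 p1.2 q2
  have y11 : P1 ≠ F1 := (nFP' hv1.1 g1 f1.1 q1).symm
  have y22 : P2 ≠ F2 := (nFP' hv2.1 g2 f2.1 q2).symm
  have y12 : P1 ≠ F2 := (nFP h.gc hu2 hv2.1 hu1 hk h12.symm e2 e1 g2 f2.2 q1).symm
  have y21 : P2 ≠ F1 := (nFP h.gc hu1 hv1.1 hu2 hk h12 e1 e2 g1 f1.2 q2).symm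
  have c4 := nodes_le hk [Q, P1, P2, F1] (by simp [x12, y11, y21, s1, s2, s4])
    (by simp [p1, p2, f1, hQ, r2])
  simp only [List.length_cons, List.length_nil] at c4
  obtain ⟨m, rfl⟩ : ∃ w, m = w + 1 := ⟨m - 1, by omega⟩
  have z12 : F1 ≠ F2 := nFF h.gc hu1 hv1.1 hu2 hv2.1 hk h12 e1 e2 g1 f1.2 g2
  have w1 : P1 ≠ B := by rintro rfl; exact h.h2 u1 k hu1 hk e1 P1 hB q1 b1 b2
  have w2 : P2 ≠ B := by rintro rfl; exact h.h2 u2 k hu2 hk e2 P2 hB q2 b1 b2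
  have t1 : F1 ≠ B := by rintro rfl; exact h.nB hv1 hk ak hB g1 b1 b2
  have t2 : F2 ≠ B := by rintro rfl; exact h.nB hv2 hk ak hB g2 b1 b2
  have c7 := nodes_le hk [Q, P1, P2, F1, F2, B]
    (by simp [s1, s2, s4, s5, s7, x12, y11, y12, y21, y22, z12, w1, w2, t1, t2])
    (by simp [p1, p2, f1, f2, hB, b1, hQ, r2])
  simp only [List.length_cons, List.length_nil] at c7
  omega

/-- degree five: the new line of `a 0` meets `l` on `b 0` -/
theorem five (h : Ctx 3 X l A) (hN : Good N) (hm : 5 ≤ N) (IH : DP 3) {a b c : ℕ → Set Pt} {v1 k : Set Pt}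
    (hu1 : Mx 5 X (a 0)) (hu2 : Mx 5 X (b 0)) (hk' : Mx 5 X (c 0)) (a1 : A ∉ a 0)
    (ak' : A ∈ c 0) (hv1 : Nu 3 X l A (a 0) v1) (hk : Mx 5 X k) (ak : A ∈ k) 
    (all : ∀ t, Mx 5 X t → t = a 0 ∨ t = b 0 ∨ t = c 0 ∨ t = k) (hL : Lat 4 (X ⊟ k) a b c) :
    v1 = a 1 ∧ ∃ P ∈ X, P ∈ a 1 ∧ P ∈ b 0 ∧ P ∈ l := by
  have e1 := neK ak a1
  have t0 := hL.tri 0 0 0 3 rfl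
  rw [R_0] at t0
  have ev : v1 = a 1 := by
    have n1 := new_stab h.gc hu1 hv1.1 hk e1
    have n2 := hL.na 0 0 0 2 rfl
    rw [R_0] at n2
    exact hN.2 2 (by omega) _ _ _ _ t0.gc t0.mp n1 n2
  refine ⟨ev, ?_⟩
  subst ev
  by_contra hcon
  have hd : ∀ P ∈ X, P ∈ a 1 → P ∉ l := by
    intro P hP hPa hPl
    obtain ⟨t, ht, htu, hAt, hPt⟩ := hv1.2.2.2 P hP hPa hPl
    rcases all t ht with e | e | e | e
    · exact htu e
    · exact hcon ⟨P, hP, hPa, e ▸ hPt, hPl⟩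
    · exact hAt (e ▸ ak')
    · exact hAt (e ▸ ak)
  have G1 := gc_del h.gc hu1
  have G := gc_del G1 hv1.1.1
  have hl1 : l ≠ a 0 := by rintro rfl; exact h.hl hu1
  have U1 := (use_del h.gc hu1 a1 hl1).1 h.use
  have U := (use_del G1 hv1.1.1 hv1.2.1 hv1.2.2.1.symm).1 U1
  have mxk : Mx 3 (X ⊟ a 0 ⊟ a 1) k := mx_del G1 hv1.1.1 (mx_del h.gc hu1 hk e1) (new_ne_mx h.gc hu1 hv1.1 hk)
  have n5 := (le5 hN hm (by omega) h.gc hk hL hu1 hu2 hk').2 rfl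
  have eR : R X a b c 2 0 0 = X ⊟ a 0 ⊟ a 1 := by rw [R_a, R_a, R_0]
  rw [eR] at n5
  have only : ∀ t, Mx 3 (X ⊟ a 0 ⊟ a 1) t → Mx 5 X t ∧ t ≠ a 0 := by
    intro t ht
    by_cases htk : t = k
    · rw [htk]; exact ⟨hk, e1.symm⟩
    have ht2 := mx_del G mxk ht (Ne.symm htk)
    have tr := hL.tri 2 0 0 1 rfl
    rw [← R_del, eR] at tr
    rcases tr.only t ht2 with e | e | e
    · rw [e] at ht; exact absurd ht n5
    · rw [e]; exact ⟨hu2, t0.pq.symm⟩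
    · rw [e]; exact ⟨hk', t0.pr.symm⟩
  rcases IH _ _ _ G U with h3 | ⟨t, ht, hd'⟩ | ⟨t, t', D, hne, ht, ht', hD, d1, d2, d3⟩
  · exact h.hl (only _ h3).1
  · obtain ⟨ht5, htne⟩ := only t ht
    obtain ⟨B, hB, b1, b2⟩ := h.h1 t ht5
    refine hd' B (mem_del.2 ⟨mem_del.2 ⟨hB, fun hBa => ?_⟩, fun hBa => hd B hB hBa b2⟩) b1 b2
    exact h.h2 t (a 0) ht5 hu1 htne B hB b1 hBa b2
  · exact h.h2 t t' (only t ht).1 (only t' ht').1 hne D (mem_del.1 (mem_del.1 hD).1).1 d1 d2 d3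

theorem case22 (h : Ctx m X l A) (hN : Good N) (hm : m + 2 ≤ N) (IH : DP (m+1)) (IH' : DP m) {u1 u2 k k' : Set Pt}
    (hu1 : Mx (m+2) X u1) (hu2 : Mx (m+2) X u2) (a1 : A ∉ u1) (a2 : A ∉ u2) (h12 : u1 ≠ u2)
    (hk : Mx (m+2) X k) (ak : A ∈ k) (hk' : Mx (m+2) X k') (ak' : A ∈ k') (hkk : k' ≠ k)
    (all : ∀ t, Mx (m+2) X t → t = u1 ∨ t = u2 ∨ t = k' ∨ t = k) (hno : ¬ ∃ v, New (m+1) X k v) : False := by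
  obtain ⟨v1, hv1⟩ := h.nu hN hm IH hu1 a1
  obtain ⟨v2, hv2⟩ := h.nu hN hm IH hu2 a2
  have e1 := neK ak a1
  have e2 := neK ak a2
  have e1' := neK ak' a1
  have e2' := neK ak' a2
  have cnt := h.count2 hu1 hu2 a1 a2 h12 hv1 hv2 hk ak hk' ak' hkk
  have t := tri_of h.gc hk hno hu1 hu2 hk' h12 e1' e2' e1 e2 hkk all
  obtain ⟨a, b, c, rfl, rfl, rfl, hL⟩ := lat_of hN (by omega) t
  have := (le5 hN hm (by omega) h.gc hk hL hu1 hu2 hk').1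
  have hm3 : m = 3 := by omega
  subst hm3
  obtain ⟨-, P, hP, pa, pb, pl⟩ := h.five hN hm IH' hu1 hu2 hk' a1 ak' hv1 hk ak all hL
  obtain ⟨-, Q, hQ, qb, qa, ql⟩ := h.five hN hm IH' hu2 hu1 hk' a2 ak' hv2 hk ak
    (fun t ht => by have := all t ht; tauto) hL.swap
  have key : ∀ (a b : ℕ → Set Pt) (P : Pt), Lat 4 (X ⊟ k) a b c → Mx 5 X (a 0) → Mx 5 X (b 0) → b 0 ≠ a 0 → b 0 ≠ c 0 →
      b 0 ≠ k → P ∈ X → P ∈ a 1 → P ∈ b 0 → P ∈ l → P ∈ c 3 ∧ P ∉ a 0 := by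
    intro a b P hL ha hb n1 n2 n3 hP pa pb pl
    have pna : P ∉ a 0 := fun hh => h.h2 _ _ hb ha n1 P hP pb hh pl
    have pnc : P ∉ c 0 := fun hh => h.h2 _ _ hb hk' n2 P hP pb hh pl
    have pnk : P ∉ k := fun hh => h.h2 _ _ hb hk n3 P hP pb hh pl
    obtain ⟨x, y, z, -, hs, hR⟩ := hL.exnode 4 0 0 0 rfl (by rw [R_0]; exact mem_del.2 ⟨hP, pnk⟩)
    obtain ⟨P', hP', ia, ib, ic⟩ := hL.node hs (by omega)
    have e : P = P' := by rw [hP', Finset.mem_singleton] at hR; exact hR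
    subst e
    have hR' := mem_R.1 hR
    have hy : y = 0 := by
      by_contra hy
      exact hR'.2.2.1 0 (by omega) pb
    have hx : x ≤ 1 := by
      by_contra hx
      exact hR'.2.1 1 (by omega) pa
    have hx0 : x ≠ 0 := by
      rintro rfl
      exact pna (ia (by omega))
    have hx1 : x = 1 := by omega
    have hz : z = 3 := by omega
    subst hx1 hz
    exact ⟨ic (by omega), pna⟩
  obtain ⟨p3, pna⟩ := key a b P hL hu1 hu2 h12.symm e2' e2 hP pa pb pl
  obtain ⟨q3, -⟩ := key b a Q hL.swap hu2 hu1 h12 e1' e1 hQ qb qa ql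
  have hl : l = c 3 := line_unique (use_isLine h.use).1 (hL.rot.rot.line (by omega))
    (show P ≠ Q by rintro rfl; exact pna qa) pl ql p3 q3
  obtain ⟨B, hB, b1, b2⟩ := h.h1 _ hk'
  have hBk : B ∉ k := fun hh => h.h2 _ _ hk' hk hkk B hB b1 hh b2
  exact Lat.ep 4 _ _ _ _ hL.rot.rot 3 (by omega) (by omega) B (mem_del.2 ⟨hB, hBk⟩) b1 (hl ▸ b2)

end Ctx
end GCW

namespace GCW
open Classical

theorem mx_finite {n X} (_hn : 0 < n) : {L | Mx n X L}.Finite := by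
  apply Set.Finite.of_finite_image (f := fun L => on X L)
  · apply Set.Finite.subset (X.powerset.finite_toSet)
    rintro _ ⟨L, -, rfl⟩
    simp only [Finset.coe_powerset, Set.mem_preimage, Set.mem_powerset_iff, Finset.coe_subset]
    intro P hP
    exact (mem_on.1 hP).1
  · intro L hL M hM e
    have hL : Mx n X L := hL
    have hM : Mx n X M := hM
    have e : on X L = on X M := e
    have h2 : 1 < (on X L).card := by rw [hL.2]; omega
    obtain ⟨P, hP, Q, hQ, hne⟩ := Finset.one_lt_card.1 h2
    have hP' := hP
    have hQ' := hQ
    rw [e] at hP' hQ'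
    exact line_unique hL.1 hM.1 hne (mem_on.1 hP).2 (mem_on.1 hQ).2 (mem_on.1 hP').2 (mem_on.1 hQ').2

theorem dich_main {N m X l A} (hN : Good N) (hm : m + 2 ≤ N) (IH : DP (m+1)) (IH' : DP m) (hX : GC (m+2) X)
    (hu : Use (m+2) X l A) : Dich (m+2) X l := by
  by_contra hcon
  have h : Ctx m X l A := by
    refine ⟨hX, hu, fun h => hcon (Or.inl h), fun t ht => ?_, fun t t' ht ht' hne D hD h1 h2 h3 => ?_⟩
    · by_contra! hh
      exact hcon (Or.inr (Or.inl ⟨t, ht, hh⟩))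
    · exact hcon (Or.inr (Or.inr ⟨t, t', D, hne, ht, ht', hD, h1, h2, h3⟩))
  obtain ⟨F, hF⟩ : ∃ F : Finset (Set Pt), ∀ t, t ∈ F ↔ Mx (m+2) X t :=
    ⟨(mx_finite (n := m+2) (X := X) (by omega)).toFinset, by simp⟩
  have h3 : 3 ≤ F.card := by
    obtain ⟨a, b, c, hab, hac, hbc, ha, hb, hc⟩ := hN.1 (m+2) hm X hX
    rw [← Finset.card_eq_three.2 ⟨a, b, c, hab, hac, hbc, rfl⟩]
    apply Finset.card_le_card
    intro t ht
    simp only [Finset.mem_insert, Finset.mem_singleton] at ht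
    rcases ht with rfl | rfl | rfl
    · exact (hF _).2 ha
    · exact (hF _).2 hb
    · exact (hF _).2 hc
  have h4 : 4 ≤ F.card := by
    by_contra hlt
    obtain ⟨a, b, c, hab, hac, hbc, e⟩ := Finset.card_eq_three.1 (show F.card = 3 by omega)
    have hF' : ∀ t, Mx (m+2) X t ↔ t = a ∨ t = b ∨ t = c := by
      intro t; rw [← hF, e]; simp
    have tr : Tri (m+2) X a b c := ⟨hX, hab, hac, hbc, (hF' _).2 (by tauto), (hF' _).2 (by tauto), (hF' _).2 (by tauto),
      fun t ht => (hF' t).1 ht⟩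
    obtain ⟨a', b', c', -, -, -, hL⟩ := lat_of hN hm tr
    exact hcon (dich_lat (by omega) hL hu)
  have hsum := Finset.card_filter_add_card_filter_not (s := F) (fun t => A ∈ t)
  set K := F.filter (fun t => A ∈ t) with hK
  set U := F.filter (fun t => ¬ A ∈ t) with hU
  have mK : ∀ t, t ∈ K ↔ Mx (m+2) X t ∧ A ∈ t := by intro t; rw [hK, Finset.mem_filter, hF]
  have mU : ∀ t, t ∈ U ↔ Mx (m+2) X t ∧ A ∉ t := by intro t; rw [hU, Finset.mem_filter, hF]
  have cK : K.card ≤ 2 := by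
    by_contra hlt
    obtain ⟨a, b, c, ha, hb, hc, hab, hac, hbc⟩ := Finset.two_lt_card_iff.1 (show 2 < K.card by omega)
    rw [mK] at ha hb hc
    exact mx_concur hX ha.1 hb.1 hc.1 hab hac hbc ha.2 hb.2 hc.2
  have cU : U.card ≤ 3 := by
    by_contra hlt
    obtain ⟨S, hS, hc⟩ := Finset.exists_subset_card_eq (show 4 ≤ U.card by omega)
    let e := (Finset.equivFinOfCardEq hc).symm
    have he : ∀ i, Mx (m+2) X (e i : Set Pt) ∧ A ∉ (e i : Set Pt) := fun i => (mU _).1 (hS (e i).2)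
    refine ff4 (k := fun i => (e i : Set Pt)) hN hm hX (fun i j hij => e.injective (Subtype.ext hij)) (fun i => (he i).1) ?_
    intro i
    obtain ⟨v, hv⟩ := h.nu hN hm IH (he i).1 (he i).2
    exact ⟨v, hv.1⟩
  have split : ∀ t, Mx (m+2) X t → t ∈ U ∨ t ∈ K := by
    intro t ht
    by_cases hA : A ∈ t
    · exact Or.inr ((mK t).2 ⟨ht, hA⟩)
    · exact Or.inl ((mU t).2 ⟨ht, hA⟩)
  have two : K.card = 2 → ∃ k k', k' ≠ k ∧ K = {k', k} := by
    intro hc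
    obtain ⟨k, k', hne, e⟩ := Finset.card_eq_two.1 hc
    exact ⟨k', k, hne, e⟩
  by_cases hU3 : U.card = 3
  · obtain ⟨a, b, c, hab, hac, hbc, e⟩ := Finset.card_eq_three.1 hU3
    have ha := (mU a).1 (by rw [e]; simp)
    have hb := (mU b).1 (by rw [e]; simp)
    have hc := (mU c).1 (by rw [e]; simp)
    by_cases hK1 : K.card = 1
    · obtain ⟨k, ek⟩ := Finset.card_eq_one.1 hK1
      have hk := (mK k).1 (by rw [ek]; simp)
      refine h.case13 hN hm IH ha.1 hb.1 hc.1 ha.2 hb.2 hc.2 hab hac hbc hk.1 hk.2 ?_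
      intro t ht
      have := split t ht
      rw [e, ek] at this
      simp at this; tauto
    · obtain ⟨k, k', hne, ek⟩ := two (by omega)
      have hk := (mK k).1 (by rw [ek]; simp)
      have hk' := (mK k').1 (by rw [ek]; simp)
      refine h.case23 hN hm IH ha.1 hb.1 hc.1 ha.2 hb.2 hc.2 hab hac hbc hk.1 hk.2 hk'.1 hk'.2 hne ?_
      intro t ht
      have := split t ht
      rw [e, ek] at this
      simp at this; tauto
  · obtain ⟨a, b, hab, e⟩ := Finset.card_eq_two.1 (show U.card = 2 by omega)
    obtain ⟨k, k', hne, ek⟩ := two (by omega)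
    have ha := (mU a).1 (by rw [e]; simp)
    have hb := (mU b).1 (by rw [e]; simp)
    have hk := (mK k).1 (by rw [ek]; simp)
    have hk' := (mK k').1 (by rw [ek]; simp)
    have all : ∀ t, Mx (m+2) X t → t = a ∨ t = b ∨ t = k' ∨ t = k := by
      intro t ht
      have := split t ht
      rw [e, ek] at this
      simp at this; tauto
    obtain ⟨v1, hv1⟩ := h.nu hN hm IH ha.1 ha.2
    obtain ⟨v2, hv2⟩ := h.nu hN hm IH hb.1 hb.2
    by_cases hno : ∃ v, New (m+1) X k v
    · by_cases hno' : ∃ v, New (m+1) X k' v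
      · exact ff4 hN hm hX (inj4 hab (Ctx.neK hk'.2 ha.2) (Ctx.neK hk'.2 hb.2) (Ctx.neK hk.2 ha.2) (Ctx.neK hk.2 hb.2) hne)
          (all4 ha.1 hb.1 hk'.1 hk.1) (all4 (p := fun u => ∃ v, New (m+1) X u v) ⟨v1, hv1.1⟩ ⟨v2, hv2.1⟩ hno' hno)
      · exact h.case22 hN hm IH IH' ha.1 hb.1 ha.2 hb.2 hab hk'.1 hk'.2 hk.1 hk.2 hne.symm
          (fun t ht => by have := all t ht; tauto) hno'
    · exact h.case22 hN hm IH IH' ha.1 hb.1 ha.2 hb.2 hab hk.1 hk.2 hk'.1 hk'.2 hne all hno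

theorem dp {N} (hN : Good N) : ∀ n ≤ N, DP n := by
  intro n
  induction n using Nat.strong_induction_on with
  | _ n IH =>
  intro hn X l A hX hu
  match n, IH, hn, hX, hu with
  | 0, _, _, _, hu =>
    obtain ⟨-, T, hT, hl⟩ := hu
    have := List.length_eq_zero_iff.1 hT.1
    rw [this] at hl; simp at hl
  | 1, _, _, hX, hu => exact Or.inl (gc_one_max hX hu)
  | m + 2, IH, hn, hX, hu =>
    exact dich_main hN hn (IH (m+1) (by omega) (by omega)) (IH m (by omega) (by omega)) hX hu

noncomputable def usS (n : ℕ) (X : Finset Pt) (l : Set Pt) : Finset Pt := X.filter (Use n X l)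

theorem mem_usS {n X l A} : A ∈ usS n X l ↔ Use n X l A := by
  simp only [usS, Finset.mem_filter]
  exact ⟨fun h => h.2, fun h => ⟨h.1, h⟩⟩

theorem main {N} (hN : Good N) : ∀ n ≤ N, ∀ X l A, GC n X → Use n X l A →
    ∃ s : ℕ, 2 * (on X l).card ≤ s + n + 1 ∧ s ≤ (on X l).card ∧ 2 ≤ s ∧ GC (s - 2) (usS n X l) := by
  intro n
  induction n using Nat.strong_induction_on with
  | _ n IH =>
  intro hn X l A hX hu
  by_cases hMl : Mx n X l
  · have hn0 : n ≠ 0 := by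
      rintro rfl
      obtain ⟨-, T, hT, hl⟩ := hu
      have := List.length_eq_zero_iff.1 hT.1
      rw [this] at hl; simp at hl
    obtain ⟨m, rfl⟩ : ∃ w, n = w + 1 := ⟨n - 1, by omega⟩
    refine ⟨m + 2, by rw [hMl.2]; omega, by rw [hMl.2], by omega, ?_⟩
    have : usS (m+1) X l = X ⊟ l := by
      ext P; rw [mem_usS, use_max hX hMl, mem_del]
    rw [this]
    exact gc_del hX hMl
  obtain ⟨m, rfl⟩ : ∃ w, n = w + 1 := by
    rcases n with _ | m
    · obtain ⟨-, T, hT, hl⟩ := hu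
      have := List.length_eq_zero_iff.1 hT.1
      rw [this] at hl; simp at hl
    · exact ⟨m, rfl⟩
  rcases dp hN (m+1) hn X l A hX hu with h | ⟨t, ht, hd⟩ | ⟨t, t', D, hne, ht, ht', hD, d1, d2, d3⟩
  · exact absurd h hMl
  · have hlt : l ≠ t := by rintro rfl; exact hMl ht
    have e1 : on (X ⊟ t) l = on X l := by
      ext P; simp only [mem_on, mem_del]
      exact ⟨fun h => ⟨h.1.1, h.2⟩, fun h => ⟨⟨h.1, fun hh => hd P h.1 hh h.2⟩, h.2⟩⟩
    have e2 : usS (m+1) X l = usS m (X ⊟ t) l := by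
      ext P; rw [mem_usS, mem_usS]
      constructor
      · intro hP; exact (use_del hX ht (use_disj ht hd hP) hlt).1 hP
      · intro hP
        exact (use_del hX ht (mem_del.1 hP.1).2 hlt).2 hP
    obtain ⟨s, s1, s2, s3, s4⟩ := IH m (by omega) (by omega) (X ⊟ t) l A (gc_del hX ht)
      ((use_del hX ht (use_disj ht hd hu) hlt).1 hu)
    rw [e1] at s1 s2
    exact ⟨s, by omega, s2, s3, by rw [e2]; exact s4⟩
  · have hlt : l ≠ t := by rintro rfl; exact hMl ht
    have hlt' : l ≠ t' := by rintro rfl; exact hMl ht'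
    have off : ∀ P, Use (m+1) X l P → P ∉ t ∧ P ∉ t' := fun P hP =>
      ⟨use_pair ht ht' hne hlt' hD d1 d2 d3 hP, use_pair ht' ht hne.symm hlt hD d2 d1 d3 hP⟩
    have G := gc_del hX ht
    have ht2 := mx_del hX ht ht' hne
    have hm0 : m ≠ 0 := by
      rintro rfl
      exact hMl (gc_one_max hX hu)
    obtain ⟨m, rfl⟩ : ∃ w, m = w + 1 := ⟨m - 1, by omega⟩
    have iff : ∀ P, Use (m+1+1) X l P ↔ Use m (X ⊟ t ⊟ t') l P := by
      intro P
      constructor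
      · intro hP
        exact (use_del G ht2 (off P hP).2 hlt').1 ((use_del hX ht (off P hP).1 hlt).1 hP)
      · intro hP
        have h1 := mem_del.1 hP.1
        exact (use_del hX ht (mem_del.1 h1.1).2 hlt).2 ((use_del G ht2 h1.2 hlt').2 hP)
    have e2 : usS (m+1+1) X l = usS m (X ⊟ t ⊟ t') l := by
      ext P; rw [mem_usS, mem_usS, iff]
    have hl := (use_isLine hu).1
    have e1 : (on (X ⊟ t ⊟ t') l).card + 1 = (on X l).card := by
      rw [← card_on_del ht.1 hl hlt.symm hD d1 d3]
      congr 2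
      ext P
      simp only [mem_on, mem_del]
      refine ⟨fun h => ⟨h.1.1, h.2⟩, fun h => ⟨⟨h.1, fun hh => ?_⟩, h.2⟩⟩
      by_cases hPD : P = D
      · exact h.1.2 (hPD ▸ d1)
      · exact hlt' (line_unique hl ht'.1 hPD h.2 d3 hh d2)
    obtain ⟨s, s1, s2, s3, s4⟩ := IH m (by omega) (by omega) _ l A (gc_del G ht2) ((iff A).1 hu)
    exact ⟨s, by omega, by omega, s3, by rw [e2]; exact s4⟩

theorem on_nodes (X : Finset Pt) (p : Poly2) : on X (zeroSet p) = nodesOn X p := by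
  ext P; simp [nodesOn, zeroSet]

theorem final (n k : ℕ) (hGM : ∀ m ≤ n, GM m) (X : Finset (ℝ × ℝ)) (hX : IsGC n X) (p : Poly2)
    (hl : IsKNodeLine X p k) (hne : usesSet n X p ≠ ∅) :
    ∃ s : ℕ, (2 * k : ℤ) - n - 1 ≤ (s : ℤ) ∧ s ≤ k ∧ 2 ≤ s ∧
      (usesSet n X p).card = s.choose 2 ∧ IsGC (s - 2) (usesSet n X p) := by
  have hN : Good n := good_of n (by
    intro m hm Y hY
    obtain ⟨q, hq⟩ := hGM m hm Y (gc_to hY)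
    exact ⟨zeroSet q, isLine_zeroSet hq.1, by rw [on_nodes]; exact hq.2⟩)
  have hG := gc_of hX
  have e : usesSet n X p = usS n X (zeroSet p) := by
    ext P
    rw [mem_usS]
    simp only [usesSet, Finset.mem_filter]
    constructor
    · rintro ⟨h1, h2⟩
      exact (use_iff hG h1 hl.1).1 h2
    · intro h
      exact ⟨h.1, (use_iff hG h.1 hl.1).2 h⟩
  obtain ⟨A, hA⟩ := Finset.nonempty_iff_ne_empty.2 hne
  rw [e, mem_usS] at hA
  obtain ⟨s, s1, s2, s3, s4⟩ := main hN n le_rfl X (zeroSet p) A hG hA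
  rw [on_nodes, hl.2] at s1 s2
  have := gc_to s4
  refine ⟨s, by omega, s2, s3, ?_, by rw [e]; exact this⟩
  rw [e, this.1.1]
  congr 1
  omega

end GCW

/-- Assuming GM up to degree `n`, for a `GC_n` set `X` and a `k`-node line `ℓ`
with `2 ≤ k ≤ n+1` and `X_ℓ ≠ ∅`, there is `s` with `2k - n - 1 ≤ s ≤ k`, `s ≥ 2`,
such that `|X_ℓ| = (s choose 2)` and `X_ℓ` is a `GC_{s-2}` set. -/
theorem stmt_3 (n k : ℕ) (hGM : ∀ m ≤ n, GM m)
    (X : Finset (ℝ × ℝ)) (hX : IsGC n X)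
    (ℓ : Poly2) (hk2 : 2 ≤ k) (hkn : k ≤ n + 1) (hℓ : IsKNodeLine X ℓ k)
    (hne : usesSet n X ℓ ≠ ∅) :
    ∃ s : ℕ, (2 * k : ℤ) - n - 1 ≤ (s : ℤ) ∧ s ≤ k ∧ 2 ≤ s ∧
      (usesSet n X ℓ).card = s.choose 2 ∧
      IsGC (s - 2) (usesSet n X ℓ) := by
  exact GCW.final n k hGM X hX ℓ hℓ hne
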